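/- arXiv:dg-ga/9609003 — 10 statements merged into one kernel-verified Lean document; each statement's English description precedes it below -/
import Mathlib

section
/- Let A be an n×n Hermitian positive semidefinite matrix with integer entries, and let K ≥ 1 be a real number with ‖A‖ ≤ K². Then for every λ with 0 < λ < 1 one has E_A(λ) − E_A(0) ≤ n · log(K²)/(−log λ). -/
open scoped ComplexOrder

open Polynomial in
lemma norm_trailingCoeff_prod {ι : Type*} (s : Finset ι) (f : ι → ℝ) (hf : ∀ i, 0 ≤ f i) :
    Real.log ‖(∏ i ∈ s, (X - C ((f i : ℝ) : ℂ))).trailingCoeff‖ = ∑ i ∈ s, Real.log (f i) := by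
  classical
  induction s using Finset.induction_on with
  | empty => simp [Polynomial.trailingCoeff]
  | insert a s ha ih =>
    have hne : (∏ i ∈ s, (X - C ((f i : ℝ) : ℂ))).trailingCoeff ≠ 0 := by
      rw [Ne, Polynomial.trailingCoeff_eq_zero]
      exact Finset.prod_ne_zero_iff.mpr fun i _ => X_sub_C_ne_zero _
    have h1 : (X - C ((f a : ℝ) : ℂ)).trailingCoeff ≠ 0 := by
      rw [Ne, Polynomial.trailingCoeff_eq_zero]
      exact X_sub_C_ne_zero _
    rw [Finset.prod_insert ha, Finset.sum_insert ha, Polynomial.trailingCoeff_mul, norm_mul,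
      Real.log_mul (norm_ne_zero_iff.mpr h1) (norm_ne_zero_iff.mpr hne), ih]
    congr 1
    by_cases h0 : f a = 0
    · simp [h0, Polynomial.trailingCoeff]
    · have : (X - C ((f a : ℝ) : ℂ)).natTrailingDegree = 0 := by
        apply Nat.eq_zero_of_le_zero
        apply Polynomial.natTrailingDegree_le_of_ne_zero
        simpa using h0
      rw [Polynomial.trailingCoeff, this]
      simp [abs_of_nonneg (hf a)]

lemma sum_log_eigenvalues_nonneg {n : ℕ} {A : Matrix (Fin n) (Fin n) ℂ}
    (hA : A.PosSemidef) (hint : ∀ i j, ∃ z : ℤ, A i j = (z : ℂ)) :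
    0 ≤ ∑ i, Real.log (hA.1.eigenvalues i) := by
  choose B hB using hint
  have hAB : A = (Matrix.of B).map (Int.castRingHom ℂ) := by
    ext i j; simp [hB]
  have hc : A.charpoly = (Matrix.of B).charpoly.map (Int.castRingHom ℂ) := by
    rw [← Matrix.charpoly_map, ← hAB]
  rw [← norm_trailingCoeff_prod Finset.univ hA.1.eigenvalues hA.eigenvalues_nonneg]
  have h2 := hA.1.charpoly_eq
  have hne : A.charpoly.trailingCoeff ≠ 0 := by
    rw [Ne, Polynomial.trailingCoeff_eq_zero]
    exact (Matrix.charpoly_monic A).ne_zero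
  have h3 : 1 ≤ ‖A.charpoly.trailingCoeff‖ := by
    rw [Polynomial.trailingCoeff] at hne ⊢
    generalize A.charpoly.natTrailingDegree = k at hne ⊢
    rw [hc, Polynomial.coeff_map] at hne ⊢
    generalize (Matrix.of B).charpoly.coeff k = z at hne ⊢
    have hz : z ≠ 0 := by rintro rfl; simp at hne
    have := Int.one_le_abs hz
    simp only [eq_intCast, Complex.norm_intCast]
    exact_mod_cast this
  rw [h2] at h3
  exact Real.log_nonneg h3

lemma eigenvalue_le_norm {n : ℕ} {A : Matrix (Fin n) (Fin n) ℂ}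
    (hA : A.PosSemidef) (i : Fin n) :
    hA.1.eigenvalues i ≤ ‖Matrix.toEuclideanCLM (𝕜 := ℂ) A‖ := by
  have h := (Matrix.toEuclideanCLM (𝕜 := ℂ) A).le_opNorm (hA.1.eigenvectorBasis i)
  have h2 : Matrix.toEuclideanCLM (𝕜 := ℂ) A (hA.1.eigenvectorBasis i)
      = ((hA.1.eigenvalues i : ℝ) : ℂ) • hA.1.eigenvectorBasis i := by
    apply (WithLp.equiv 2 (Fin n → ℂ)).injective
    have := hA.1.mulVec_eigenvectorBasis i
    ext j
    have := congrFun this j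
    simpa using this
  rw [h2, norm_smul] at h
  simpa [abs_of_nonneg (hA.eigenvalues_nonneg i)] using h

/-- Let `A` be an `n × n` Hermitian positive semidefinite matrix with integer entries and
let `K ≥ 1` satisfy `‖A‖ ≤ K²`.  Then for every `0 < λ < 1`,
`E_A(λ) − E_A(0) ≤ n · log K² / (−log λ)`, where `E_A(λ)` is the number of eigenvalues
`μ ≤ λ` of `A`, counted with multiplicity. -/
theorem eigenvalue_counting_estimate_matrix
    {n : ℕ} {A : Matrix (Fin n) (Fin n) ℂ}
    (hA : A.PosSemidef)
    (hint : ∀ i j, ∃ z : ℤ, A i j = (z : ℂ))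
    (K : ℝ) (hK : 1 ≤ K) (hnorm : ‖Matrix.toEuclideanCLM (𝕜 := ℂ) A‖ ≤ K ^ 2)
    (E : ℝ → ℕ)
    (hE : ∀ lam : ℝ, E lam = (Finset.univ.filter fun i : Fin n =>
      hA.1.eigenvalues i ≤ lam).card)
    (lam : ℝ) (hlam0 : 0 < lam) (hlam1 : lam < 1) :
    (E lam : ℝ) - E 0 ≤ n * Real.log (K ^ 2) / (-Real.log lam) := by
  have hs := sum_log_eigenvalues_nonneg hA hint
  have hK2 : 0 ≤ Real.log (K ^ 2) := Real.log_nonneg (one_le_pow₀ hK)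
  have hl : Real.log lam < 0 := Real.log_neg hlam0 hlam1
  have hb : ∀ i, Real.log (hA.1.eigenvalues i) ≤
      ((if hA.1.eigenvalues i ≤ lam then (1 : ℝ) else 0)
        - (if hA.1.eigenvalues i ≤ 0 then (1 : ℝ) else 0)) * Real.log lam + Real.log (K ^ 2) := by
    intro i
    have h0 := hA.eigenvalues_nonneg i
    have h1 := (eigenvalue_le_norm hA i).trans hnorm
    generalize hA.1.eigenvalues i = x at h0 h1 ⊢
    rcases h0.eq_or_lt with rfl | hx
    · simp [hlam0.le]
      simpa using hK2
    · rw [if_neg hx.not_ge]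
      split_ifs with hxl
      · have := Real.log_le_log hx hxl
        linarith
      · have := Real.log_le_log hx h1
        linarith
  have hsum := hs.trans (Finset.sum_le_sum fun i _ => hb i)
  rw [Finset.sum_add_distrib, ← Finset.sum_mul, Finset.sum_sub_distrib, Finset.sum_boole,
    Finset.sum_boole, ← hE, ← hE] at hsum
  rw [le_div_iff₀ (by linarith)]
  simp only [Finset.sum_const, Finset.card_univ, Fintype.card_fin, nsmul_eq_mul] at hsum
  linarith
end

section
/- Let I be a set equipped with a metric d, let A be a bounded linear operator on ℓ²(I) with ⟨Aδ_σ, δ_τ⟩ = 0 whenever d(σ,τ) > 1, let s ⊆ I be a finite subset, and let B be a linear endomorphism of ℓ²(s) with ⟨Bδ_σ, δ_τ⟩ = 0 whenever σ, τ ∈ s and d(σ,τ) > 1. Assume that ⟨Aδ_σ, δ_τ⟩ = ⟨Bδ_σ, δ_τ⟩ for all σ, τ ∈ s such that d(σ, I∖s) > 1 or d(τ, I∖s) > 1. Then for every integer k ≥ 1 and every σ ∈ s with d(σ, I∖s) > k one has ⟨A^k δ_σ, δ_σ⟩ = ⟨B^k δ_σ, δ_σ⟩. -/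
/-- The standard basis vector `δ_σ` of `ℓ²(I)`. -/
noncomputable def delta {I : Type*} [DecidableEq I] (σ : I) : lp (fun _ : I => ℂ) 2 :=
  lp.single 2 σ 1

/-- **Lemma 2.3 (principle of not feeling the boundary).**  Let `A` be a bounded operator on
`ℓ²(I)` whose matrix entries vanish at distance `> 1`, let `s ⊆ I` be finite, and let `B` be
an endomorphism of `ℓ²(s)` (given by its matrix) whose entries vanish at distance `> 1`.
If the matrix entries of `A` and `B` agree at all pairs `(σ,τ)` in `s` with `σ` or `τ` at
distance `> 1` from `I ∖ s`, then for every `k ≥ 1` and every `σ ∈ s` with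
`d(σ, I∖s) > k` one has `⟨A^k δ_σ, δ_σ⟩ = ⟨B^k δ_σ, δ_σ⟩`. -/
theorem not_feeling_the_boundary
    {I : Type*} [MetricSpace I] [DecidableEq I]
    (A : lp (fun _ : I => ℂ) 2 →L[ℂ] lp (fun _ : I => ℂ) 2)
    (hAloc : ∀ σ τ : I, 1 < dist σ τ → (A (delta σ) : ∀ _ : I, ℂ) τ = 0)
    (s : Finset I)
    (B : Matrix s s ℂ)
    (hBloc : ∀ σ τ : s, 1 < dist (σ : I) (τ : I) → B σ τ = 0)
    (hagree : ∀ σ τ : s,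
      ((∀ ρ : I, ρ ∉ s → 1 < dist (σ : I) ρ) ∨ (∀ ρ : I, ρ ∉ s → 1 < dist (τ : I) ρ)) →
      (A (delta (σ : I)) : ∀ _ : I, ℂ) (τ : I) = B σ τ)
    (k : ℕ) (hk : 1 ≤ k)
    (σ : s) (hσ : ∀ ρ : I, ρ ∉ s → (k : ℝ) < dist (σ : I) ρ) :
    ((A ^ k) (delta (σ : I)) : ∀ _ : I, ℂ) (σ : I) = (B ^ k) σ σ := by
  have hloc : ∀ j : ℕ, ∀ τ : s, (j : ℝ) < dist (σ : I) (τ : I) → (B ^ j) σ τ = 0 := by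
    intro j
    induction j with
    | zero =>
      intro τ h
      rw [pow_zero, Matrix.one_apply_ne]
      rintro rfl
      simp at h
    | succ j ih =>
      intro τ h
      rw [pow_succ, Matrix.mul_apply]
      apply Finset.sum_eq_zero
      intro υ _
      by_cases h1 : (j : ℝ) < dist (σ : I) (υ : I)
      · rw [ih υ h1, zero_mul]
      · rw [hBloc υ τ, mul_zero]
        have := dist_triangle (σ : I) (υ : I) (τ : I)
        push_cast at h
        linarith
  have hstep : ∀ τ : s, (∀ ρ : I, ρ ∉ s → 1 < dist (τ : I) ρ) →
      A (delta (τ : I)) = ∑ υ : s, B τ υ • delta (υ : I) := by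
    intro τ h
    ext ρ
    rw [lp.coeFn_sum, Finset.sum_apply]
    by_cases hρ : ρ ∈ s
    · rw [Finset.sum_eq_single (⟨ρ, hρ⟩ : s)]
      · rw [← hagree τ ⟨ρ, hρ⟩ (Or.inl h)]
        simp [delta]
      · intro υ _ hne
        have : ρ ≠ (υ : I) := fun e => hne (Subtype.ext e.symm)
        simp [delta, this]
      · simp
    · rw [hAloc τ ρ (h ρ hρ), Finset.sum_eq_zero]
      intro υ _
      have : ρ ≠ (υ : I) := fun e => hρ (e ▸ υ.2)
      simp [delta, this]
  have main : ∀ j : ℕ, j ≤ k →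
      (A ^ j) (delta (σ : I)) = ∑ τ : s, (B ^ j) σ τ • delta (τ : I) := by
    intro j
    induction j with
    | zero =>
      intro _
      simp [Matrix.one_apply]
    | succ j ih =>
      intro hj
      have hjk : (j : ℝ) + 1 ≤ k := by exact_mod_cast hj
      rw [pow_succ', ContinuousLinearMap.mul_apply, ih (by omega), map_sum]
      have : ∀ τ : s, A ((B ^ j) σ τ • delta (τ : I)) =
          ∑ υ : s, ((B ^ j) σ τ * B τ υ) • delta (υ : I) := by
        intro τ
        by_cases h1 : (j : ℝ) < dist (σ : I) (τ : I)
        · simp [hloc j τ h1]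
        · rw [map_smul, hstep τ, Finset.smul_sum]
          · simp only [smul_smul]
          · intro ρ hρ
            have := dist_triangle (σ : I) (τ : I) ρ
            have := hσ ρ hρ
            linarith
      simp only [this]
      rw [Finset.sum_comm]
      simp only [pow_succ, Matrix.mul_apply, Finset.sum_smul]
  rw [main k le_rfl, lp.coeFn_sum, Finset.sum_apply, Finset.sum_eq_single σ]
  · simp [delta]
  · intro υ _ hne
    have : (σ : I) ≠ (υ : I) := fun e => hne (Subtype.ext e.symm)
    simp [delta, this]
  · simp
end

section
/- In the Setting, for every polynomial p with real coefficients one has lim_{m→∞} (1/N_m)·Tr(p(Δ^(m))) = Σ_{σ∈𝓕} ⟨p(Δ)δ_σ, δ_σ⟩. -/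
open scoped ComplexOrder

open Filter

lemma hasSum_apply_delta {I : Type*} [DecidableEq I]
    (T : lp (fun _ : I => ℂ) 2 →L[ℂ] lp (fun _ : I => ℂ) 2)
    (f : lp (fun _ : I => ℂ) 2) (τ : I) :
    HasSum (fun ρ => (f : ∀ _ : I, ℂ) ρ * (T (delta ρ) : ∀ _ : I, ℂ) τ)
      ((T f : ∀ _ : I, ℂ) τ) := by
  have h := lp.hasSum_single (p := 2) (by simp) f
  have h2 := h.mapL ((lp.evalCLM ℂ (fun _ : I => ℂ) 2 τ).comp T)
  suffices e : (fun ρ => (f : ∀ _ : I, ℂ) ρ * (T (delta ρ) : ∀ _ : I, ℂ) τ) =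
      fun ρ => ((lp.evalCLM ℂ (fun _ : I => ℂ) 2 τ).comp T)
        (lp.single 2 ρ ((f : ∀ _ : I, ℂ) ρ)) by
    rw [e]
    exact h2
  funext ρ
  have : lp.single 2 ρ ((f : ∀ _ : I, ℂ) ρ) = (f : ∀ _ : I, ℂ) ρ • delta ρ := by
    rw [delta, ← lp.single_smul]; simp
  simp only [this, map_smul, smul_eq_mul]
  rfl

lemma pow_succ_entry {I : Type*} [DecidableEq I]
    (T : lp (fun _ : I => ℂ) 2 →L[ℂ] lp (fun _ : I => ℂ) 2) (n : ℕ) (σ τ : I) :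
    (((T ^ (n + 1)) (delta σ) : lp (fun _ : I => ℂ) 2) : ∀ _ : I, ℂ) τ =
      ∑' ρ, (T (delta σ) : ∀ _ : I, ℂ) ρ * ((T ^ n) (delta ρ) : ∀ _ : I, ℂ) τ := by
  rw [(hasSum_apply_delta (T ^ n) (T (delta σ)) τ).tsum_eq, pow_succ]
  rfl

lemma delta_entry {I : Type*} [DecidableEq I] (σ τ : I) :
    (delta σ : ∀ _ : I, ℂ) τ = if σ = τ then 1 else 0 := by
  rw [delta, lp.single_apply, Pi.single_apply]
  simp [eq_comm]

lemma pow_equiv {I : Type*} [DecidableEq I] {G : Type*} [Group G] [MulAction G I]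
    (T : lp (fun _ : I => ℂ) 2 →L[ℂ] lp (fun _ : I => ℂ) 2)
    (h : ∀ (g : G) (σ τ : I),
      (T (delta (g • σ)) : ∀ _ : I, ℂ) (g • τ) = (T (delta σ) : ∀ _ : I, ℂ) τ)
    (n : ℕ) (g : G) (σ τ : I) :
    ((T ^ n) (delta (g • σ)) : ∀ _ : I, ℂ) (g • τ) = ((T ^ n) (delta σ) : ∀ _ : I, ℂ) τ := by
  induction n generalizing σ τ with
  | zero => simp [delta_entry]
  | succ n ih =>
    rw [pow_succ_entry, pow_succ_entry, ← (MulAction.toPerm g).tsum_eq]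
    exact tsum_congr fun ρ => by simp only [MulAction.toPerm_apply, h, ih]

lemma entry_bound {I : Type*} [DecidableEq I]
    (T : lp (fun _ : I => ℂ) 2 →L[ℂ] lp (fun _ : I => ℂ) 2) (σ τ : I) :
    ‖(T (delta σ) : ∀ _ : I, ℂ) τ‖ ≤ ‖T‖ := by
  refine (lp.norm_apply_le_norm (by simp) _ τ).trans ((T.le_opNorm _).trans ?_)
  rw [delta, lp.norm_single (by simp)]
  simp

lemma matrix_bound {I : Type*} [MetricSpace I] [DecidableEq I] (C : ℝ) (b : ℕ) (hC : 0 < C)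
    (hballfin : ∀ σ : I, {τ : I | dist σ τ ≤ 1}.Finite)
    (hballcard : ∀ σ : I, {τ : I | dist σ τ ≤ 1}.ncard ≤ b)
    (Y : Finset I) (M : Matrix Y Y ℂ)
    (hint : ∀ σ τ : Y, ∃ z : ℤ, M σ τ = (z : ℂ) ∧ |(z : ℝ)| ≤ C)
    (hloc : ∀ σ τ : Y, 1 < dist (σ : I) (τ : I) → M σ τ = 0) (n : ℕ) (σ τ : Y) :
    ‖(M ^ n) σ τ‖ ≤ (C * b) ^ n := by
  induction n generalizing σ τ with
  | zero =>
    rw [pow_zero, pow_zero, Matrix.one_apply]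
    split_ifs <;> simp
  | succ n ih =>
    rw [pow_succ', Matrix.mul_apply]
    have hK : 0 ≤ (C * b) ^ n := by positivity
    have hle : ∀ ρ : Y, ‖M σ ρ * (M ^ n) ρ τ‖ ≤
        if dist (σ : I) ρ ≤ 1 then C * (C * b) ^ n else 0 := by
      intro ρ
      split_ifs with hd
      · rw [norm_mul]
        obtain ⟨z, hz, hzC⟩ := hint σ ρ
        refine mul_le_mul ?_ (ih ρ τ) (norm_nonneg _) hC.le
        rw [hz, Complex.norm_intCast]
        exact hzC
      · rw [hloc σ ρ (not_le.mp hd)]; simp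
    refine (norm_sum_le _ _).trans ((Finset.sum_le_sum fun ρ _ => hle ρ).trans ?_)
    rw [← Finset.sum_filter, Finset.sum_const, nsmul_eq_mul]
    have hcard : ((Finset.univ.filter fun ρ : Y => dist (σ : I) ρ ≤ 1).card) ≤ b := by
      refine le_trans ?_ (hballcard σ)
      rw [← Finset.card_map (Function.Embedding.subtype _), ← Set.ncard_coe_finset]
      refine Set.ncard_le_ncard ?_ (hballfin σ)
      intro x hx
      simp only [Finset.coe_map, Set.mem_image, Finset.mem_coe, Finset.mem_filter] at hx
      obtain ⟨y, hy, rfl⟩ := hx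
      exact hy.2
    calc _ ≤ (b : ℝ) * (C * (C * b) ^ n) := by
          refine mul_le_mul_of_nonneg_right (by exact_mod_cast hcard) (by positivity)
      _ = _ := by ring

lemma matrix_agree {I : Type*} [MetricSpace I] [DecidableEq I]
    (T : lp (fun _ : I => ℂ) 2 →L[ℂ] lp (fun _ : I => ℂ) 2)
    (hTloc : ∀ σ τ : I, 1 < dist σ τ → (T (delta σ) : ∀ _ : I, ℂ) τ = 0)
    (Y : Finset I) (M : Matrix Y Y ℂ)
    (hloc : ∀ σ τ : Y, 1 < dist (σ : I) (τ : I) → M σ τ = 0)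
    (hagree : ∀ σ τ : Y, (∀ ρ : I, ρ ∉ Y → 1 < dist (σ : I) ρ) →
      M σ τ = (T (delta (σ : I)) : ∀ _ : I, ℂ) (τ : I))
    (n : ℕ) (σ τ : Y) (hσ : ∀ ρ : I, ρ ∉ Y → (n : ℝ) < dist (σ : I) ρ) :
    (M ^ n) σ τ = ((T ^ n) (delta (σ : I)) : ∀ _ : I, ℂ) (τ : I) := by
  induction n generalizing σ τ with
  | zero =>
    rw [pow_zero, pow_zero, Matrix.one_apply]
    have h0 := delta_entry (σ : I) (τ : I)
    simp only [SetLike.coe_eq_coe] at h0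
    exact h0.symm
  | succ n ih =>
    have h1 : ∀ ρ : I, ρ ∉ Y → 1 < dist (σ : I) ρ := fun ρ hρ => by
      have := hσ ρ hρ
      push_cast at this
      have : (0 : ℝ) ≤ n := Nat.cast_nonneg n
      linarith
    rw [pow_succ_entry, pow_succ', Matrix.mul_apply, tsum_eq_sum (s := Y), ← Finset.sum_coe_sort Y
      (fun ρ => (T (delta (σ : I)) : ∀ _ : I, ℂ) ρ * ((T ^ n) (delta ρ) : ∀ _ : I, ℂ) τ)]
    · refine Finset.sum_congr rfl fun ρ _ => ?_
      by_cases hd : 1 < dist (σ : I) ρ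
      · rw [hloc _ _ hd, hTloc _ _ hd]; simp
      · rw [hagree σ ρ h1, ih ρ τ]
        intro x hx
        have := hσ x hx
        have h3 := dist_triangle (σ : I) ρ x
        push_cast at this
        linarith
    · intro ρ hρ
      rw [hTloc _ _ (h1 ρ hρ), zero_mul]

/-- **Lemma 2.3 (trace convergence).** In the amenable Setting, for every real polynomial
`p`, `(1/N_m)·Tr(p(Δ^(m)))` converges to `Σ_{σ∈𝓕} ⟨p(Δ)δ_σ, δ_σ⟩`. -/
theorem trace_convergence
    {I : Type*} [MetricSpace I] [Countable I] [DecidableEq I]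
    {G : Type*} [Group G] [Countable G] [MulAction G I]
    (hfree : ∀ (g : G) (σ : I), g • σ = σ → g = 1)
    (hiso : ∀ (g : G) (σ τ : I), dist (g • σ) (g • τ) = dist σ τ)
    (𝓕 : Finset I)
    (hfund : ∀ σ : I, ∃! τ : I, τ ∈ 𝓕 ∧ ∃ g : G, g • σ = τ)
    (C : ℝ) (b : ℕ) (hC : 0 < C) (hCb : 1 ≤ C * b)
    (hballfin : ∀ σ : I, {τ : I | dist σ τ ≤ 1}.Finite)
    (hballcard : ∀ σ : I, {τ : I | dist σ τ ≤ 1}.ncard ≤ b)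
    (Δ : lp (fun _ : I => ℂ) 2 →L[ℂ] lp (fun _ : I => ℂ) 2)
    (hΔpos : Δ.IsPositive)
    (hΔequiv : ∀ (g : G) (σ τ : I),
      (Δ (delta (g • σ)) : ∀ _ : I, ℂ) (g • τ) = (Δ (delta σ) : ∀ _ : I, ℂ) τ)
    (hΔint : ∀ σ τ : I, ∃ z : ℤ, (Δ (delta σ) : ∀ _ : I, ℂ) τ = (z : ℂ) ∧ |(z : ℝ)| ≤ C)
    (hΔloc : ∀ σ τ : I, 1 < dist σ τ → (Δ (delta σ) : ∀ _ : I, ℂ) τ = 0)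
    (Λ : ℕ → Finset G) (hΛ : ∀ m, (Λ m).Nonempty)
    (Y : ℕ → Finset I)
    (hY : ∀ m, Y m = (Λ m).biUnion fun g => 𝓕.image fun σ => g • σ)
    (hreg : ∀ k : ℕ, Filter.Tendsto
      (fun m => (({σ : I | σ ∈ Y m ∧ ∃ τ : I, τ ∉ Y m ∧ dist σ τ ≤ (k : ℝ)}.ncard : ℝ)
        / (Λ m).card)) Filter.atTop (nhds 0))
    (Δm : (m : ℕ) → Matrix (Y m) (Y m) ℂ)
    (hΔm : ∀ m, (Δm m).PosSemidef)
    (hΔmint : ∀ m, ∀ σ τ : Y m, ∃ z : ℤ, Δm m σ τ = (z : ℂ) ∧ |(z : ℝ)| ≤ C)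
    (hΔmloc : ∀ m, ∀ σ τ : Y m, 1 < dist (σ : I) (τ : I) → Δm m σ τ = 0)
    (hΔmagree : ∀ m, ∀ σ τ : Y m,
      ((∀ ρ : I, ρ ∉ Y m → 1 < dist (σ : I) ρ) ∨ (∀ ρ : I, ρ ∉ Y m → 1 < dist (τ : I) ρ)) →
      Δm m σ τ = (Δ (delta (σ : I)) : ∀ _ : I, ℂ) (τ : I))
    :
    ∀ p : Polynomial ℝ,
      Filter.Tendsto (fun m =>
          Matrix.trace (Polynomial.aeval (Δm m) (p.map (algebraMap ℝ ℂ))) / ((Λ m).card : ℂ))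
        Filter.atTop
        (nhds (∑ σ ∈ 𝓕,
          (Polynomial.aeval Δ (p.map (algebraMap ℝ ℂ)) (delta σ) : ∀ _ : I, ℂ) σ)) := by
  intro p
  have hinj : ∀ m, Set.InjOn (fun x : G × I => x.1 • x.2) ((Λ m ×ˢ 𝓕 : Finset (G × I)) : Set (G × I)) := by
    rintro m ⟨g, σ⟩ h1 ⟨g', σ'⟩ h2 h
    simp only [Finset.coe_product, Set.mem_prod, Finset.mem_coe] at h1 h2 h
    have hs : σ = σ' := (hfund (g • σ)).unique ⟨h1.2, g⁻¹, by simp⟩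
      ⟨h2.2, g'⁻¹, by rw [h]; simp⟩
    subst hs
    have : g'⁻¹ * g = 1 := hfree _ σ (by rw [mul_smul, h]; simp)
    rw [inv_mul_eq_one] at this
    rw [this]
  have hYim : ∀ m, Y m = (Λ m ×ˢ 𝓕).image (fun x : G × I => x.1 • x.2) := by
    intro m
    rw [hY]
    ext x
    simp only [Finset.mem_biUnion, Finset.mem_image, Finset.mem_product, Prod.exists]
    constructor
    · rintro ⟨g, hg, σ, hσ, rfl⟩; exact ⟨g, σ, ⟨hg, hσ⟩, rfl⟩
    · rintro ⟨g, σ, ⟨hg, hσ⟩, rfl⟩; exact ⟨g, hg, σ, hσ, rfl⟩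
  have hpow : ∀ n : ℕ, Tendsto (fun m => Matrix.trace ((Δm m) ^ n) / ((Λ m).card : ℂ)) atTop
      (nhds (∑ σ ∈ 𝓕, ((Δ ^ n) (delta σ) : ∀ _ : I, ℂ) σ)) := by
    intro n
    set L := ∑ σ ∈ 𝓕, ((Δ ^ n) (delta σ) : ∀ _ : I, ℂ) σ with hL
    have hsum : ∀ m, ∑ σ : Y m, ((Δ ^ n) (delta (σ : I)) : ∀ _ : I, ℂ) (σ : I)
        = (Λ m).card * L := by
      intro m
      rw [Finset.sum_coe_sort (Y m) (fun σ => ((Δ ^ n) (delta (σ : I)) : ∀ _ : I, ℂ) (σ : I)),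
        hYim m, Finset.sum_image (hinj m), Finset.sum_product]
      simp only [pow_equiv Δ hΔequiv]
      rw [Finset.sum_const, nsmul_eq_mul]
    rw [tendsto_iff_norm_sub_tendsto_zero]
    have hlim := (hreg n).const_mul ((C * b) ^ n + ‖Δ ^ n‖)
    rw [mul_zero] at hlim
    refine squeeze_zero (fun m => norm_nonneg _) (fun m => ?_) hlim
    have hN : (0 : ℝ) < (Λ m).card := by exact_mod_cast (hΛ m).card_pos
    have hNc : ((Λ m).card : ℂ) ≠ 0 := by exact_mod_cast (hΛ m).card_pos.ne'
    have e1 : Matrix.trace ((Δm m) ^ n) / ((Λ m).card : ℂ) - L =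
        (∑ σ : Y m, (((Δm m) ^ n) σ σ - ((Δ ^ n) (delta (σ : I)) : ∀ _ : I, ℂ) (σ : I)))
          / ((Λ m).card : ℂ) := by
      rw [Finset.sum_sub_distrib, hsum, sub_div, mul_div_cancel_left₀ _ hNc]
      rfl
    rw [e1, norm_div, Complex.norm_natCast, ← mul_div_assoc]
    refine div_le_div_of_nonneg_right ?_ hN.le
    set K := (C * b) ^ n + ‖Δ ^ n‖ with hK
    have hK0 : 0 ≤ K := by positivity
    classical
    have hle : ∀ σ : Y m,
        ‖((Δm m) ^ n) σ σ - ((Δ ^ n) (delta (σ : I)) : ∀ _ : I, ℂ) (σ : I)‖ ≤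
        if ∃ τ : I, τ ∉ Y m ∧ dist (σ : I) τ ≤ (n : ℝ) then K else 0 := by
      intro σ
      split_ifs with hd
      · exact (norm_sub_le _ _).trans (add_le_add
          (matrix_bound C b hC hballfin hballcard _ _ (hΔmint m) (hΔmloc m) n σ σ)
          (entry_bound _ _ _))
      · push Not at hd
        rw [matrix_agree Δ hΔloc (Y m) (Δm m) (hΔmloc m)
          (fun σ τ h => hΔmagree m σ τ (Or.inl h)) n σ σ hd, sub_self, norm_zero]
    refine (norm_sum_le _ _).trans ((Finset.sum_le_sum fun σ _ => hle σ).trans ?_)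
    rw [← Finset.sum_filter, Finset.sum_const, nsmul_eq_mul, mul_comm]
    refine mul_le_mul_of_nonneg_left ?_ hK0
    rw [← Finset.card_map (Function.Embedding.subtype _), ← Set.ncard_coe_finset]
    refine Nat.cast_le.mpr ?_
    refine Set.ncard_le_ncard ?_ ?_
    swap
    · exact (Y m).finite_toSet.subset (fun x hx => hx.1)
    intro x hx
    simp only [Finset.coe_map, Set.mem_image, Finset.mem_coe, Finset.mem_filter] at hx
    obtain ⟨y, hy, rfl⟩ := hx
    exact ⟨y.2, hy.2⟩
  induction p using Polynomial.induction_on' with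
  | add p q hp hq =>
    convert hp.add hq using 2
    · simp [add_div]
    · simp [Finset.sum_add_distrib]
  | monomial n a =>
    convert (hpow n).const_mul (a : ℂ) using 2
    · simp [Polynomial.aeval_monomial, Algebra.algebraMap_eq_smul_one, mul_div_assoc]
    · simp only [Polynomial.map_monomial, Polynomial.aeval_monomial,
        Finset.mul_sum, Complex.coe_algebraMap]
      rw [Algebra.algebraMap_eq_smul_one, smul_mul_assoc, one_mul]
      rfl
end

section
/- Let A be an n×n Hermitian positive semidefinite matrix with ‖A‖ ≤ K² for some K ≥ 1, let λ ≥ 0, and let p be a polynomial with real coefficients such that p(μ) ≥ 1 for all μ ∈ [0, λ] and p(μ) ≥ 0 for all μ ∈ [0, K²]. Then E_A(λ) ≤ Tr(p(A)). -/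
open scoped ComplexOrder

theorem trace_aeval_eq_sum_aux {n : ℕ} {A : Matrix (Fin n) (Fin n) ℂ} (hA : A.IsHermitian)
    (q : Polynomial ℂ) :
    Matrix.trace (Polynomial.aeval A q) = ∑ i, q.eval (hA.eigenvalues i : ℂ) := by
  have h1 : Polynomial.aeval A q = Unitary.conjStarAlgAut ℂ _ hA.eigenvectorUnitary
      (Polynomial.aeval (Matrix.diagonal (RCLike.ofReal ∘ hA.eigenvalues)) q) := by
    conv_lhs => rw [hA.spectral_theorem]
    exact Polynomial.aeval_algHom_apply
      (Unitary.conjStarAlgAut ℂ _ hA.eigenvectorUnitary).toAlgEquiv.toAlgHom _ q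
  have h2 : Polynomial.aeval
      (Matrix.diagonal (RCLike.ofReal ∘ hA.eigenvalues) : Matrix (Fin n) (Fin n) ℂ) q
      = Matrix.diagonal (fun i => q.eval (hA.eigenvalues i : ℂ)) := by
    have := Polynomial.aeval_algHom_apply (Matrix.diagonalAlgHom (n := Fin n) (α := ℂ) ℂ)
      (RCLike.ofReal ∘ hA.eigenvalues) q
    simp only [Matrix.diagonalAlgHom_apply] at this
    rw [this]
    congr 1
    ext i
    rw [Polynomial.aeval_pi_apply₂]
    simp [Polynomial.aeval_def, Polynomial.eval₂_eq_eval_map]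
  rw [h1, h2, Unitary.conjStarAlgAut_apply, Matrix.trace_mul_comm, ← mul_assoc]
  simp [Matrix.trace_diagonal]

theorem eigenvalue_le_norm_aux {n : ℕ} {A : Matrix (Fin n) (Fin n) ℂ} (hA : A.IsHermitian)
    (i : Fin n) : hA.eigenvalues i ≤ ‖Matrix.toEuclideanCLM (𝕜 := ℂ) A‖ := by
  have h := (Matrix.toEuclideanCLM (𝕜 := ℂ) A).le_opNorm (hA.eigenvectorBasis i)
  have e : Matrix.toEuclideanCLM (𝕜 := ℂ) A (hA.eigenvectorBasis i)
      = (hA.eigenvalues i : ℂ) • hA.eigenvectorBasis i := by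
    have := hA.mulVec_eigenvectorBasis i
    ext j
    have := congrFun this j
    simpa using this
  rw [e, norm_smul, hA.eigenvectorBasis.norm_eq_one] at h
  simp at h
  exact (le_abs_self _).trans h

/-- Let `A` be an `n × n` Hermitian positive semidefinite matrix with `‖A‖ ≤ K²` for some
`K ≥ 1`, let `λ ≥ 0`, and let `p` be a real polynomial with `p ≥ 1` on `[0, λ]` and `p ≥ 0`
on `[0, K²]`.  Then `E_A(λ) ≤ Tr(p(A))`. -/
theorem eigenvalue_count_le_trace
    {n : ℕ} {A : Matrix (Fin n) (Fin n) ℂ}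
    (hA : A.PosSemidef)
    (K : ℝ) (hK : 1 ≤ K) (hnorm : ‖Matrix.toEuclideanCLM (𝕜 := ℂ) A‖ ≤ K ^ 2)
    (lam : ℝ) (hlam : 0 ≤ lam)
    (p : Polynomial ℝ)
    (hp1 : ∀ μ ∈ Set.Icc 0 lam, 1 ≤ p.eval μ)
    (hp0 : ∀ μ ∈ Set.Icc 0 (K ^ 2), 0 ≤ p.eval μ)
    (E : ℝ → ℕ)
    (hE : ∀ t : ℝ, E t = (Finset.univ.filter fun i : Fin n =>
      hA.1.eigenvalues i ≤ t).card) :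
    (E lam : ℝ) ≤ (Matrix.trace (Polynomial.aeval A (p.map (algebraMap ℝ ℂ)))).re := by
  rw [trace_aeval_eq_sum_aux hA.1, hE, Finset.card_filter, Complex.re_sum]
  push_cast
  refine Finset.sum_le_sum fun i _ => ?_
  have e : (Polynomial.eval (hA.1.eigenvalues i : ℂ) (p.map (algebraMap ℝ ℂ))).re
      = p.eval (hA.1.eigenvalues i) := by
    have := Polynomial.eval_map_algebraMap (B := ℂ) p (hA.1.eigenvalues i : ℂ)
    rw [this]
    have := Polynomial.aeval_algebraMap_apply ℂ (hA.1.eigenvalues i) p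
    simp only [Complex.coe_algebraMap] at this
    rw [this]
    simp
  rw [e]
  have h0 := hA.eigenvalues_nonneg i
  split_ifs with h
  · exact hp1 _ ⟨h0, h⟩
  · exact hp0 _ ⟨h0, (eigenvalue_le_norm_aux hA.1 i).trans hnorm⟩
end

section
/- Let A be an n×n Hermitian positive semidefinite matrix with ‖A‖ ≤ K² for some K ≥ 1, let λ ≥ 0, let n₀ ≥ 1 be an integer, and let p be a polynomial with real coefficients such that 0 ≤ p(μ) ≤ 1 + 1/n₀ for all μ ∈ [0, λ + 1/n₀] and 0 ≤ p(μ) ≤ 1/n₀ for all μ ∈ (λ + 1/n₀, K²]. Then Tr(p(A)) ≤ E_A(λ + 1/n₀) + n/n₀. -/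
open scoped ComplexOrder

/-- Let `A` be an `n × n` Hermitian positive semidefinite matrix with `‖A‖ ≤ K²` for some
`K ≥ 1`, let `λ ≥ 0`, let `n₀ ≥ 1` be an integer, and let `p` be a real polynomial with
`0 ≤ p ≤ 1 + 1/n₀` on `[0, λ + 1/n₀]` and `0 ≤ p ≤ 1/n₀` on `(λ + 1/n₀, K²]`.  Then
`Tr(p(A)) ≤ E_A(λ + 1/n₀) + n/n₀`. -/
theorem trace_le_eigenvalue_count
    {n : ℕ} {A : Matrix (Fin n) (Fin n) ℂ}
    (hA : A.PosSemidef)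
    (K : ℝ) (hK : 1 ≤ K) (hnorm : ‖Matrix.toEuclideanCLM (𝕜 := ℂ) A‖ ≤ K ^ 2)
    (lam : ℝ) (hlam : 0 ≤ lam)
    (n₀ : ℕ) (hn₀ : 1 ≤ n₀)
    (p : Polynomial ℝ)
    (hp1 : ∀ μ ∈ Set.Icc 0 (lam + 1 / n₀), 0 ≤ p.eval μ ∧ p.eval μ ≤ 1 + 1 / n₀)
    (hp2 : ∀ μ ∈ Set.Ioc (lam + 1 / n₀) (K ^ 2), 0 ≤ p.eval μ ∧ p.eval μ ≤ 1 / n₀)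
    (E : ℝ → ℕ)
    (hE : ∀ t : ℝ, E t = (Finset.univ.filter fun i : Fin n =>
      hA.1.eigenvalues i ≤ t).card) :
    (Matrix.trace (Polynomial.aeval A (p.map (algebraMap ℝ ℂ)))).re ≤
      (E (lam + 1 / n₀) : ℝ) + n / n₀ := by
  have htr : Matrix.trace (Polynomial.aeval A (p.map (algebraMap ℝ ℂ))) =
      ∑ i, ((p.eval (hA.1.eigenvalues i) : ℝ) : ℂ) := by
    have h1 : Polynomial.aeval A (p.map (algebraMap ℝ ℂ)) =
        Unitary.conjStarAlgAut ℂ _ hA.1.eigenvectorUnitary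
          (Polynomial.aeval (Matrix.diagonal (RCLike.ofReal ∘ hA.1.eigenvalues))
            (p.map (algebraMap ℝ ℂ))) := by
      conv_lhs => rw [hA.1.spectral_theorem]
      exact Polynomial.aeval_algHom_apply
        ((Unitary.conjStarAlgAut ℂ (Matrix (Fin n) (Fin n) ℂ)
          hA.1.eigenvectorUnitary).toAlgEquiv.toAlgHom) _ _
    have h2 : Polynomial.aeval (Matrix.diagonal
        (RCLike.ofReal ∘ hA.1.eigenvalues : Fin n → ℂ)) (p.map (algebraMap ℝ ℂ)) =
        Matrix.diagonal (Polynomial.aeval (RCLike.ofReal ∘ hA.1.eigenvalues : Fin n → ℂ)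
          (p.map (algebraMap ℝ ℂ))) :=
      Polynomial.aeval_algHom_apply (Matrix.diagonalAlgHom ℂ) _ _
    rw [h1, h2, Unitary.conjStarAlgAut_apply, Matrix.trace_mul_cycle,
      Unitary.coe_star_mul_self, one_mul, Matrix.trace_diagonal]
    refine Finset.sum_congr rfl fun i _ => ?_
    have h3 := Polynomial.aeval_algHom_apply (Pi.evalAlgHom ℂ (fun _ : Fin n => ℂ) i)
      (RCLike.ofReal ∘ hA.1.eigenvalues : Fin n → ℂ) (p.map (algebraMap ℝ ℂ))
    simp only [Pi.evalAlgHom_apply] at h3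
    rw [← h3]
    simp [Polynomial.aeval_def, Polynomial.eval₂_map]
    exact (Polynomial.hom_eval₂ p (RingHom.id ℝ) Complex.ofRealHom _).symm
  have hev : ∀ i, hA.1.eigenvalues i ≤ K ^ 2 := by
    intro i
    have h := (Matrix.toEuclideanCLM (𝕜 := ℂ) A).le_opNorm (hA.1.eigenvectorBasis i)
    have h2 : Matrix.toEuclideanCLM (𝕜 := ℂ) A (hA.1.eigenvectorBasis i) =
        (hA.1.eigenvalues i : ℂ) • hA.1.eigenvectorBasis i := by
      ext j
      simpa using congrFun (hA.1.mulVec_eigenvectorBasis i) j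
    rw [h2, norm_smul, hA.1.eigenvectorBasis.orthonormal.1 i] at h
    simp only [mul_one, Complex.norm_real] at h
    exact (le_abs_self _).trans (h.trans hnorm)
  rw [htr, hE, ← Complex.ofReal_sum, Complex.ofReal_re, Finset.card_filter]
  push_cast
  have : (n : ℝ) / n₀ = ∑ i : Fin n, (1 / n₀ : ℝ) := by
    simp [div_eq_mul_inv]
  rw [this, ← Finset.sum_add_distrib]
  refine Finset.sum_le_sum fun i _ => ?_
  split_ifs with h
  · exact (hp1 _ ⟨hA.eigenvalues_nonneg i, h⟩).2
  · simpa using (hp2 _ ⟨not_le.mp h, hev i⟩).2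
end

section
/- In the Setting, for every λ ≥ 0 the two one-sided limits lim_{δ→0+} limsup_{m→∞} F_m(λ+δ) and lim_{δ→0+} liminf_{m→∞} F_m(λ+δ) exist and are equal. -/
open scoped ComplexOrder

open Filter

lemma trace_pow_eq_sum {n : Type*} [Fintype n] [DecidableEq n] {A : Matrix n n ℂ}
    (hA : A.IsHermitian) (k : ℕ) :
    (A ^ k).trace = ((∑ i, hA.eigenvalues i ^ k : ℝ) : ℂ) := by
  conv_lhs => rw [hA.spectral_theorem, ← map_pow, Unitary.conjStarAlgAut_apply,
    Matrix.trace_mul_cycle, Unitary.coe_star_mul_self, one_mul, Matrix.diagonal_pow,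
    Matrix.trace_diagonal]
  simp

lemma eigenvalue_le_of_row {n : Type*} [Fintype n] [DecidableEq n] {A : Matrix n n ℂ}
    (hA : A.IsHermitian) (R : ℝ) (hR : ∀ i, ∑ j, ‖A i j‖ ≤ R) (i : n) :
    hA.eigenvalues i ≤ R := by
  have h1 : Module.End.HasEigenvalue (Matrix.toLin' A) (hA.eigenvalues i : ℂ) := by
    refine Module.End.hasEigenvalue_of_hasEigenvector
      (x := (hA.eigenvectorBasis i : n → ℂ)) ?_
    refine ⟨?_, ?_⟩
    · rw [Module.End.mem_eigenspace_iff, Matrix.toLin'_apply, hA.mulVec_eigenvectorBasis]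
      ext j; simp
    · intro h
      have := hA.eigenvectorBasis.orthonormal.ne_zero i
      apply this
      ext j
      exact congrFun h j
  obtain ⟨k, hk⟩ := eigenvalue_mem_ball h1
  rw [mem_closedBall_iff_norm] at hk
  have h2 : ‖(hA.eigenvalues i : ℂ)‖ ≤ ‖A k k‖ + ∑ j ∈ Finset.univ.erase k, ‖A k j‖ := by
    have := norm_sub_norm_le (hA.eigenvalues i : ℂ) (A k k)
    linarith
  rw [Finset.add_sum_erase _ (fun j => ‖A k j‖) (Finset.mem_univ k)] at h2
  have h3 := hR k
  have h4 : hA.eigenvalues i ≤ ‖(hA.eigenvalues i : ℂ)‖ := by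
    rw [Complex.norm_real]; exact le_abs_self _
  linarith

lemma abstract_limits (ι : ℕ → Type*) [∀ m, Fintype (ι m)] (μ : ∀ m, ι m → ℝ) (N : ℕ → ℝ)
    (hN : ∀ m, 0 < N m) (D : ℝ) (hD : ∀ m, (Fintype.card (ι m) : ℝ) / N m ≤ D)
    (R : ℝ) (h0 : ∀ m i, 0 ≤ μ m i) (hR : ∀ m i, μ m i ≤ R)
    (hmom : ∀ k : ℕ, ∃ c : ℝ, Tendsto (fun m => (∑ i, μ m i ^ k) / N m) atTop (nhds c))
    (F : ℕ → ℝ → ℝ)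
    (hF : ∀ m x, F m x = ((Finset.univ.filter fun i => μ m i ≤ x).card : ℝ) / N m)
    (lam : ℝ) :
    ∃ L : ℝ,
      Tendsto (fun δ : ℝ => limsup (fun m => F m (lam + δ)) atTop)
        (nhdsWithin 0 (Set.Ioi 0)) (nhds L) ∧
      Tendsto (fun δ : ℝ => liminf (fun m => F m (lam + δ)) atTop)
        (nhdsWithin 0 (Set.Ioi 0)) (nhds L) := by
  have hF0 : ∀ m x, 0 ≤ F m x := fun m x => by
    rw [hF]; exact div_nonneg (Nat.cast_nonneg _) (hN m).le
  have hFD : ∀ m x, F m x ≤ D := fun m x => by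
    rw [hF]; refine le_trans ?_ (hD m)
    have := (hN m).le
    gcongr
    exact Finset.card_le_univ _
  have hFm : ∀ m, Monotone (F m) := fun m x y hxy => by
    rw [hF, hF]
    have := (hN m).le
    gcongr
  have hD0 : 0 ≤ D := (hF0 0 0).trans (hFD 0 0)
  have bu : ∀ x, IsBoundedUnder (· ≤ ·) atTop (fun m => F m x) := fun x =>
    isBoundedUnder_of ⟨D, fun m => hFD m x⟩
  have bl : ∀ x, IsBoundedUnder (· ≥ ·) atTop (fun m => F m x) := fun x =>
    isBoundedUnder_of ⟨0, fun m => hF0 m x⟩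
  -- polynomial statistics converge
  have hpoly : ∀ p : Polynomial ℝ, ∃ c : ℝ,
      Tendsto (fun m => (∑ i, p.eval (μ m i)) / N m) atTop (nhds c) := by
    intro p
    choose c hc using hmom
    refine ⟨∑ k ∈ Finset.range (p.natDegree + 1), p.coeff k * c k, ?_⟩
    have := tendsto_finsetSum (Finset.range (p.natDegree + 1))
      (fun k _ => (hc k).const_mul (p.coeff k))
    refine this.congr fun m => ?_
    simp_rw [Polynomial.eval_eq_sum_range]
    rw [Finset.sum_comm, Finset.sum_div]
    refine Finset.sum_congr rfl fun k _ => ?_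
    rw [← Finset.mul_sum, mul_div_assoc]
  -- key comparison
  have key : ∀ x y, x < y →
      limsup (fun m => F m x) atTop ≤ liminf (fun m => F m y) atTop := by
    intro x y hxy
    refine le_of_forall_pos_le_add fun ε hε => ?_
    set e : ℝ := ε / (4 * (D + 1)) with he
    have hepos : 0 < e := by positivity
    let f : ℝ → ℝ := fun t => max 0 (min 1 ((y - t) / (y - x)))
    have hfc : Continuous f := by fun_prop
    have hyx : 0 < y - x := sub_pos.2 hxy
    have hf0 : ∀ t, 0 ≤ f t := fun t => le_max_left _ _
    have hf1 : ∀ t, f t ≤ 1 := fun t => max_le zero_le_one (min_le_left _ _)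
    have hfx : ∀ t, t ≤ x → 1 ≤ f t := fun t ht =>
      le_max_of_le_right (le_min le_rfl ((one_le_div hyx).2 (by linarith)))
    have hfy : ∀ t, y < t → f t ≤ 0 := fun t ht =>
      max_le le_rfl ((min_le_right _ _).trans
        (div_nonpos_of_nonpos_of_nonneg (by linarith) hyx.le))
    obtain ⟨p, hp⟩ := exists_polynomial_near_of_continuousOn 0 R f hfc.continuousOn e hepos
    obtain ⟨c, hc⟩ := hpoly p
    have hcnt : ∀ m z, F m z = (∑ i, if μ m i ≤ z then (1:ℝ) else 0) / N m := by
      intro m z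
      rw [hF, Finset.sum_boole]
    have hce : ∀ m, (∑ _i : ι m, e) / N m ≤ ε / 4 := by
      intro m
      rw [Finset.sum_const, Finset.card_univ, nsmul_eq_mul, mul_div_right_comm]
      calc _ ≤ D * e := by gcongr; exact hD m
        _ ≤ (D + 1) * e := by gcongr; linarith
        _ = ε / 4 := by rw [he]; field_simp
    have h1 : ∀ m, F m x ≤ (∑ i, p.eval (μ m i)) / N m + ε / 4 := by
      intro m
      refine le_trans ?_ (add_le_add_right (hce m) _)
      rw [hcnt, ← add_div, ← Finset.sum_add_distrib]
      have := (hN m).le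
      gcongr with i _
      have h := abs_lt.1 (hp (μ m i) ⟨h0 m i, hR m i⟩)
      split_ifs with hi
      · have := hfx _ hi; linarith [h.1]
      · have := hf0 (μ m i); linarith [h.1]
    have h2 : ∀ m, (∑ i, p.eval (μ m i)) / N m ≤ F m y + ε / 4 := by
      intro m
      refine le_trans ?_ (add_le_add_right (hce m) _)
      rw [hcnt, ← add_div, ← Finset.sum_add_distrib]
      have := (hN m).le
      gcongr with i _
      have h := abs_lt.1 (hp (μ m i) ⟨h0 m i, hR m i⟩)
      split_ifs with hi
      · have := hf1 (μ m i); linarith [h.2]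
      · have := hfy _ (not_le.1 hi); linarith [h.2]
    have e1 : ∀ᶠ m in atTop, (∑ i, p.eval (μ m i)) / N m < c + ε / 4 :=
      hc.eventually_lt_const (by linarith)
    have e2 : ∀ᶠ m in atTop, c - ε / 4 < (∑ i, p.eval (μ m i)) / N m :=
      hc.eventually_const_lt (by linarith)
    have l1 : limsup (fun m => F m x) atTop ≤ c + ε / 2 := by
      refine limsup_le_of_le (bl x).isCoboundedUnder_le ?_
      filter_upwards [e1] with m hm
      linarith [h1 m]
    have l2 : c - ε / 2 ≤ liminf (fun m => F m y) atTop := by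
      refine le_liminf_of_le (bu y).isCoboundedUnder_ge ?_
      filter_upwards [e2] with m hm
      linarith [h2 m]
    linarith
  have hle : ∀ x, liminf (fun m => F m x) atTop ≤ limsup (fun m => F m x) atTop := fun x =>
    liminf_le_limsup (bu x) (bl x)
  have mS : Monotone (fun δ : ℝ => limsup (fun m => F m (lam + δ)) atTop) := by
    intro a b hab
    rcases hab.eq_or_lt with rfl | h
    · exact le_rfl
    · exact (key _ _ (by linarith)).trans (hle _)
  have mI : Monotone (fun δ : ℝ => liminf (fun m => F m (lam + δ)) atTop) := by
    intro a b hab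
    rcases hab.eq_or_lt with rfl | h
    · exact le_rfl
    · exact (hle _).trans (key _ _ (by linarith))
  have tS := mS.tendsto_nhdsGT 0
  have tI := mI.tendsto_nhdsGT 0
  refine ⟨_, tS, ?_⟩
  convert tI using 2
  refine le_antisymm ?_ (le_of_tendsto_of_tendsto' tI tS fun δ => hle _)
  have t2 : Tendsto (fun δ : ℝ => 2 * δ) (nhdsWithin 0 (Set.Ioi 0)) (nhdsWithin 0 (Set.Ioi 0)) := by
    refine tendsto_nhdsWithin_of_tendsto_nhds_of_eventually_within _ ?_ ?_
    · have : Tendsto (fun δ : ℝ => 2 * δ) (nhds 0) (nhds (2 * 0)) := tendsto_id.const_mul 2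
      rw [mul_zero] at this
      exact this.mono_left nhdsWithin_le_nhds
    · filter_upwards [self_mem_nhdsWithin] with δ hδ
      simpa using hδ
  refine le_of_tendsto_of_tendsto tS (tI.comp t2) ?_
  filter_upwards [self_mem_nhdsWithin] with δ hδ
  have : (0:ℝ) < δ := hδ
  exact key _ _ (by linarith)

/-- Powers of a kernel `K` with row supports `B`. -/
noncomputable def kpow {I : Type*} [DecidableEq I] (B : I → Finset I) (K : I → I → ℂ) :
    ℕ → I → I → ℂ
  | 0 => fun σ τ => if σ = τ then 1 else 0
  | k + 1 => fun σ τ => ∑ ρ ∈ B σ, K σ ρ * kpow B K k ρ τ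

lemma kpow_invariant {I : Type*} [DecidableEq I] {G : Type*} [Group G] [MulAction G I]
    (B : I → Finset I) (K : I → I → ℂ)
    (hB : ∀ (g : G) σ τ, g • τ ∈ B (g • σ) ↔ τ ∈ B σ)
    (hK : ∀ (g : G) σ τ, K (g • σ) (g • τ) = K σ τ) (g : G) (k : ℕ) :
    ∀ σ τ, kpow B K k (g • σ) (g • τ) = kpow B K k σ τ := by
  induction k with
  | zero => intro σ τ; simp [kpow]
  | succ k ih =>
    intro σ τ
    simp only [kpow]
    symm
    refine Finset.sum_bij (fun ρ _ => g • ρ) (fun ρ h => (hB g σ ρ).2 h)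
      (fun a _ c _ h => MulAction.injective g h) (fun ρ h => ?_) (fun ρ _ => ?_)
    · refine ⟨g⁻¹ • ρ, ?_, by simp⟩
      rw [← hB g]; simpa using h
    · rw [hK, ih]

lemma kpow_bound {I : Type*} [DecidableEq I] (B : I → Finset I) (K : I → I → ℂ)
    (C : ℝ) (b : ℕ) (hC : 0 < C) (hb : ∀ σ, (B σ).card ≤ b) (hK : ∀ σ τ, ‖K σ τ‖ ≤ C) (k : ℕ) :
    ∀ σ τ, ‖kpow B K k σ τ‖ ≤ (C * b) ^ k := by
  induction k with
  | zero => intro σ τ; simp only [kpow]; split_ifs <;> simp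
  | succ k ih =>
    intro σ τ
    simp only [kpow]
    calc _ ≤ ∑ ρ ∈ B σ, ‖K σ ρ * kpow B K k ρ τ‖ := norm_sum_le _ _
      _ ≤ ∑ ρ ∈ B σ, C * (C * b) ^ k := by
        gcongr with ρ _
        rw [norm_mul]
        exact mul_le_mul (hK _ _) (ih _ _) (norm_nonneg _) hC.le
      _ = (B σ).card * (C * (C * b) ^ k) := by rw [Finset.sum_const, nsmul_eq_mul]
      _ ≤ b * (C * (C * b) ^ k) := by
        gcongr
        exact hb σ
      _ = _ := by ring

lemma row_sum_le {I : Type*} [MetricSpace I] (Y : Finset I) (A : Matrix Y Y ℂ)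
    (C : ℝ) (b : ℕ) (hC : 0 < C) (B : I → Finset I) (hBm : ∀ σ τ, τ ∈ B σ ↔ dist σ τ ≤ 1)
    (hb : ∀ σ, (B σ).card ≤ b) (hA : ∀ σ τ, ‖A σ τ‖ ≤ C)
    (hloc : ∀ σ τ : Y, 1 < dist (σ : I) (τ : I) → A σ τ = 0) (σ : Y) :
    ∑ τ, ‖A σ τ‖ ≤ C * b := by
  classical
  calc ∑ τ, ‖A σ τ‖ ≤ ∑ τ : Y, if (τ : I) ∈ B σ then C else 0 := by
        gcongr with τ _
        split_ifs with h
        · exact hA _ _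
        · rw [hBm, not_le] at h
          simp [hloc _ _ h]
    _ = ∑ τ ∈ Y, if τ ∈ B σ then C else 0 :=
        Finset.sum_coe_sort Y (fun τ => if τ ∈ B (σ : I) then C else 0)
    _ = ((Y.filter (· ∈ B σ)).card : ℝ) * C := by
        rw [← Finset.sum_filter, Finset.sum_const, nsmul_eq_mul]
    _ ≤ b * C := by
        gcongr
        refine le_trans (Finset.card_le_card ?_) (hb σ)
        intro τ hτ
        exact (Finset.mem_filter.1 hτ).2
    _ = C * b := mul_comm _ _

lemma matrix_pow_bound {n : Type*} [Fintype n] [DecidableEq n] (A : Matrix n n ℂ) (R : ℝ)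
    (hR0 : 0 ≤ R) (hR : ∀ i, ∑ j, ‖A i j‖ ≤ R) (k : ℕ) : ∀ i j, ‖(A ^ k) i j‖ ≤ R ^ k := by
  induction k with
  | zero => intro i j; rw [pow_zero, Matrix.one_apply]; split_ifs <;> simp
  | succ k ih =>
    intro i j
    rw [pow_succ', Matrix.mul_apply]
    calc _ ≤ ∑ l, ‖A i l * (A ^ k) l j‖ := norm_sum_le _ _
      _ ≤ ∑ l, ‖A i l‖ * R ^ k := by
        gcongr with l _
        rw [norm_mul]
        exact mul_le_mul_of_nonneg_left (ih _ _) (norm_nonneg _)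
      _ = (∑ l, ‖A i l‖) * R ^ k := by rw [Finset.sum_mul]
      _ ≤ R * R ^ k := by gcongr; exact hR i
      _ = _ := by ring

lemma matrix_pow_agree {I : Type*} [MetricSpace I] [DecidableEq I] (Y : Finset I)
    (A : Matrix Y Y ℂ) (K : I → I → ℂ)
    (B : I → Finset I) (hBm : ∀ σ τ, τ ∈ B σ ↔ dist σ τ ≤ 1)
    (hloc : ∀ σ τ : Y, 1 < dist (σ : I) (τ : I) → A σ τ = 0)
    (hag : ∀ σ τ : Y, (∀ ρ : I, ρ ∉ Y → 1 < dist (σ : I) ρ) → A σ τ = K σ τ) (k : ℕ) :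
    ∀ σ τ : Y, (∀ ρ : I, ρ ∉ Y → (k : ℝ) < dist (σ : I) ρ) →
      (A ^ k) σ τ = kpow B K k σ τ := by
  induction k with
  | zero =>
    intro σ τ _
    simp only [kpow, pow_zero, Matrix.one_apply, Subtype.ext_iff]
  | succ k ih =>
    intro σ τ h
    have h1 : ∀ ρ : I, ρ ∉ Y → 1 < dist (σ : I) ρ := fun ρ hρ => by
      have := h ρ hρ
      push_cast at this
      have hk : (0:ℝ) ≤ k := Nat.cast_nonneg k
      linarith
    have hBY : B σ ⊆ Y := fun ρ hρ => by
      by_contra hn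
      have := h1 ρ hn
      rw [hBm] at hρ
      linarith
    rw [pow_succ', Matrix.mul_apply]
    simp only [kpow]
    have e : ∀ ρ : Y, A σ ρ * (A ^ k) ρ τ =
        if (ρ : I) ∈ B σ then K σ ρ * kpow B K k ρ τ else 0 := by
      intro ρ
      split_ifs with hρ
      · rw [hBm] at hρ
        rw [hag _ _ h1, ih]
        intro x hx
        have := h x hx
        push_cast at this
        have := dist_triangle (σ : I) ρ x
        linarith
      · rw [hBm, not_le] at hρ
        rw [hloc _ _ hρ, zero_mul]
    rw [Finset.sum_congr rfl (fun ρ _ => e ρ)]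
    rw [Finset.sum_coe_sort Y (fun ρ => if ρ ∈ B (σ : I) then K σ ρ * kpow B K k ρ τ else 0),
      ← Finset.sum_filter, Finset.filter_mem_eq_inter, Finset.inter_eq_right.2 hBY]

lemma sum_translates {I : Type*} [DecidableEq I] {G : Type*} [Group G] [MulAction G I]
    (hfree : ∀ (g : G) (σ : I), g • σ = σ → g = 1) (𝓕 : Finset I)
    (hfund : ∀ σ : I, ∃! τ : I, τ ∈ 𝓕 ∧ ∃ g : G, g • σ = τ)
    (Λ : Finset G) {M : Type*} [AddCommMonoid M] (h : I → M) (hh : ∀ (g : G) σ, h (g • σ) = h σ) :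
    ∑ σ ∈ Λ.biUnion (fun g => 𝓕.image fun σ => g • σ), h σ = Λ.card • ∑ σ ∈ 𝓕, h σ := by
  classical
  rw [Finset.sum_biUnion]
  · rw [← Finset.sum_const]
    refine Finset.sum_congr rfl fun g _ => ?_
    rw [Finset.sum_image (fun a _ c _ h => MulAction.injective g h)]
    exact Finset.sum_congr rfl fun σ _ => hh g σ
  · intro g _ g' _ hne
    rw [Function.onFun, Finset.disjoint_left]
    intro x hx hx'
    obtain ⟨σ, hσ, rfl⟩ := Finset.mem_image.1 hx
    obtain ⟨σ', hσ', he⟩ := Finset.mem_image.1 hx'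
    apply hne
    have hs : σ = σ' := (hfund σ).unique ⟨hσ, 1, one_smul _ _⟩
      ⟨hσ', g'⁻¹ * g, by rw [mul_smul, ← he, inv_smul_smul]⟩
    subst hs
    have he' : g' • σ = g • σ := he
    have := hfree (g'⁻¹ * g) σ (by rw [mul_smul, ← he', inv_smul_smul])
    exact (inv_mul_eq_one.1 this).symm

/-- **Theorem 2.1 (1).** In the amenable Setting, for every `λ ≥ 0` the one-sided limits
`lim_{δ→0+} limsup_m F_m(λ+δ)` and `lim_{δ→0+} liminf_m F_m(λ+δ)` exist and are equal. -/
theorem right_limits_of_spectral_density_exist_and_agree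
    {I : Type*} [MetricSpace I] [Countable I] [DecidableEq I]
    {G : Type*} [Group G] [Countable G] [MulAction G I]
    (hfree : ∀ (g : G) (σ : I), g • σ = σ → g = 1)
    (hiso : ∀ (g : G) (σ τ : I), dist (g • σ) (g • τ) = dist σ τ)
    (𝓕 : Finset I)
    (hfund : ∀ σ : I, ∃! τ : I, τ ∈ 𝓕 ∧ ∃ g : G, g • σ = τ)
    (C : ℝ) (b : ℕ) (hC : 0 < C) (hCb : 1 ≤ C * b)
    (hballfin : ∀ σ : I, {τ : I | dist σ τ ≤ 1}.Finite)
    (hballcard : ∀ σ : I, {τ : I | dist σ τ ≤ 1}.ncard ≤ b)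
    (Δ : lp (fun _ : I => ℂ) 2 →L[ℂ] lp (fun _ : I => ℂ) 2)
    (hΔpos : Δ.IsPositive)
    (hΔequiv : ∀ (g : G) (σ τ : I),
      (Δ (delta (g • σ)) : ∀ _ : I, ℂ) (g • τ) = (Δ (delta σ) : ∀ _ : I, ℂ) τ)
    (hΔint : ∀ σ τ : I, ∃ z : ℤ, (Δ (delta σ) : ∀ _ : I, ℂ) τ = (z : ℂ) ∧ |(z : ℝ)| ≤ C)
    (hΔloc : ∀ σ τ : I, 1 < dist σ τ → (Δ (delta σ) : ∀ _ : I, ℂ) τ = 0)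
    (Λ : ℕ → Finset G) (hΛ : ∀ m, (Λ m).Nonempty)
    (Y : ℕ → Finset I)
    (hY : ∀ m, Y m = (Λ m).biUnion fun g => 𝓕.image fun σ => g • σ)
    (hreg : ∀ k : ℕ, Filter.Tendsto
      (fun m => (({σ : I | σ ∈ Y m ∧ ∃ τ : I, τ ∉ Y m ∧ dist σ τ ≤ (k : ℝ)}.ncard : ℝ)
        / (Λ m).card)) Filter.atTop (nhds 0))
    (Δm : (m : ℕ) → Matrix (Y m) (Y m) ℂ)
    (hΔm : ∀ m, (Δm m).PosSemidef)
    (hΔmint : ∀ m, ∀ σ τ : Y m, ∃ z : ℤ, Δm m σ τ = (z : ℂ) ∧ |(z : ℝ)| ≤ C)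
    (hΔmloc : ∀ m, ∀ σ τ : Y m, 1 < dist (σ : I) (τ : I) → Δm m σ τ = 0)
    (hΔmagree : ∀ m, ∀ σ τ : Y m,
      ((∀ ρ : I, ρ ∉ Y m → 1 < dist (σ : I) ρ) ∨ (∀ ρ : I, ρ ∉ Y m → 1 < dist (τ : I) ρ)) →
      Δm m σ τ = (Δ (delta (σ : I)) : ∀ _ : I, ℂ) (τ : I))
    (F : ℕ → ℝ → ℝ)
    (hF : ∀ (m : ℕ) (lam : ℝ), F m lam =
      ((Finset.univ.filter fun i : Y m => (hΔm m).1.eigenvalues i ≤ lam).card : ℝ)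
        / (Λ m).card)
    (lam : ℝ) (hlam : 0 ≤ lam) :
    ∃ L : ℝ,
      Filter.Tendsto (fun δ : ℝ => Filter.limsup (fun m => F m (lam + δ)) Filter.atTop)
        (nhdsWithin 0 (Set.Ioi 0)) (nhds L) ∧
      Filter.Tendsto (fun δ : ℝ => Filter.liminf (fun m => F m (lam + δ)) Filter.atTop)
        (nhdsWithin 0 (Set.Ioi 0)) (nhds L) := by
  have hB' : ∀ σ τ : I, τ ∈ (hballfin σ).toFinset ↔ dist σ τ ≤ 1 := fun σ τ => by simp
  set B : I → Finset I := fun σ => (hballfin σ).toFinset with hBdef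
  have hBm : ∀ σ τ : I, τ ∈ B σ ↔ dist σ τ ≤ 1 := hB'
  have hBb : ∀ σ, (B σ).card ≤ b := fun σ => by
    rw [hBdef]
    simp only
    rw [← Set.ncard_eq_toFinset_card _ (hballfin σ)]
    exact hballcard σ
  let K : I → I → ℂ := fun σ τ => (Δ (delta σ) : ∀ _ : I, ℂ) τ
  have nint : ∀ w : ℂ, (∃ z : ℤ, w = (z : ℂ) ∧ |(z : ℝ)| ≤ C) → ‖w‖ ≤ C := by
    rintro w ⟨z, rfl, hz⟩
    rwa [Complex.norm_intCast]
  have hKC : ∀ σ τ, ‖K σ τ‖ ≤ C := fun σ τ => nint _ (hΔint σ τ)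
  have hrow : ∀ m, ∀ σ : Y m, ∑ τ, ‖Δm m σ τ‖ ≤ C * b := fun m =>
    row_sum_le (Y m) (Δm m) C b hC B hBm hBb (fun σ τ => nint _ (hΔmint m σ τ)) (hΔmloc m)
  have hN : ∀ m, (0 : ℝ) < (Λ m).card := fun m => by exact_mod_cast (hΛ m).card_pos
  have hcard : ∀ m, (Y m).card = (Λ m).card * 𝓕.card := fun m => by
    have := sum_translates hfree 𝓕 hfund (Λ m) (fun _ => (1 : ℕ)) (fun _ _ => rfl)
    rw [← hY m] at this
    simpa using this
  refine abstract_limits (fun m => Y m) (fun m => (hΔm m).1.eigenvalues) (fun m => (Λ m).card)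
    hN 𝓕.card ?_ (C * b) (fun m i => (hΔm m).eigenvalues_nonneg i)
    (fun m i => eigenvalue_le_of_row (hΔm m).1 _ (hrow m) i) ?_ F hF lam
  · intro m
    rw [Fintype.card_coe, hcard, Nat.cast_mul, mul_div_cancel_left₀ _ (hN m).ne']
  intro k
  set c : ℂ := ∑ σ ∈ 𝓕, kpow B K k σ σ with hc
  refine ⟨c.re, ?_⟩
  have hinv : ∀ (g : G) σ, kpow B K k (g • σ) (g • σ) = kpow B K k σ σ := fun g σ =>
    kpow_invariant B K (fun g σ τ => by rw [hBm, hBm, hiso]) hΔequiv g k σ σ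
  have hsum : ∀ m, ∑ σ ∈ Y m, kpow B K k σ σ = (Λ m).card * c := fun m => by
    rw [hY m, sum_translates hfree 𝓕 hfund (Λ m) (fun σ => kpow B K k σ σ) hinv, nsmul_eq_mul]
  have hbd : ∀ m, |(∑ i, (hΔm m).1.eigenvalues i ^ k) / ((Λ m).card : ℝ) - c.re| ≤
      2 * (C * b) ^ k *
      (({σ : I | σ ∈ Y m ∧ ∃ τ : I, τ ∉ Y m ∧ dist σ τ ≤ (k : ℝ)}.ncard : ℝ) / (Λ m).card) := by
    intro m
    classical
    have hset : ({σ : I | σ ∈ Y m ∧ ∃ τ : I, τ ∉ Y m ∧ dist σ τ ≤ (k : ℝ)}.ncard : ℝ) =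
        ∑ σ : Y m, if ∃ τ : I, τ ∉ Y m ∧ dist (σ : I) τ ≤ (k : ℝ) then (1:ℝ) else 0 := by
      rw [Finset.sum_coe_sort (Y m)
        (fun σ => if ∃ τ : I, τ ∉ Y m ∧ dist (σ : I) τ ≤ (k : ℝ) then (1:ℝ) else 0),
        Finset.sum_boole, ← Set.ncard_coe_finset]
      congr 2
      ext σ
      simp
    have h1 : ‖((Δm m) ^ k).trace - (Λ m).card * c‖ ≤ 2 * (C * b) ^ k *
        ({σ : I | σ ∈ Y m ∧ ∃ τ : I, τ ∉ Y m ∧ dist σ τ ≤ (k : ℝ)}.ncard : ℝ) := by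
      rw [hset, ← hsum, ← Finset.sum_coe_sort (Y m), Matrix.trace, ← Finset.sum_sub_distrib,
        Finset.mul_sum]
      refine (norm_sum_le _ _).trans (Finset.sum_le_sum fun σ _ => ?_)
      rw [Matrix.diag_apply]
      split_ifs with h
      · have b1 := matrix_pow_bound (Δm m) (C * b) (by linarith) (hrow m) k σ σ
        have b2 := kpow_bound B K C b hC hBb hKC k σ σ
        have b3 := norm_sub_le ((Δm m ^ k) σ σ) (kpow B K k σ σ)
        linarith
      · push Not at h
        rw [matrix_pow_agree (Y m) (Δm m) K B hBm (hΔmloc m)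
          (fun σ τ hσ => hΔmagree m σ τ (Or.inl hσ)) k σ σ h]
        simp
    rw [trace_pow_eq_sum (hΔm m).1] at h1
    have h2 := (Complex.abs_re_le_norm _).trans h1
    rw [Complex.sub_re, Complex.ofReal_re, ← Complex.ofReal_natCast, Complex.re_ofReal_mul] at h2
    have h3 : (∑ i, (hΔm m).1.eigenvalues i ^ k) / ((Λ m).card : ℝ) - c.re =
        ((∑ i, (hΔm m).1.eigenvalues i ^ k) - ((Λ m).card : ℝ) * c.re) / (Λ m).card := by
      have := (hN m).ne'
      field_simp
    rw [h3, abs_div, abs_of_pos (hN m), ← mul_div_assoc]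
    exact div_le_div_of_nonneg_right h2 (hN m).le
  rw [tendsto_iff_norm_sub_tendsto_zero]
  refine squeeze_zero (fun _ => norm_nonneg _) (fun m => hbd m) ?_
  simpa using (hreg k).const_mul (2 * (C * b) ^ k)
end

section
/- In the Setting, lim_{m→∞} F_m(0) exists, and moreover lim_{λ→0+} limsup_{m→∞} F_m(λ) = lim_{λ→0+} liminf_{m→∞} F_m(λ) = lim_{m→∞} F_m(0); that is, the normalized eigenvalue counting functions are right continuous at zero in the limit. -/
open scoped ComplexOrder

open Filter

theorem rowsum_pow {n : Type*} [Fintype n] [DecidableEq n] (B : Matrix n n ℂ) (D : ℝ)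
    (hD : 0 ≤ D) (h : ∀ i, ∑ j, ‖B i j‖ ≤ D) (k : ℕ) : ∀ i, ∑ j, ‖(B ^ k) i j‖ ≤ D ^ k := by
  induction k with
  | zero => intro i; simp [Matrix.one_apply, apply_ite]
  | succ k ih =>
    intro i
    rw [pow_succ']
    calc ∑ j, ‖(B * B ^ k) i j‖ ≤ ∑ j, ∑ l, ‖B i l‖ * ‖(B ^ k) l j‖ := by
          refine Finset.sum_le_sum fun j _ => ?_
          rw [Matrix.mul_apply]
          refine (norm_sum_le _ _).trans (le_of_eq ?_)
          simp
      _ = ∑ l, ‖B i l‖ * ∑ j, ‖(B ^ k) l j‖ := by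
          rw [Finset.sum_comm]; simp [Finset.mul_sum]
      _ ≤ ∑ l, ‖B i l‖ * D ^ k := by
          refine Finset.sum_le_sum fun l _ => ?_
          exact mul_le_mul_of_nonneg_left (ih l) (norm_nonneg _)
      _ = (∑ l, ‖B i l‖) * D ^ k := by rw [Finset.sum_mul]
      _ ≤ D * D ^ k := by gcongr; exact h i
      _ = D ^ (k+1) := by ring

theorem eig_le {n : Type*} [Fintype n] [DecidableEq n] (A : Matrix n n ℂ) (hA : A.IsHermitian)
    (K : ℝ) (h : ∀ i, ∑ j, ‖A i j‖ ≤ K) (i : n) : hA.eigenvalues i ≤ K := by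
  have hev : Module.End.HasEigenvalue (Matrix.toLin' A) ((hA.eigenvalues i : ℝ) : ℂ) := by
    apply Module.End.hasEigenvalue_of_hasEigenvector (x := (hA.eigenvectorBasis i).ofLp)
    rw [Module.End.hasEigenvector_iff]
    constructor
    · rw [Module.End.mem_eigenspace_iff, Matrix.toLin'_apply, hA.mulVec_eigenvectorBasis i]
      ext; simp
    · intro h0
      exact hA.eigenvectorBasis.orthonormal.ne_zero i (by ext x; simpa using congrFun h0 x)
  obtain ⟨k, hk⟩ := eigenvalue_mem_ball hev
  rw [mem_closedBall_iff_norm] at hk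
  have h1 : ‖((hA.eigenvalues i : ℝ) : ℂ)‖ ≤ K := by
    calc _ = ‖(((hA.eigenvalues i : ℝ) : ℂ) - A k k) + A k k‖ := by simp
      _ ≤ ‖(((hA.eigenvalues i : ℝ) : ℂ) - A k k)‖ + ‖A k k‖ := norm_add_le _ _
      _ ≤ (∑ j ∈ Finset.univ.erase k, ‖A k j‖) + ‖A k k‖ := by gcongr
      _ = ∑ j, ‖A k j‖ := Finset.sum_erase_add _ _ (Finset.mem_univ k)
      _ ≤ K := h k
  rw [Complex.norm_real] at h1
  exact (le_abs_self _).trans h1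

theorem trace_pow_eig {n : Type*} [Fintype n] [DecidableEq n] (A : Matrix n n ℂ)
    (hA : A.IsHermitian) (K : ℝ) (k : ℕ) :
    ((1 - ((K⁻¹ : ℝ) : ℂ) • A) ^ k).trace = ((∑ i, (1 - K⁻¹ * hA.eigenvalues i) ^ k : ℝ) : ℂ) := by
  have h1 := hA.spectral_theorem
  have h2 : (1 - ((K⁻¹ : ℝ) : ℂ) • A) ^ k = Unitary.conjStarAlgAut ℂ _ hA.eigenvectorUnitary
      ((1 - ((K⁻¹ : ℝ) : ℂ) • Matrix.diagonal (RCLike.ofReal ∘ hA.eigenvalues)) ^ k) := by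
    rw [map_pow, map_sub, map_one, map_smul, ← h1]
  have h3 : (1 - ((K⁻¹ : ℝ) : ℂ) • Matrix.diagonal (RCLike.ofReal ∘ hA.eigenvalues)) 
     = Matrix.diagonal (fun i => ((1 - K⁻¹ * hA.eigenvalues i : ℝ) : ℂ)) := by
    ext i j
    by_cases hij : i = j
    · subst hij; simp
    · simp [hij]
  rw [h2, h3, Unitary.conjStarAlgAut_apply, Matrix.trace_mul_cycle, Unitary.coe_star_mul_self,
    one_mul, Matrix.diagonal_pow, Matrix.trace_diagonal]
  simp

theorem one_le_prod {n : Type*} [Fintype n] [DecidableEq n] (A : Matrix n n ℂ)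
    (hA : A.IsHermitian) (hint : ∀ i j, ∃ z : ℤ, A i j = (z : ℂ)) :
    1 ≤ ∏ i ∈ Finset.univ.filter (fun i => hA.eigenvalues i ≠ 0), |hA.eigenvalues i| := by
  choose z hz using hint
  have hmap : A = (Matrix.of z).map (Int.castRingHom ℂ) := by ext i j; simp [hz]
  have hc : A.charpoly = (Matrix.of z).charpoly.map (Int.castRingHom ℂ) := by
    conv_lhs => rw [hmap]
    rw [Matrix.charpoly_map]
  have he := hA.charpoly_eq
  set S := Finset.univ.filter (fun i => hA.eigenvalues i ≠ 0)
  set r := (Finset.univ.filter (fun i => ¬ hA.eigenvalues i ≠ 0)).card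
  have he2 : A.charpoly = Polynomial.X ^ r *
      ∏ i ∈ S, (Polynomial.X - Polynomial.C ((hA.eigenvalues i : ℝ) : ℂ)) := by
    rw [he, ← Finset.prod_filter_mul_prod_filter_not Finset.univ (fun i => hA.eigenvalues i ≠ 0),
      mul_comm]
    congr 1
    rw [Finset.prod_congr rfl (g := fun _ => Polynomial.X), Finset.prod_const]
    intro i hi
    have : hA.eigenvalues i = 0 := by simpa using hi
    simp [this]
  have hco : A.charpoly.coeff r = ∏ i ∈ S, (-((hA.eigenvalues i : ℝ) : ℂ)) := by
    rw [he2, Polynomial.coeff_X_pow_mul', if_pos le_rfl, Nat.sub_self,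
      Polynomial.coeff_zero_eq_eval_zero, Polynomial.eval_prod]
    simp
  have hnorm : ∏ i ∈ S, |hA.eigenvalues i| = ‖A.charpoly.coeff r‖ := by
    rw [hco, norm_prod]; simp
  rw [hnorm, hc, Polynomial.coeff_map]
  have hne : (Matrix.of z).charpoly.coeff r ≠ 0 := by
    intro h0
    have : A.charpoly.coeff r = 0 := by rw [hc, Polynomial.coeff_map, h0]; simp
    rw [hco, Finset.prod_eq_zero_iff] at this
    obtain ⟨i, hi, hi0⟩ := this
    have := (Finset.mem_filter.1 hi).2
    apply this
    simpa using hi0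
  simp only [eq_intCast, Complex.norm_intCast]
  exact_mod_cast Int.one_le_abs hne

theorem count_le {n : Type*} [Fintype n] [DecidableEq n] (A : Matrix n n ℂ)
    (hA : A.PosSemidef) (hint : ∀ i j, ∃ z : ℤ, A i j = (z : ℂ)) (K : ℝ) (hK : 1 ≤ K)
    (hle : ∀ i, hA.1.eigenvalues i ≤ K) (lam : ℝ) (h0 : 0 < lam) (h1 : lam < 1) :
    ((Finset.univ.filter fun i => hA.1.eigenvalues i ≤ lam).card : ℝ) ≤
    ((Finset.univ.filter fun i => hA.1.eigenvalues i ≤ 0).card : ℝ) +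
      Fintype.card n * Real.log K / (- Real.log lam) := by
  have hl : 0 < - Real.log lam := by have := Real.log_neg h0 h1; linarith
  have hKl : 0 ≤ Real.log K := Real.log_nonneg hK
  have hp := Real.log_nonneg (one_le_prod A hA.1 hint)
  rw [Real.log_prod (by intro i hi; simpa using hi)] at hp
  have hnn := hA.eigenvalues_nonneg
  -- compare termwise with indicator sums
  have hsum : 0 ≤ ∑ i, (Real.log K + (if hA.1.eigenvalues i ≤ lam then Real.log lam else 0)
      - (if hA.1.eigenvalues i ≤ 0 then Real.log lam else 0)) := by
    refine hp.trans ?_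
    rw [Finset.sum_filter]
    refine Finset.sum_le_sum fun i _ => ?_
    have hi := hnn i
    by_cases hz : hA.1.eigenvalues i = 0
    · simp [hz, h0.le, hKl]
    · have hpos : 0 < hA.1.eigenvalues i := lt_of_le_of_ne hi (Ne.symm hz)
      rw [if_pos hz, if_neg (not_le.2 hpos), Real.log_abs]
      split_ifs with hh
      · have := Real.log_le_log hpos hh
        linarith
      · have := Real.log_le_log hpos (hle i)
        linarith
  rw [Finset.sum_sub_distrib, Finset.sum_add_distrib, ← Finset.sum_filter, ← Finset.sum_filter] at hsum
  simp only [Finset.sum_const, nsmul_eq_mul, Finset.card_univ] at hsum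
  rw [← sub_le_iff_le_add', le_div_iff₀ hl]
  linarith

/-- sandwich -/
theorem trace_sandwich {n : Type*} [Fintype n] [DecidableEq n] (A : Matrix n n ℂ)
    (hA : A.PosSemidef) (K : ℝ) (hK : 1 ≤ K)
    (hle : ∀ i, hA.1.eigenvalues i ≤ K) (lam : ℝ) (h0 : 0 < lam) (h1 : lam < 1) (k : ℕ) :
    ((Finset.univ.filter fun i => hA.1.eigenvalues i ≤ 0).card : ℝ) ≤
      ((1 - ((K⁻¹ : ℝ) : ℂ) • A) ^ k).trace.re ∧
    ((1 - ((K⁻¹ : ℝ) : ℂ) • A) ^ k).trace.re ≤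
      ((Finset.univ.filter fun i => hA.1.eigenvalues i ≤ lam).card : ℝ) +
       Fintype.card n * (1 - K⁻¹ * lam) ^ k := by
  rw [trace_pow_eig A hA.1, Complex.ofReal_re]
  have hnn := hA.eigenvalues_nonneg
  have hK0 : 0 < K := by linarith
  have hb : ∀ x, x ≤ K → 0 ≤ 1 - K⁻¹ * x := by
    intro x hx
    have : K⁻¹ * x ≤ K⁻¹ * K := by gcongr
    rw [inv_mul_cancel₀ hK0.ne'] at this
    linarith
  constructor
  · rw [Finset.card_filter]
    push_cast
    refine Finset.sum_le_sum fun i _ => ?_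
    split_ifs with h
    · rw [le_antisymm h (hnn i)]; simp
    · exact pow_nonneg (hb _ (hle i)) _
  · have : (Fintype.card n * (1 - K⁻¹ * lam) ^ k : ℝ) = ∑ i : n, (1 - K⁻¹ * lam) ^ k := by simp
    rw [this, Finset.card_filter]
    push_cast
    rw [← Finset.sum_add_distrib]
    refine Finset.sum_le_sum fun i _ => ?_
    split_ifs with h
    · have h3 : (1 - K⁻¹ * hA.1.eigenvalues i) ^ k ≤ 1 := by
        apply pow_le_one₀ (hb _ (hle i))
        have := mul_nonneg (inv_nonneg.2 hK0.le) (hnn i)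
        linarith
      have := pow_nonneg (hb lam (by linarith)) k
      linarith
    · rw [zero_add]
      push Not at h
      apply pow_le_pow_left₀ (hb _ (hle i))
      gcongr

/-- Powers of a locally finite kernel. -/
noncomputable def kerPow {I : Type*} [DecidableEq I] (B : I → I → ℂ) : ℕ → I → I → ℂ
  | 0 => fun σ τ => if σ = τ then 1 else 0
  | (k + 1) => fun σ τ => ∑ᶠ ρ, B σ ρ * kerPow B k ρ τ

theorem kerPow_equiv {I : Type*} [DecidableEq I] {G : Type*} [Group G] [MulAction G I]
    (B : I → I → ℂ) (g : G) (h : ∀ σ τ, B (g • σ) (g • τ) = B σ τ) (k : ℕ) :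
    ∀ σ τ, kerPow B k (g • σ) (g • τ) = kerPow B k σ τ := by
  induction k with
  | zero => intro σ τ; simp [kerPow]
  | succ k ih =>
    intro σ τ
    simp only [kerPow]
    rw [← finsum_comp_equiv (MulAction.toPerm g)]
    simp [h, ih]

theorem pow_eq_kerPow {I : Type*} [MetricSpace I] [DecidableEq I] (Y : Finset I)
    (B : I → I → ℂ) (hB : ∀ σ τ, 1 < dist σ τ → B σ τ = 0) (M : Matrix Y Y ℂ)
    (hM : ∀ σ τ : Y, (∀ ρ : I, ρ ∉ Y → 1 < dist (σ : I) ρ) → M σ τ = B σ τ) (k : ℕ) :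
    ∀ σ τ : Y, (∀ ρ : I, ρ ∉ Y → (k : ℝ) < dist (σ : I) ρ) →
      (M ^ k) σ τ = kerPow B k σ τ := by
  induction k with
  | zero => intro σ τ _; simp [kerPow, Matrix.one_apply]
  | succ k ih =>
    intro σ τ hσ
    push_cast at hσ
    have hσ1 : ∀ ρ : I, ρ ∉ Y → 1 < dist (σ : I) ρ := by
      intro ρ hρ
      have := hσ ρ hρ
      have : (0 : ℝ) ≤ k := Nat.cast_nonneg k
      linarith
    rw [pow_succ', Matrix.mul_apply]
    simp only [kerPow]
    rw [finsum_eq_sum_of_support_subset (s := Y) _ ?_]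
    · rw [← Finset.sum_coe_sort Y]
      refine Finset.sum_congr rfl fun ρ _ => ?_
      rw [hM σ ρ hσ1]
      by_cases hd : 1 < dist (σ : I) ρ
      · simp [hB _ _ hd]
      · rw [ih ρ τ]
        intro x hx
        have h1 := hσ x hx
        have h2 := dist_triangle (σ : I) ρ x
        linarith
    · intro ρ hρ
      by_contra hc
      exact hρ (by simp [hB _ _ (hσ1 ρ hc)])

theorem moment_tendsto
    {I : Type*} [MetricSpace I] [DecidableEq I]
    {G : Type*} [Group G] [MulAction G I]
    (hfree : ∀ (g : G) (σ : I), g • σ = σ → g = 1)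
    (𝓕 : Finset I)
    (hfund : ∀ σ : I, ∃! τ : I, τ ∈ 𝓕 ∧ ∃ g : G, g • σ = τ)
    (Λ : ℕ → Finset G) (hΛ : ∀ m, (Λ m).Nonempty)
    (Y : ℕ → Finset I)
    (hY : ∀ m, Y m = (Λ m).biUnion fun g => 𝓕.image fun σ => g • σ)
    (hreg : ∀ k : ℕ, Filter.Tendsto
      (fun m => (({σ : I | σ ∈ Y m ∧ ∃ τ : I, τ ∉ Y m ∧ dist σ τ ≤ (k : ℝ)}.ncard : ℝ)
        / (Λ m).card)) Filter.atTop (nhds 0))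
    (B : I → I → ℂ) (hB : ∀ σ τ, 1 < dist σ τ → B σ τ = 0)
    (hBe : ∀ (g : G) σ τ, B (g • σ) (g • τ) = B σ τ)
    (M : (m : ℕ) → Matrix (Y m) (Y m) ℂ)
    (hM : ∀ m, ∀ σ τ : Y m, (∀ ρ : I, ρ ∉ Y m → 1 < dist (σ : I) ρ) → M m σ τ = B σ τ)
    (D : ℝ) (hD : 0 ≤ D) (hrow : ∀ m σ, ∑ τ, ‖M m σ τ‖ ≤ D) (k : ℕ) :
    Filter.Tendsto (fun m => ((M m) ^ k).trace.re / (Λ m).card) Filter.atTop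
      (nhds (∑ σ ∈ 𝓕, kerPow B k σ σ).re) := by
  have hinj : ∀ g g' : G, ∀ σ ∈ 𝓕, ∀ σ' ∈ 𝓕, g • σ = g' • σ' → g = g' ∧ σ = σ' := by
    intro g g' σ hσ σ' hσ' h
    have h1 : σ = σ' := by
      refine (hfund σ).unique ⟨hσ, 1, one_smul _ _⟩ ⟨hσ', g'⁻¹ * g, ?_⟩
      rw [mul_smul, h, inv_smul_smul]
    subst h1
    refine ⟨?_, rfl⟩
    have : (g'⁻¹ * g) • σ = σ := by rw [mul_smul, h, inv_smul_smul]
    have := hfree _ _ this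
    exact (inv_mul_eq_one.1 this).symm
  have hsum : ∀ m, ∑ σ ∈ Y m, kerPow B k σ σ = (Λ m).card * ∑ σ ∈ 𝓕, kerPow B k σ σ := by
    intro m
    rw [hY, Finset.sum_biUnion]
    · rw [← nsmul_eq_mul, ← Finset.sum_const]
      refine Finset.sum_congr rfl fun g _ => ?_
      rw [Finset.sum_image (fun a _ b _ h => smul_left_cancel g h)]
      exact Finset.sum_congr rfl fun σ _ => kerPow_equiv B g (hBe g) k σ σ
    · intro g _ g' _ hne
      rw [Function.onFun, Finset.disjoint_left]
      intro x hx hx'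
      obtain ⟨a, ha, rfl⟩ := Finset.mem_image.1 hx
      obtain ⟨a', ha', h⟩ := Finset.mem_image.1 hx'
      exact hne (hinj g g' a ha a' ha' h.symm).1
  set P : ℝ := ∑ σ ∈ 𝓕, ‖kerPow B k σ σ‖ with hP
  have hPb : ∀ σ, ‖kerPow B k σ σ‖ ≤ P := by
    intro σ
    obtain ⟨τ, ⟨hτ, g, hg⟩, _⟩ := hfund σ
    rw [← kerPow_equiv B g (hBe g) k σ σ, hg]
    exact Finset.single_le_sum (f := fun σ => ‖kerPow B k σ σ‖) (fun _ _ => norm_nonneg _) hτ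
  have hDb : ∀ m (σ : Y m), ‖((M m) ^ k) σ σ‖ ≤ D ^ k := by
    intro m σ
    refine le_trans ?_ (rowsum_pow (M m) D hD (hrow m) k σ)
    exact Finset.single_le_sum (f := fun τ => ‖((M m) ^ k) σ τ‖) (fun _ _ => norm_nonneg _)
      (Finset.mem_univ σ)
  rw [tendsto_iff_dist_tendsto_zero]
  have hlim := (hreg k).const_mul (D ^ k + P)
  rw [mul_zero] at hlim
  refine squeeze_zero (fun _ => dist_nonneg) (fun m => ?_) hlim
  have hN : (0 : ℝ) < (Λ m).card := by exact_mod_cast (hΛ m).card_pos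
  rw [Real.dist_eq, ← mul_div_assoc, le_div_iff₀ hN, ← abs_of_pos hN, ← abs_mul, abs_of_pos hN,
    sub_mul, div_mul_cancel₀ _ hN.ne']
  have e1 : (∑ σ ∈ 𝓕, kerPow B k σ σ).re * (Λ m).card = (∑ σ ∈ Y m, kerPow B k σ σ).re := by
    rw [hsum, mul_comm, ← Complex.re_ofReal_mul]; simp
  rw [e1, ← Complex.sub_re, Matrix.trace, ← Finset.sum_coe_sort (Y m), ← Finset.sum_sub_distrib]
  refine (Complex.abs_re_le_norm _).trans ?_
  refine (norm_sum_le _ _).trans ?_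
  classical
  set S : Set I := {σ : I | σ ∈ Y m ∧ ∃ τ : I, τ ∉ Y m ∧ dist σ τ ≤ (k : ℝ)} with hS
  have hSY : S = ((Y m).filter (fun σ => σ ∈ S) : Finset I) := by
    ext σ; simp [hS]
  have hcard : (S.ncard : ℝ) = ∑ σ ∈ Y m, if σ ∈ S then (1 : ℝ) else 0 := by
    conv_lhs => rw [hSY, Set.ncard_coe_finset, Finset.card_filter]
    push_cast
    rfl
  rw [hcard, Finset.mul_sum, ← Finset.sum_coe_sort (Y m)]
  refine Finset.sum_le_sum fun σ _ => ?_
  rw [Matrix.diag_apply]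
  split_ifs with h
  · rw [mul_one]
    exact (norm_sub_le _ _).trans (add_le_add (hDb m σ) (hPb σ))
  · rw [pow_eq_kerPow (Y m) B hB (M m) (hM m) k σ σ, sub_self]
    · simp
    · intro ρ hρ
      by_contra hc
      exact h ⟨σ.2, ρ, hρ, not_lt.1 hc⟩

/-- **Theorem 2.1 (2).** In the amenable Setting, `lim_m F_m(0)` exists and
`lim_{λ→0+} limsup_m F_m(λ) = lim_{λ→0+} liminf_m F_m(λ) = lim_m F_m(0)`:
the normalized eigenvalue counting functions are right continuous at zero in the limit. -/
theorem spectral_density_right_continuous_at_zero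
    {I : Type*} [MetricSpace I] [Countable I] [DecidableEq I]
    {G : Type*} [Group G] [Countable G] [MulAction G I]
    (hfree : ∀ (g : G) (σ : I), g • σ = σ → g = 1)
    (hiso : ∀ (g : G) (σ τ : I), dist (g • σ) (g • τ) = dist σ τ)
    (𝓕 : Finset I)
    (hfund : ∀ σ : I, ∃! τ : I, τ ∈ 𝓕 ∧ ∃ g : G, g • σ = τ)
    (C : ℝ) (b : ℕ) (hC : 0 < C) (hCb : 1 ≤ C * b)
    (hballfin : ∀ σ : I, {τ : I | dist σ τ ≤ 1}.Finite)
    (hballcard : ∀ σ : I, {τ : I | dist σ τ ≤ 1}.ncard ≤ b)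
    (Δ : lp (fun _ : I => ℂ) 2 →L[ℂ] lp (fun _ : I => ℂ) 2)
    (hΔpos : Δ.IsPositive)
    (hΔequiv : ∀ (g : G) (σ τ : I),
      (Δ (delta (g • σ)) : ∀ _ : I, ℂ) (g • τ) = (Δ (delta σ) : ∀ _ : I, ℂ) τ)
    (hΔint : ∀ σ τ : I, ∃ z : ℤ, (Δ (delta σ) : ∀ _ : I, ℂ) τ = (z : ℂ) ∧ |(z : ℝ)| ≤ C)
    (hΔloc : ∀ σ τ : I, 1 < dist σ τ → (Δ (delta σ) : ∀ _ : I, ℂ) τ = 0)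
    (Λ : ℕ → Finset G) (hΛ : ∀ m, (Λ m).Nonempty)
    (Y : ℕ → Finset I)
    (hY : ∀ m, Y m = (Λ m).biUnion fun g => 𝓕.image fun σ => g • σ)
    (hreg : ∀ k : ℕ, Filter.Tendsto
      (fun m => (({σ : I | σ ∈ Y m ∧ ∃ τ : I, τ ∉ Y m ∧ dist σ τ ≤ (k : ℝ)}.ncard : ℝ)
        / (Λ m).card)) Filter.atTop (nhds 0))
    (Δm : (m : ℕ) → Matrix (Y m) (Y m) ℂ)
    (hΔm : ∀ m, (Δm m).PosSemidef)
    (hΔmint : ∀ m, ∀ σ τ : Y m, ∃ z : ℤ, Δm m σ τ = (z : ℂ) ∧ |(z : ℝ)| ≤ C)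
    (hΔmloc : ∀ m, ∀ σ τ : Y m, 1 < dist (σ : I) (τ : I) → Δm m σ τ = 0)
    (hΔmagree : ∀ m, ∀ σ τ : Y m,
      ((∀ ρ : I, ρ ∉ Y m → 1 < dist (σ : I) ρ) ∨ (∀ ρ : I, ρ ∉ Y m → 1 < dist (τ : I) ρ)) →
      Δm m σ τ = (Δ (delta (σ : I)) : ∀ _ : I, ℂ) (τ : I))
    (F : ℕ → ℝ → ℝ)
    (hF : ∀ (m : ℕ) (lam : ℝ), F m lam =
      ((Finset.univ.filter fun i : Y m => (hΔm m).1.eigenvalues i ≤ lam).card : ℝ)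
        / (Λ m).card)
    :
    ∃ L : ℝ,
      Filter.Tendsto (fun m => F m 0) Filter.atTop (nhds L) ∧
      Filter.Tendsto (fun lam : ℝ => Filter.limsup (fun m => F m lam) Filter.atTop)
        (nhdsWithin 0 (Set.Ioi 0)) (nhds L) ∧
      Filter.Tendsto (fun lam : ℝ => Filter.liminf (fun m => F m lam) Filter.atTop)
        (nhdsWithin 0 (Set.Ioi 0)) (nhds L) := by
  classical
  set K : ℝ := C * b with hKdef
  have hK0 : 0 < K := by linarith
  -- row sums
  have hrow : ∀ m σ, ∑ τ, ‖Δm m σ τ‖ ≤ K := by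
    intro m σ
    calc ∑ τ, ‖Δm m σ τ‖ ≤ ∑ τ : Y m, (if dist (σ : I) (τ : I) ≤ 1 then C else 0) := by
          refine Finset.sum_le_sum fun τ _ => ?_
          split_ifs with h
          · obtain ⟨z, hz, hzC⟩ := hΔmint m σ τ
            rw [hz, Complex.norm_intCast]
            exact hzC
          · rw [hΔmloc m σ τ (not_le.1 h)]; simp
      _ = ∑ τ ∈ Y m, (if dist (σ : I) τ ≤ 1 then C else 0) :=
          Finset.sum_coe_sort (Y m) (fun τ => if dist (σ : I) τ ≤ 1 then C else 0)
      _ = C * ((Y m).filter (fun τ => dist (σ : I) τ ≤ 1)).card := by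
          rw [← Finset.sum_filter, Finset.sum_const, nsmul_eq_mul, mul_comm]
      _ ≤ C * b := by
          gcongr
          refine le_trans ?_ (hballcard σ)
          rw [← Set.ncard_coe_finset]
          refine Set.ncard_le_ncard ?_ (hballfin σ)
          intro τ hτ
          simpa using (Finset.mem_filter.1 (Finset.mem_coe.1 hτ)).2
  have heig : ∀ m i, (hΔm m).1.eigenvalues i ≤ K := fun m i => eig_le _ _ K (hrow m) i
  have hcY : ∀ m, (Fintype.card (Y m) : ℝ) ≤ (Λ m).card * 𝓕.card := by
    intro m
    rw [Fintype.card_coe, hY]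
    exact_mod_cast Finset.card_biUnion_le_card_mul _ _ _ (fun g _ => Finset.card_image_le)
  have hN : ∀ m, (0 : ℝ) < (Λ m).card := fun m => by exact_mod_cast (hΛ m).card_pos
  set f : ℝ := (𝓕.card : ℝ) with hf
  have hf0 : 0 ≤ f := Nat.cast_nonneg _
  -- logarithmic estimate
  have hlog : ∀ m lam, 0 < lam → lam < 1 →
      F m lam ≤ F m 0 + f * Real.log K / (- Real.log lam) := by
    intro m lam h0 h1
    have hl : 0 < - Real.log lam := by have := Real.log_neg h0 h1; linarith
    have := count_le (Δm m) (hΔm m) (fun i j => (hΔmint m i j).imp fun _ h => h.1) K hCb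
      (heig m) lam h0 h1
    rw [hF, hF, div_le_iff₀ (hN m), add_mul, div_mul_cancel₀ _ (hN m).ne']
    refine this.trans (add_le_add le_rfl ?_)
    rw [div_mul_eq_mul_div]
    apply div_le_div_of_nonneg_right _ hl.le
    have h3 := mul_le_mul_of_nonneg_right (hcY m) (Real.log_nonneg hCb)
    linarith
  have hmono : ∀ m x y, x ≤ y → F m x ≤ F m y := by
    intro m x y hxy
    rw [hF, hF]
    apply div_le_div_of_nonneg_right _ (hN m).le
    exact_mod_cast Finset.card_le_card
      (Finset.monotone_filter_right _ (fun i _ hi => le_trans hi hxy))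
  have hFnn : ∀ m x, 0 ≤ F m x := by intro m x; rw [hF]; positivity
  have hFle : ∀ m x, F m x ≤ f := by
    intro m x
    rw [hF, div_le_iff₀ (hN m), mul_comm]
    refine le_trans ?_ (hcY m)
    exact_mod_cast Finset.card_le_univ _
  -- moments
  set T : ℕ → ℕ → ℝ := fun k m =>
    ((1 - ((K⁻¹ : ℝ) : ℂ) • Δm m) ^ k).trace.re / (Λ m).card with hT
  have hmom : ∀ k, ∃ t, Tendsto (T k) atTop (nhds t) := by
    intro k
    refine ⟨_, moment_tendsto hfree 𝓕 hfund Λ hΛ Y hY hreg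
      (fun σ τ => (if σ = τ then 1 else 0) -
        ((K⁻¹ : ℝ) : ℂ) * (Δ (delta σ) : ∀ _ : I, ℂ) τ) ?_ ?_
      (fun m => 1 - ((K⁻¹ : ℝ) : ℂ) • Δm m) ?_ 2 (by norm_num) ?_ k⟩
    · intro σ τ h
      have : σ ≠ τ := by rintro rfl; simp at h; linarith
      simp [this, hΔloc σ τ h]
    · intro g σ τ
      simp [hΔequiv]
    · intro m σ τ h
      simp [Matrix.one_apply, hΔmagree m σ τ (Or.inl h)]
    · intro m σ
      calc ∑ τ, ‖(1 - ((K⁻¹ : ℝ) : ℂ) • Δm m) σ τ‖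
          ≤ ∑ τ, (‖(1 : Matrix (Y m) (Y m) ℂ) σ τ‖ + K⁻¹ * ‖Δm m σ τ‖) := by
            refine Finset.sum_le_sum fun τ _ => ?_
            rw [Matrix.sub_apply, Matrix.smul_apply]
            refine (norm_sub_le _ _).trans (le_of_eq ?_)
            rw [smul_eq_mul, norm_mul, Complex.norm_real, Real.norm_of_nonneg (inv_nonneg.2 hK0.le)]
        _ = 1 + K⁻¹ * ∑ τ, ‖Δm m σ τ‖ := by
            rw [Finset.sum_add_distrib, Finset.mul_sum]
            simp [Matrix.one_apply, apply_ite]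
        _ ≤ 1 + K⁻¹ * K := by gcongr; exact hrow m σ
        _ = 2 := by rw [inv_mul_cancel₀ hK0.ne']; norm_num
  have hsand : ∀ k m lam, 0 < lam → lam < 1 →
      F m 0 ≤ T k m ∧ T k m ≤ F m lam + f * (1 - K⁻¹ * lam) ^ k := by
    intro k m lam h0 h1
    obtain ⟨ha, hb⟩ := trace_sandwich (Δm m) (hΔm m) K hCb (heig m) lam h0 h1 k
    constructor
    · rw [hF]
      exact div_le_div_of_nonneg_right ha (hN m).le
    · rw [hF, hT]
      simp only
      rw [div_le_iff₀ (hN m), add_mul, div_mul_cancel₀ _ (hN m).ne']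
      refine hb.trans (add_le_add le_rfl ?_)
      have hq : 0 ≤ (1 - K⁻¹ * lam) ^ k := by
        apply pow_nonneg
        have : K⁻¹ * lam ≤ 1 * 1 :=
          mul_le_mul (inv_le_one_of_one_le₀ hCb) h1.le h0.le zero_le_one
        linarith
      have h3 := mul_le_mul_of_nonneg_right (hcY m) hq
      linarith
  -- the error term tends to zero
  have herr : Tendsto (fun lam : ℝ => f * Real.log K / (- Real.log lam))
      (nhdsWithin 0 (Set.Ioi 0)) (nhds 0) := by
    apply Tendsto.const_div_atTop
    exact tendsto_neg_atBot_atTop.comp Real.tendsto_log_nhdsGT_zero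
  have hsmall : ∀ᶠ lam : ℝ in nhdsWithin 0 (Set.Ioi 0), 0 < lam ∧ lam < 1 := by
    have : Set.Ioo (0:ℝ) 1 ∈ nhdsWithin (0:ℝ) (Set.Ioi 0) := Ioo_mem_nhdsGT zero_lt_one
    exact this
  -- Cauchy
  have hcau : CauchySeq (fun m => F m 0) := by
    rw [Metric.cauchySeq_iff']
    intro ε hε
    obtain ⟨lam, ⟨h0, h1⟩, hlam⟩ :=
      (hsmall.and (herr.eventually (gt_mem_nhds (show (0:ℝ) < ε / 8 by positivity)))).exists
    have hq : Tendsto (fun k : ℕ => f * (1 - K⁻¹ * lam) ^ k) atTop (nhds 0) := by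
      have h2 : 0 < K⁻¹ * lam := mul_pos (inv_pos.2 hK0) h0
      have h3 : K⁻¹ * lam ≤ 1 * 1 :=
          mul_le_mul (inv_le_one_of_one_le₀ hCb) h1.le h0.le zero_le_one
      have := (tendsto_pow_atTop_nhds_zero_of_lt_one (r := 1 - K⁻¹ * lam) (by linarith)
        (by linarith)).const_mul f
      simpa using this
    obtain ⟨k, hk⟩ := (hq.eventually (gt_mem_nhds (show (0:ℝ) < ε / 8 by positivity))).exists
    obtain ⟨t, ht⟩ := hmom k
    obtain ⟨n, hn⟩ := Metric.cauchySeq_iff'.1 ht.cauchySeq (ε / 4) (by positivity)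
    refine ⟨n, fun m hm => ?_⟩
    have hd := hn m hm
    rw [Real.dist_eq, abs_lt] at hd ⊢
    have a1 := hsand k m lam h0 h1
    have a2 := hsand k n lam h0 h1
    have a3 := hlog m lam h0 h1
    have a4 := hlog n lam h0 h1
    constructor <;> linarith [a1.1, a1.2, a2.1, a2.2, hd.1, hd.2]
  obtain ⟨L, hL⟩ := cauchySeq_tendsto_of_complete hcau
  have hbdle : ∀ x, IsBoundedUnder (· ≤ ·) atTop (fun m => F m x) :=
    fun x => isBoundedUnder_of ⟨f, fun m => hFle m x⟩
  have hbdge : ∀ x, IsBoundedUnder (· ≥ ·) atTop (fun m => F m x) :=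
    fun x => isBoundedUnder_of ⟨0, fun m => hFnn m x⟩
  have hlow : ∀ lam, 0 < lam → L ≤ liminf (fun m => F m lam) atTop := by
    intro lam h0
    rw [← hL.liminf_eq]
    exact liminf_le_liminf (Eventually.of_forall fun m => hmono m 0 lam h0.le)
      (hbdge 0) (hbdle lam).isCoboundedUnder_ge
  have hmid : ∀ lam, liminf (fun m => F m lam) atTop ≤ limsup (fun m => F m lam) atTop :=
    fun lam => liminf_le_limsup (hbdle lam) (hbdge lam)
  have hup : ∀ lam, 0 < lam → lam < 1 →
      limsup (fun m => F m lam) atTop ≤ L + f * Real.log K / (- Real.log lam) := by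
    intro lam h0 h1
    have hL' := hL.add_const (f * Real.log K / (- Real.log lam))
    rw [← hL'.limsup_eq]
    exact limsup_le_limsup (Eventually.of_forall fun m => hlog m lam h0 h1)
      (hbdge lam).isCoboundedUnder_le hL'.isBoundedUnder_le
  have herr' : Tendsto (fun lam : ℝ => L + f * Real.log K / (- Real.log lam))
      (nhdsWithin 0 (Set.Ioi 0)) (nhds L) := by
    simpa using herr.const_add L
  refine ⟨L, hL, ?_, ?_⟩
  · refine tendsto_of_tendsto_of_tendsto_of_le_of_le' tendsto_const_nhds herr' ?_ ?_
    · filter_upwards [hsmall] with lam h using (hlow lam h.1).trans (hmid lam)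
    · filter_upwards [hsmall] with lam h using hup lam h.1 h.2
  · refine tendsto_of_tendsto_of_tendsto_of_le_of_le' tendsto_const_nhds herr' ?_ ?_
    · filter_upwards [hsmall] with lam h using hlow lam h.1
    · filter_upwards [hsmall] with lam h using (hmid lam).trans (hup lam h.1 h.2)
end

section
/- In the Setting, the limit L = lim_{m→∞} F_m(0) exists and ∫_{(0, C·b]} (liminf_{m→∞} F_m(λ) − L)/λ dλ ≤ #𝓕 · log(C·b); in particular this integral is finite. (This is the operator-theoretic form of the statement that an amenable normal covering space of a finite simplicial complex is of determinant class.) -/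
open scoped ComplexOrder

open Filter

lemma dc_trailing_prod {n : Type*} [Fintype n] (f : n → ℂ) :
    (∏ i, (Polynomial.X - Polynomial.C (f i))).trailingCoeff = ∏ i, (if f i = 0 then 1 else - f i) := by
  classical
  have h : ∀ s : Finset n, (∏ i ∈ s, (Polynomial.X - Polynomial.C (f i))).trailingCoeff = ∏ i ∈ s, (if f i = 0 then 1 else - f i) := by
    intro s
    induction s using Finset.induction_on with
    | empty => simp [Polynomial.trailingCoeff]
    | insert a s ha ih =>
      rw [Finset.prod_insert ha, Finset.prod_insert ha, Polynomial.trailingCoeff_mul, ih]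
      congr 1
      split_ifs with h0
      · rw [h0]; simp [Polynomial.trailingCoeff]
      · rw [Polynomial.trailingCoeff, Polynomial.natTrailingDegree_eq_zero.2 (Or.inr (by simpa using h0))]
        simp
  exact h _

lemma dc_prod_ge_one {n : Type*} [Fintype n] [DecidableEq n] (A : Matrix n n ℂ) (hA : A.IsHermitian)
    (hint : ∀ i j, ∃ z : ℤ, A i j = (z : ℂ)) :
    1 ≤ ∏ i, (if hA.eigenvalues i = 0 then 1 else |hA.eigenvalues i|) := by
  choose z hz using hint
  have hM : A = (Matrix.of z).map (Int.castRingHom ℂ) := by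
    ext i j; simp [hz]
  have h1 := hA.charpoly_eq
  have h2 : A.charpoly = (Matrix.of z).charpoly.map (Int.castRingHom ℂ) := by
    rw [hM, Matrix.charpoly_map]
  have h3 := dc_trailing_prod (fun i => ((hA.eigenvalues i : ℝ) : ℂ))
  have h4 : (∏ i, (if hA.eigenvalues i = 0 then 1 else |hA.eigenvalues i|)) =
     ‖A.charpoly.trailingCoeff‖ := by
    rw [h1]; erw [h3]
    rw [norm_prod]
    refine Finset.prod_congr rfl fun i _ => ?_
    simp only [Complex.ofReal_eq_zero]
    split_ifs <;> simp
  have hnz : (Matrix.of z).charpoly ≠ 0 := (Matrix.charpoly_monic _).ne_zero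
  have hinj : Function.Injective (Int.castRingHom ℂ) := Int.cast_injective
  have hdeg : A.charpoly.natTrailingDegree = (Matrix.of z).charpoly.natTrailingDegree := by
    rw [h2]
    apply le_antisymm
    · apply Polynomial.natTrailingDegree_le_of_ne_zero
      rw [Polynomial.coeff_map]
      have := Polynomial.trailingCoeff_nonzero_iff_nonzero.2 hnz
      rw [Polynomial.trailingCoeff] at this
      simpa using this
    · apply Polynomial.le_natTrailingDegree
      · rw [← h2]; exact (Matrix.charpoly_monic _).ne_zero
      · intro m hm
        rw [Polynomial.coeff_map, Polynomial.coeff_eq_zero_of_lt_natTrailingDegree hm, map_zero]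
  rw [h4, Polynomial.trailingCoeff, hdeg, h2, Polynomial.coeff_map]
  have := Polynomial.trailingCoeff_nonzero_iff_nonzero.2 hnz
  rw [Polynomial.trailingCoeff] at this
  have h5 := Int.one_le_abs this
  simp only [eq_intCast, Complex.norm_intCast]
  exact_mod_cast h5

lemma dc_log_nonneg {n : Type*} [Fintype n] (μ : n → ℝ)
    (h : 1 ≤ ∏ i, (if μ i = 0 then 1 else |μ i|)) :
    0 ≤ ∑ i, Real.log (μ i) := by
  have h1 := Real.log_nonneg h
  rw [Real.log_prod] at h1
  · refine h1.trans_eq (Finset.sum_congr rfl fun i _ => ?_)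
    split_ifs with h <;> simp [h]
  · intro i _
    split_ifs with h <;> simp [h]

lemma dc_eig_le {n : Type*} [Fintype n] [DecidableEq n] (A : Matrix n n ℂ) (hA : A.IsHermitian) (K : ℝ)
    (hrow : ∀ i, ∑ j, ‖A i j‖ ≤ K) (i : n) : hA.eigenvalues i ≤ K := by
  have hev : Module.End.HasEigenvalue (Matrix.toLin' A) ((hA.eigenvalues i : ℝ) : ℂ) := by
    refine Module.End.hasEigenvalue_of_hasEigenvector (x := WithLp.ofLp (hA.eigenvectorBasis i)) ⟨?_, ?_⟩
    · rw [Module.End.mem_eigenspace_iff, Matrix.toLin'_apply]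
      have := hA.mulVec_eigenvectorBasis i
      simpa using this
    · have := hA.eigenvectorBasis.orthonormal.ne_zero i
      intro h
      apply this
      ext j
      exact congrFun h j
  obtain ⟨k, hk⟩ := eigenvalue_mem_ball hev
  rw [Metric.mem_closedBall, dist_eq_norm] at hk
  have h1 := hrow k
  rw [← Finset.add_sum_erase _ _ (Finset.mem_univ k)] at h1
  have h2 : ‖((hA.eigenvalues i : ℝ) : ℂ)‖ ≤ ‖((hA.eigenvalues i : ℝ) : ℂ) - A k k‖ + ‖A k k‖ := by
    simpa using norm_add_le (((hA.eigenvalues i : ℝ) : ℂ) - A k k) (A k k)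
  rw [Complex.norm_real] at h2
  have := le_abs_self (hA.eigenvalues i)
  rw [Real.norm_eq_abs] at h2
  linarith

lemma dc_trace {n : Type*} [Fintype n] [DecidableEq n] (A : Matrix n n ℂ) (hA : A.IsHermitian) (K : ℝ) (k : ℕ) :
    ((1 - (K⁻¹ : ℂ) • A) ^ k).trace = ((∑ i, (1 - hA.eigenvalues i / K) ^ k : ℝ) : ℂ) := by
  have h := hA.spectral_theorem
  have h2 : (1 - (K⁻¹ : ℂ) • A) ^ k = Unitary.conjStarAlgAut ℂ _ hA.eigenvectorUnitary
     ((1 - (K⁻¹ : ℂ) • Matrix.diagonal (RCLike.ofReal ∘ hA.eigenvalues)) ^ k) := by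
    rw [map_pow, map_sub, map_one, map_smul, ← h]
  have h3 : (1 - (K⁻¹ : ℂ) • Matrix.diagonal (RCLike.ofReal ∘ hA.eigenvalues) : Matrix n n ℂ) =
     Matrix.diagonal (fun i => ((1 - hA.eigenvalues i / K : ℝ) : ℂ)) := by
    ext i j
    by_cases hij : i = j
    · subst hij; simp; ring
    · simp [hij]
  rw [h2, h3, Matrix.diagonal_pow, Unitary.conjStarAlgAut_apply, Matrix.trace_mul_cycle,
    Unitary.coe_star_mul_self, one_mul, Matrix.trace_diagonal]
  simp

lemma dc_count {n : Type*} [Fintype n] (μ : n → ℝ) (lam : ℝ) :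
    ((Finset.univ.filter fun i => μ i ≤ lam).card : ℝ) = ∑ i, if μ i ≤ lam then (1:ℝ) else 0 := by
  simp

lemma dc_approx {n : Type*} [Fintype n] (μ : n → ℝ) (K N ε : ℝ) (hK : 1 ≤ K) (hN : 0 < N)
    (h0 : ∀ i, 0 ≤ μ i) (h1 : ∀ i, μ i ≤ K) (hlog : 0 ≤ ∑ i, Real.log (μ i)) (hε : 0 < ε) (hεK : ε < K) (k : ℕ) :
    |(∑ i, (1 - μ i / K) ^ k) / N - ((Finset.univ.filter fun i => μ i ≤ 0).card : ℝ) / N| ≤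
      (Fintype.card n : ℝ) / N * (Real.log K / Real.log (K / ε) + (1 - ε / K) ^ k) := by
  have hK0 : 0 < K := by linarith
  have hl : 0 < Real.log (K / ε) := Real.log_pos (by rw [lt_div_iff₀ hε]; linarith)
  have hKl : 0 ≤ Real.log K := Real.log_nonneg hK
  have hεle : 0 ≤ 1 - ε / K := by rw [sub_nonneg, div_le_one hK0]; exact hεK.le
  have key : ∀ i, (if μ i ≤ 0 then (1:ℝ) else 0) ≤ (1 - μ i / K) ^ k ∧
      (1 - μ i / K) ^ k ≤ (if μ i ≤ 0 then (1:ℝ) else 0) + ((Real.log K - Real.log (μ i)) / Real.log (K / ε) + (1 - ε / K) ^ k) := by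
    intro i
    have hp := pow_nonneg hεle k
    have hi : 0 ≤ 1 - μ i / K := by rw [sub_nonneg, div_le_one hK0]; exact h1 i
    have hi1 : 1 - μ i / K ≤ 1 := by have := div_nonneg (h0 i) hK0.le; linarith
    rcases (h0 i).eq_or_lt with h | h
    · rw [← h]; simp; positivity
    · rw [if_neg (not_le.2 h)]
      refine ⟨pow_nonneg hi k, ?_⟩
      rw [zero_add]
      rcases le_or_gt (μ i) ε with h2 | h2
      · have : 1 ≤ (Real.log K - Real.log (μ i)) / Real.log (K / ε) := by
          rw [le_div_iff₀ hl, one_mul, Real.log_div hK0.ne' hε.ne']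
          have := Real.log_le_log h h2
          linarith
        have := pow_le_one₀ (n := k) hi hi1
        linarith
      · have : 0 ≤ (Real.log K - Real.log (μ i)) / Real.log (K / ε) := by
          apply div_nonneg _ hl.le
          have := Real.log_le_log h (h1 i)
          linarith
        have h3 : (1 - μ i / K) ^ k ≤ (1 - ε / K) ^ k := by
          apply pow_le_pow_left₀ hi
          gcongr
        linarith
  have s1 := Finset.sum_le_sum (s := Finset.univ) fun i _ => (key i).1
  have s2 := Finset.sum_le_sum (s := Finset.univ) fun i _ => (key i).2
  rw [Finset.sum_add_distrib, Finset.sum_add_distrib, ← Finset.sum_div, Finset.sum_sub_distrib] at s2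
  simp only [Finset.sum_const, Finset.card_univ, nsmul_eq_mul] at s2
  rw [← dc_count] at s1 s2
  rw [← sub_div, abs_of_nonneg (div_nonneg (by linarith) hN.le), div_mul_eq_mul_div]
  apply div_le_div_of_nonneg_right _ hN.le
  have : ((Fintype.card n : ℝ) * Real.log K - ∑ i, Real.log (μ i)) / Real.log (K / ε) ≤ (Fintype.card n : ℝ) * Real.log K / Real.log (K/ε) := by
    apply div_le_div_of_nonneg_right _ hl.le
    linarith
  rw [mul_add, ← mul_div_assoc]
  linarith

lemma dc_int1 (μ K N : ℝ) (hμ : 0 < μ) (hμK : μ ≤ K) (hN : 0 < N) :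
    ∫⁻ lam in Set.Ioc (0:ℝ) K, ENNReal.ofReal (if 0 < μ ∧ μ ≤ lam then (N * lam)⁻¹ else 0) =
      ENNReal.ofReal ((Real.log K - Real.log μ) / N) := by
  have e1 : ∀ lam : ℝ, ENNReal.ofReal (if 0 < μ ∧ μ ≤ lam then (N * lam)⁻¹ else 0) =
     (Set.Ici μ).indicator (fun lam => ENNReal.ofReal ((N * lam)⁻¹)) lam := by
    intro lam
    by_cases h : μ ≤ lam <;> simp [Set.indicator, hμ, h]
  simp_rw [e1]
  rw [MeasureTheory.setLIntegral_indicator measurableSet_Ici]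
  have e2 : Set.Ici μ ∩ Set.Ioc 0 K = Set.Icc μ K := by
    ext x; simp only [Set.mem_inter_iff, Set.mem_Ici, Set.mem_Ioc, Set.mem_Icc]
    constructor
    · rintro ⟨a, b, c⟩; exact ⟨a, c⟩
    · rintro ⟨a, c⟩; exact ⟨a, by linarith, c⟩
  rw [e2, MeasureTheory.Measure.restrict_congr_set MeasureTheory.Ioc_ae_eq_Icc.symm]
  have hint : IntervalIntegrable (fun lam : ℝ => (N * lam)⁻¹) MeasureTheory.volume μ K := by
    apply ContinuousOn.intervalIntegrable
    rw [Set.uIcc_of_le hμK]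
    apply ContinuousOn.inv₀ (by fun_prop)
    intro x hx
    have : 0 < x := lt_of_lt_of_le hμ hx.1
    positivity
  rw [← MeasureTheory.ofReal_integral_eq_lintegral_ofReal]
  · rw [← intervalIntegral.integral_of_le hμK]
    simp_rw [mul_inv]
    rw [intervalIntegral.integral_const_mul, integral_inv_of_pos hμ (by linarith),
      Real.log_div (by linarith) hμ.ne']
    congr 1; field_simp
  · exact (intervalIntegrable_iff_integrableOn_Ioc_of_le hμK).1 hint
  · refine (MeasureTheory.ae_restrict_mem measurableSet_Ioc).mono fun x hx => ?_
    have : 0 < x := lt_trans hμ hx.1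
    simp only [Pi.zero_apply]
    positivity

lemma dc_int {n : Type*} [Fintype n] (μ : n → ℝ) (K N : ℝ) (hK : 1 ≤ K) (hN : 0 < N)
    (h0 : ∀ i, 0 ≤ μ i) (h1 : ∀ i, μ i ≤ K) (hlog : 0 ≤ ∑ i, Real.log (μ i)) :
    ∫⁻ lam in Set.Ioc (0:ℝ) K, ENNReal.ofReal
      ((((Finset.univ.filter fun i => μ i ≤ lam).card : ℝ) / N -
        ((Finset.univ.filter fun i => μ i ≤ 0).card : ℝ) / N) / lam) ≤
      ENNReal.ofReal ((Fintype.card n : ℝ) / N * Real.log K) := by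
  have hKl : 0 ≤ Real.log K := Real.log_nonneg hK
  have e1 : ∫⁻ lam in Set.Ioc (0:ℝ) K, ENNReal.ofReal
      ((((Finset.univ.filter fun i => μ i ≤ lam).card : ℝ) / N -
        ((Finset.univ.filter fun i => μ i ≤ 0).card : ℝ) / N) / lam) =
      ∫⁻ lam in Set.Ioc (0:ℝ) K, ∑ i, ENNReal.ofReal (if 0 < μ i ∧ μ i ≤ lam then (N * lam)⁻¹ else 0) := by
    apply MeasureTheory.setLIntegral_congr_fun measurableSet_Ioc
    intro lam hlam
    simp only
    have hl : 0 < lam := hlam.1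
    rw [← ENNReal.ofReal_sum_of_nonneg]
    · congr 1
      rw [dc_count, dc_count, ← sub_div, ← Finset.sum_sub_distrib, div_div, Finset.sum_div]
      refine Finset.sum_congr rfl fun i _ => ?_
      by_cases ha : μ i ≤ 0
      · simp [ha, ha.trans hl.le, not_lt.2 ha]
      · by_cases hb : μ i ≤ lam <;> simp [ha, hb, not_le.1 ha, div_eq_mul_inv]
    · intro i _
      split_ifs <;> positivity
  rw [e1, MeasureTheory.lintegral_finsetSum]
  · have e2 : ∀ i, ∫⁻ lam in Set.Ioc (0:ℝ) K, ENNReal.ofReal (if 0 < μ i ∧ μ i ≤ lam then (N * lam)⁻¹ else 0) ≤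
        ENNReal.ofReal ((Real.log K - Real.log (μ i)) / N) := by
      intro i
      rcases (h0 i).eq_or_lt with h | h
      · simp [← h]
      · exact (dc_int1 (μ i) K N h (h1 i) hN).le
    refine (Finset.sum_le_sum fun i _ => e2 i).trans ?_
    rw [← ENNReal.ofReal_sum_of_nonneg]
    · apply ENNReal.ofReal_le_ofReal
      rw [← Finset.sum_div, Finset.sum_sub_distrib, div_mul_eq_mul_div]
      apply div_le_div_of_nonneg_right _ hN.le
      simp only [Finset.sum_const, Finset.card_univ, nsmul_eq_mul]
      linarith
    · intro i _
      apply div_nonneg _ hN.le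
      rcases (h0 i).eq_or_lt with h | h
      · simp [← h, hKl]
      · have := Real.log_le_log h (h1 i)
        linarith
  · intro i _
    apply Measurable.ennreal_ofReal
    apply Measurable.ite
    · by_cases h : 0 < μ i
      · simp only [h, true_and]; exact measurableSet_Ici
      · simp [h]
    · fun_prop
    · fun_prop

/-- Entries of the `k`-th power of an infinite band matrix. -/
noncomputable def dcP {I : Type*} [DecidableEq I] (a : I → I → ℂ) : ℕ → I → I → ℂ
  | 0, σ, τ => if σ = τ then 1 else 0
  | k + 1, σ, τ => ∑ᶠ ρ, a σ ρ * dcP a k ρ τ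

lemma dcP_equiv {I : Type*} [DecidableEq I] {G : Type*} [Group G] [MulAction G I] (a : I → I → ℂ)
    (ha : ∀ (g : G) σ τ, a (g • σ) (g • τ) = a σ τ) (k : ℕ) (g : G) (σ τ : I) :
    dcP a k (g • σ) (g • τ) = dcP a k σ τ := by
  induction k generalizing σ τ with
  | zero => simp [dcP]
  | succ k ih =>
    simp only [dcP]
    rw [← finsum_comp_equiv (MulAction.toPerm g)]
    simp [ha, ih]

lemma dcP_agree {I : Type*} [MetricSpace I] [DecidableEq I] (a : I → I → ℂ)
    (hloc : ∀ σ τ, 1 < dist σ τ → a σ τ = 0) (Y : Finset I) (M : Matrix Y Y ℂ)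
    (hag : ∀ σ τ : Y, (∀ ρ : I, ρ ∉ Y → 1 < dist (σ : I) ρ) → M σ τ = a σ τ) (k : ℕ) (σ τ : Y)
    (hσ : ∀ ρ : I, ρ ∉ Y → (k : ℝ) < dist (σ : I) ρ) : (M ^ k) σ τ = dcP a k σ τ := by
  induction k generalizing σ with
  | zero => simp [dcP, Matrix.one_apply]
  | succ k ih =>
    have h1 : ∀ ρ : I, ρ ∉ Y → 1 < dist (σ : I) ρ := by
      intro ρ hρ
      have := hσ ρ hρ
      push_cast at this
      have : (0:ℝ) ≤ k := by positivity
      linarith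
    rw [pow_succ', Matrix.mul_apply, dcP, finsum_eq_sum_of_support_subset (s := Y), ← Finset.sum_coe_sort Y]
    · refine Finset.sum_congr rfl fun ρ _ => ?_
      rw [hag σ ρ h1]
      by_cases hd : 1 < dist (σ : I) ρ
      · rw [hloc _ _ hd]; simp
      · rw [ih]
        intro x hx
        have := hσ x hx
        have h3 := dist_triangle (σ : I) ρ x
        push_cast at this
        linarith
    · intro ρ hρ
      by_contra hn
      apply hρ
      simp [hloc _ _ (h1 ρ (by simpa using hn))]

lemma dc_pow_bound {n : Type*} [Fintype n] [DecidableEq n] (M : Matrix n n ℂ) (D : ℝ) (hD : 0 ≤ D)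
    (h : ∀ i, ∑ j, ‖M i j‖ ≤ D) (k : ℕ) (i j : n) : ‖(M ^ k) i j‖ ≤ D ^ k := by
  induction k generalizing i with
  | zero => simp only [pow_zero, Matrix.one_apply]; split_ifs <;> simp
  | succ k ih =>
    rw [pow_succ', Matrix.mul_apply, pow_succ']
    refine (norm_sum_le _ _).trans ?_
    calc _ ≤ ∑ l, ‖M i l‖ * D ^ k := by
            refine Finset.sum_le_sum fun l _ => ?_
            rw [norm_mul]
            exact mul_le_mul_of_nonneg_left (ih l) (norm_nonneg _)
      _ ≤ _ := by
        rw [← Finset.sum_mul]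
        exact mul_le_mul_of_nonneg_right (h i) (by positivity)

lemma dc_inj {I : Type*} {G : Type*} [Group G] [MulAction G I]
    (hfree : ∀ (g : G) (σ : I), g • σ = σ → g = 1)
    (𝓕 : Finset I)
    (hfund : ∀ σ : I, ∃! τ : I, τ ∈ 𝓕 ∧ ∃ g : G, g • σ = τ) (g h : G) (σ τ : I) (hσ : σ ∈ 𝓕) (hτ : τ ∈ 𝓕)
    (he : g • σ = h • τ) : g = h ∧ σ = τ := by
  have e : (h⁻¹ * g) • σ = τ := by rw [mul_smul, he, inv_smul_smul]
  have hst : σ = τ := (hfund σ).unique ⟨hσ, 1, one_smul _ _⟩ ⟨hτ, _, e⟩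
  subst hst
  have := hfree _ _ e
  refine ⟨?_, rfl⟩
  rw [inv_mul_eq_one] at this
  exact this.symm

lemma dc_sumY {I : Type*} [DecidableEq I] {G : Type*} [Group G] [MulAction G I]
    (hfree : ∀ (g : G) (σ : I), g • σ = σ → g = 1)
    (𝓕 : Finset I)
    (hfund : ∀ σ : I, ∃! τ : I, τ ∈ 𝓕 ∧ ∃ g : G, g • σ = τ) (Λ : Finset G) {E : Type*} [AddCommMonoid E] (f : I → E)
    (hf : ∀ (g : G) σ, f (g • σ) = f σ) :
    ∑ σ ∈ Λ.biUnion (fun g => 𝓕.image fun σ => g • σ), f σ = Λ.card • ∑ σ ∈ 𝓕, f σ := by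
  rw [Finset.sum_biUnion, Finset.sum_congr rfl (g := fun _ => ∑ σ ∈ 𝓕, f σ), Finset.sum_const]
  · intro g _
    rw [Finset.sum_image]
    · simp [hf]
    · intro x _ y _ hxy
      exact MulAction.injective g hxy
  · intro g _ h _ hgh
    simp only [Function.onFun]
    rw [Finset.disjoint_left]
    intro x hx hy
    rw [Finset.mem_image] at hx hy
    obtain ⟨s, hs, rfl⟩ := hx
    obtain ⟨t, ht, h2⟩ := hy
    exact hgh (dc_inj hfree 𝓕 hfund g h s t hs ht h2.symm).1

lemma dc_moment {I : Type*} [MetricSpace I] [DecidableEq I]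
    {G : Type*} [Group G] [MulAction G I]
    (hfree : ∀ (g : G) (σ : I), g • σ = σ → g = 1)
    (𝓕 : Finset I)
    (hfund : ∀ σ : I, ∃! τ : I, τ ∈ 𝓕 ∧ ∃ g : G, g • σ = τ)
    (Λ : ℕ → Finset G) (hΛ : ∀ m, (Λ m).Nonempty)
    (Y : ℕ → Finset I)
    (hY : ∀ m, Y m = (Λ m).biUnion fun g => 𝓕.image fun σ => g • σ)
    (hreg : ∀ k : ℕ, Filter.Tendsto
      (fun m => (({σ : I | σ ∈ Y m ∧ ∃ τ : I, τ ∉ Y m ∧ dist σ τ ≤ (k : ℝ)}.ncard : ℝ)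
        / (Λ m).card)) Filter.atTop (nhds 0))
    (a : I → I → ℂ)
    (ha : ∀ (g : G) σ τ, a (g • σ) (g • τ) = a σ τ)
    (hloc : ∀ σ τ, 1 < dist σ τ → a σ τ = 0)
    (M : (m : ℕ) → Matrix (Y m) (Y m) ℂ)
    (hag : ∀ m, ∀ σ τ : Y m, (∀ ρ : I, ρ ∉ Y m → 1 < dist (σ : I) ρ) → M m σ τ = a σ τ)
    (D : ℝ) (hD : 0 ≤ D) (hrow : ∀ m i, ∑ j, ‖M m i j‖ ≤ D) (k : ℕ) :
    Tendsto (fun m => (M m ^ k).trace / ((Λ m).card : ℂ)) atTop (nhds (∑ σ ∈ 𝓕, dcP a k σ σ)) := by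
  classical
  set f : I → ℂ := fun σ => dcP a k σ σ with hfdef
  have hf : ∀ (g : G) σ, f (g • σ) = f σ := fun g σ => dcP_equiv a ha k g σ σ
  set B : ℝ := ∑ σ ∈ 𝓕, ‖f σ‖ with hB
  have hfB : ∀ σ, ‖f σ‖ ≤ B := by
    intro σ
    obtain ⟨τ, ⟨hτ, g, hg⟩, -⟩ := hfund σ
    rw [← hf g σ, hg]
    exact Finset.single_le_sum (f := fun σ => ‖f σ‖) (fun _ _ => norm_nonneg _) hτ
  rw [tendsto_iff_norm_sub_tendsto_zero]
  have hlim := (hreg k).mul_const (D ^ k + B)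
  rw [zero_mul] at hlim
  refine squeeze_zero (fun _ => norm_nonneg _) (fun m => ?_) hlim
  have hN : (0:ℝ) < (Λ m).card := by exact_mod_cast (hΛ m).card_pos
  have hNc : ((Λ m).card : ℂ) ≠ 0 := by exact_mod_cast hN.ne'
  have e1 : ∑ σ : Y m, f σ = (Λ m).card * ∑ σ ∈ 𝓕, f σ := by
    rw [Finset.sum_coe_sort (Y m) f]
    have := dc_sumY hfree 𝓕 hfund (Λ m) f hf
    rw [← hY m, nsmul_eq_mul] at this
    exact this
  have e2 : (M m ^ k).trace / ((Λ m).card : ℂ) - ∑ σ ∈ 𝓕, f σ =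
     (∑ σ : Y m, ((M m ^ k) σ σ - f σ)) / ((Λ m).card : ℂ) := by
    rw [Finset.sum_sub_distrib, e1, sub_div, mul_div_cancel_left₀ _ hNc]
    rfl
  rw [e2, norm_div, Complex.norm_natCast, div_mul_eq_mul_div]
  apply div_le_div_of_nonneg_right _ hN.le
  refine (norm_sum_le _ _).trans ?_
  set bad : Finset I := (Y m).filter fun σ => ∃ τ : I, τ ∉ Y m ∧ dist σ τ ≤ (k : ℝ) with hbad
  have e3 : {σ : I | σ ∈ Y m ∧ ∃ τ : I, τ ∉ Y m ∧ dist σ τ ≤ (k : ℝ)} = (bad : Set I) := by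
    ext; simp [hbad]
  rw [e3, Set.ncard_coe_finset]
  have e4 : ∀ σ : Y m, ‖(M m ^ k) σ σ - f σ‖ ≤ if (σ : I) ∈ bad then D ^ k + B else 0 := by
    intro σ
    split_ifs with h
    · refine (norm_sub_le _ _).trans (add_le_add (dc_pow_bound _ D hD (hrow m) k σ σ) (hfB σ))
    · rw [dcP_agree a hloc (Y m) (M m) (hag m) k σ σ]
      · simp [hfdef]
      · intro ρ hρ
        by_contra hc
        exact h (by simp only [hbad, Finset.mem_filter]; exact ⟨σ.2, ρ, hρ, not_lt.1 hc⟩)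
  refine (Finset.sum_le_sum fun σ _ => e4 σ).trans ?_
  rw [Finset.sum_coe_sort (Y m) (fun σ => if σ ∈ bad then D ^ k + B else 0), ← Finset.sum_filter, Finset.sum_const, nsmul_eq_mul]
  apply le_of_eq
  congr 3
  ext x; simp [hbad]

/-- **Determinant Class Theorem (operator form).** In the amenable Setting, the limit
`L = lim_m F_m(0)` exists and
`∫_{(0, C·b]} (liminf_m F_m(λ) − L)/λ dλ ≤ #𝓕 · log(C·b)`; in particular this integral
is finite. -/
theorem determinant_class
    {I : Type*} [MetricSpace I] [Countable I] [DecidableEq I]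
    {G : Type*} [Group G] [Countable G] [MulAction G I]
    (hfree : ∀ (g : G) (σ : I), g • σ = σ → g = 1)
    (hiso : ∀ (g : G) (σ τ : I), dist (g • σ) (g • τ) = dist σ τ)
    (𝓕 : Finset I)
    (hfund : ∀ σ : I, ∃! τ : I, τ ∈ 𝓕 ∧ ∃ g : G, g • σ = τ)
    (C : ℝ) (b : ℕ) (hC : 0 < C) (hCb : 1 ≤ C * b)
    (hballfin : ∀ σ : I, {τ : I | dist σ τ ≤ 1}.Finite)
    (hballcard : ∀ σ : I, {τ : I | dist σ τ ≤ 1}.ncard ≤ b)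
    (Δ : lp (fun _ : I => ℂ) 2 →L[ℂ] lp (fun _ : I => ℂ) 2)
    (hΔpos : Δ.IsPositive)
    (hΔequiv : ∀ (g : G) (σ τ : I),
      (Δ (delta (g • σ)) : ∀ _ : I, ℂ) (g • τ) = (Δ (delta σ) : ∀ _ : I, ℂ) τ)
    (hΔint : ∀ σ τ : I, ∃ z : ℤ, (Δ (delta σ) : ∀ _ : I, ℂ) τ = (z : ℂ) ∧ |(z : ℝ)| ≤ C)
    (hΔloc : ∀ σ τ : I, 1 < dist σ τ → (Δ (delta σ) : ∀ _ : I, ℂ) τ = 0)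
    (Λ : ℕ → Finset G) (hΛ : ∀ m, (Λ m).Nonempty)
    (Y : ℕ → Finset I)
    (hY : ∀ m, Y m = (Λ m).biUnion fun g => 𝓕.image fun σ => g • σ)
    (hreg : ∀ k : ℕ, Filter.Tendsto
      (fun m => (({σ : I | σ ∈ Y m ∧ ∃ τ : I, τ ∉ Y m ∧ dist σ τ ≤ (k : ℝ)}.ncard : ℝ)
        / (Λ m).card)) Filter.atTop (nhds 0))
    (Δm : (m : ℕ) → Matrix (Y m) (Y m) ℂ)
    (hΔm : ∀ m, (Δm m).PosSemidef)
    (hΔmint : ∀ m, ∀ σ τ : Y m, ∃ z : ℤ, Δm m σ τ = (z : ℂ) ∧ |(z : ℝ)| ≤ C)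
    (hΔmloc : ∀ m, ∀ σ τ : Y m, 1 < dist (σ : I) (τ : I) → Δm m σ τ = 0)
    (hΔmagree : ∀ m, ∀ σ τ : Y m,
      ((∀ ρ : I, ρ ∉ Y m → 1 < dist (σ : I) ρ) ∨ (∀ ρ : I, ρ ∉ Y m → 1 < dist (τ : I) ρ)) →
      Δm m σ τ = (Δ (delta (σ : I)) : ∀ _ : I, ℂ) (τ : I))
    (F : ℕ → ℝ → ℝ)
    (hF : ∀ (m : ℕ) (lam : ℝ), F m lam =
      ((Finset.univ.filter fun i : Y m => (hΔm m).1.eigenvalues i ≤ lam).card : ℝ)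
        / (Λ m).card)
    :
    ∃ L : ℝ,
      Filter.Tendsto (fun m => F m 0) Filter.atTop (nhds L) ∧
      ∫⁻ lam in Set.Ioc (0 : ℝ) (C * b),
          ENNReal.ofReal ((Filter.liminf (fun m => F m lam) Filter.atTop - L) / lam) ≤
        ENNReal.ofReal (𝓕.card * Real.log (C * b)) := by
  have hK0 : (0:ℝ) < C * b := by linarith
  set K : ℝ := C * b with hKdef
  have hN : ∀ m, (0:ℝ) < (Λ m).card := fun m => by exact_mod_cast (hΛ m).card_pos
  have hcard : ∀ m, (Fintype.card (Y m) : ℝ) = (Λ m).card * 𝓕.card := by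
    intro m
    have := dc_sumY hfree 𝓕 hfund (Λ m) (fun _ => 1) (fun _ _ => rfl)
    rw [← hY m] at this
    simp only [Finset.sum_const, smul_eq_mul, mul_one] at this
    rw [Fintype.card_coe, this]; push_cast; ring
  have hcardN : ∀ m, (Fintype.card (Y m) : ℝ) / (Λ m).card = 𝓕.card := by
    intro m
    rw [hcard, mul_div_cancel_left₀ _ (hN m).ne']
  have hrow : ∀ m i, ∑ j, ‖Δm m i j‖ ≤ K := by
    intro m i
    have h1 : ∀ j, ‖Δm m i j‖ ≤ if dist (i : I) (j : I) ≤ 1 then C else 0 := by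
      intro j
      split_ifs with h
      · obtain ⟨z, hz, hz2⟩ := hΔmint m i j
        rw [hz, Complex.norm_intCast]; exact hz2
      · rw [hΔmloc m i j (not_le.1 h), norm_zero]
    refine (Finset.sum_le_sum fun j _ => h1 j).trans ?_
    rw [Finset.sum_coe_sort (Y m) (fun j => if dist (i : I) j ≤ 1 then C else 0), ← Finset.sum_filter,
      Finset.sum_const, nsmul_eq_mul, mul_comm, hKdef]
    apply mul_le_mul_of_nonneg_left _ hC.le
    refine le_trans ?_ (Nat.cast_le.2 (hballcard i))
    rw [← Set.ncard_coe_finset]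
    have hsub : (((Y m).filter fun x => dist (i : I) x ≤ 1 : Finset I) : Set I) ⊆ {τ : I | dist (i : I) τ ≤ 1} := by
      intro x; simp
    exact Nat.cast_le.2 (Set.ncard_le_ncard hsub (hballfin i))
  have hμ0 : ∀ m i, 0 ≤ (hΔm m).1.eigenvalues i := fun m i => (hΔm m).eigenvalues_nonneg i
  have hμK : ∀ m i, (hΔm m).1.eigenvalues i ≤ K := fun m i => dc_eig_le _ _ K (hrow m) i
  have hlog : ∀ m, 0 ≤ ∑ i, Real.log ((hΔm m).1.eigenvalues i) := fun m =>
    dc_log_nonneg _ (dc_prod_ge_one _ _ fun i j => (hΔmint m i j).imp fun z hz => hz.1)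
  -- convergence of moments
  have hmom : ∀ k : ℕ, ∃ T : ℝ, Tendsto
      (fun m => (∑ i, (1 - (hΔm m).1.eigenvalues i / K) ^ k) / ((Λ m).card : ℝ)) atTop (nhds T) := by
    intro k
    set a : I → I → ℂ := fun σ τ => (if σ = τ then 1 else 0) - (K⁻¹ : ℂ) * (Δ (delta σ) : ∀ _ : I, ℂ) τ with ha
    have h := dc_moment hfree 𝓕 hfund Λ hΛ Y hY hreg a
      (by intro g σ τ; simp [ha, hΔequiv])
      (by
        intro σ τ h
        have : σ ≠ τ := by rintro rfl; simp at h; linarith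
        simp [ha, hΔloc σ τ h, this])
      (fun m => 1 - (K⁻¹ : ℂ) • Δm m)
      (by
        intro m σ τ h
        simp [ha, hΔmagree m σ τ (Or.inl h), Matrix.one_apply])
      2 (by norm_num)
      (by
        intro m i
        have h1 : ∀ j, ‖(1 - (K⁻¹ : ℂ) • Δm m) i j‖ ≤ (if i = j then (1:ℝ) else 0) + K⁻¹ * ‖Δm m i j‖ := by
          intro j
          rw [Matrix.sub_apply, Matrix.smul_apply, Matrix.one_apply]
          refine (norm_sub_le _ _).trans (add_le_add ?_ ?_)
          · split_ifs <;> simp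
          · rw [norm_smul, norm_inv, Complex.norm_real, Real.norm_of_nonneg hK0.le]
        refine (Finset.sum_le_sum fun j _ => h1 j).trans ?_
        rw [Finset.sum_add_distrib, ← Finset.mul_sum]
        have h2 : K⁻¹ * ∑ j, ‖Δm m i j‖ ≤ 1 := by
          rw [inv_mul_le_iff₀ hK0, mul_one]; exact hrow m i
        simp only [Finset.sum_ite_eq, Finset.mem_univ, if_true]
        linarith) k
    refine ⟨_, ((Complex.continuous_re.tendsto _).comp h).congr fun m => ?_⟩
    simp only [Function.comp]
    rw [dc_trace _ (hΔm m).1, ← Complex.ofReal_natCast, ← Complex.ofReal_div, Complex.ofReal_re]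
  -- uniform approximation
  have happ : ∀ δ > 0, ∃ k : ℕ, ∀ m,
      |(∑ i, (1 - (hΔm m).1.eigenvalues i / K) ^ k) / ((Λ m).card : ℝ) - F m 0| ≤ δ := by
    intro δ hδ
    have hlim : Tendsto (fun s : ℝ => (𝓕.card : ℝ) * (Real.log K / s)) atTop (nhds 0) := by
      simpa using (tendsto_id.const_div_atTop (Real.log K)).const_mul (𝓕.card : ℝ)
    obtain ⟨s, hs, hs0⟩ := ((hlim.eventually (gt_mem_nhds (half_pos hδ))).and (eventually_gt_atTop 0)).exists
    set ε : ℝ := K * Real.exp (-s) with hε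
    have hε0 : 0 < ε := by positivity
    have hεK : ε < K := by
      have : Real.exp (-s) < 1 := by rw [Real.exp_lt_one_iff]; linarith
      rw [hε]; nlinarith
    have hls : Real.log (K / ε) = s := by
      rw [hε, Real.exp_neg]
      have : K / (K * (Real.exp s)⁻¹) = Real.exp s := by field_simp
      rw [this, Real.log_exp]
    have hlim2 : Tendsto (fun k : ℕ => (𝓕.card : ℝ) * (1 - ε / K) ^ k) atTop (nhds 0) := by
      have h1 : ε / K < 1 := (div_lt_one hK0).2 hεK
      have h2 : 0 < ε / K := by positivity
      simpa using (tendsto_pow_atTop_nhds_zero_of_lt_one (r := 1 - ε / K) (by linarith) (by linarith)).const_mul (𝓕.card : ℝ)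
    obtain ⟨k, hk⟩ := (hlim2.eventually (gt_mem_nhds (half_pos hδ))).exists
    refine ⟨k, fun m => ?_⟩
    have := dc_approx _ K _ ε hCb (hN m) (hμ0 m) (hμK m) (hlog m) hε0 hεK k
    rw [hcardN, hls, mul_add] at this
    rw [hF]
    linarith
  have hcau : CauchySeq (fun m => F m 0) := by
    rw [Metric.cauchySeq_iff]
    intro δ hδ
    obtain ⟨k, hk⟩ := happ (δ / 4) (by positivity)
    obtain ⟨T, hT⟩ := hmom k
    obtain ⟨n0, hn0⟩ := Metric.cauchySeq_iff.1 hT.cauchySeq (δ / 4) (by positivity)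
    refine ⟨n0, fun m hm n hn => ?_⟩
    have h1 := hk m
    have h2 := hk n
    have h3 := hn0 m hm n hn
    rw [Real.dist_eq] at h3 ⊢
    rw [abs_le] at h1 h2
    rw [abs_lt] at h3 ⊢
    constructor <;> linarith [h1.1, h1.2, h2.1, h2.2, h3.1, h3.2]
  obtain ⟨L, hL⟩ := cauchySeq_tendsto_of_complete hcau
  refine ⟨L, hL, ?_⟩
  have hF0 : ∀ m lam, 0 ≤ F m lam := fun m lam => by rw [hF]; positivity
  have hFle : ∀ m lam, F m lam ≤ 𝓕.card := by
    intro m lam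
    rw [hF, ← hcardN m]
    apply div_le_div_of_nonneg_right _ (hN m).le
    exact_mod_cast Finset.card_le_univ _
  have hFmono : ∀ m, Monotone (F m) := by
    intro m x y hxy
    rw [hF, hF]
    apply div_le_div_of_nonneg_right _ (hN m).le
    refine Nat.cast_le.2 (Finset.card_le_card fun i hi => ?_)
    rw [Finset.mem_filter] at hi ⊢
    exact ⟨hi.1, hi.2.trans hxy⟩
  have hpt : ∀ lam ∈ Set.Ioc (0:ℝ) K, ENNReal.ofReal ((Filter.liminf (fun m => F m lam) Filter.atTop - L) / lam) ≤
      Filter.liminf (fun m => ENNReal.ofReal ((F m lam - F m 0) / lam)) atTop := by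
    intro lam hlam
    have hl := hlam.1
    refine le_of_forall_lt fun c hc => ?_
    have hct : c ≠ ⊤ := hc.ne_top
    rw [ENNReal.lt_ofReal_iff_toReal_lt hct, lt_div_iff₀ hl] at hc
    set x := c.toReal with hx
    obtain ⟨η, hη1, hη2⟩ : ∃ η, 0 < η ∧ x * lam + 3 * η = Filter.liminf (fun m => F m lam) Filter.atTop - L :=
      ⟨(Filter.liminf (fun m => F m lam) Filter.atTop - L - x * lam) / 3, by linarith, by ring⟩
    have ev1 : ∀ᶠ m in atTop, x * lam + 2 * η + L < F m lam := by
      exact Filter.eventually_lt_of_lt_liminf (by linarith)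
        (Filter.isBoundedUnder_of ⟨0, fun m => hF0 m lam⟩)
    have ev2 : ∀ᶠ m in atTop, F m 0 < L + η := hL.eventually (gt_mem_nhds (by linarith))
    have hcl : c < ENNReal.ofReal (x + η / lam) := by
      rw [ENNReal.lt_ofReal_iff_toReal_lt hct]
      have : 0 < η / lam := by positivity
      linarith
    refine hcl.trans_le (Filter.le_liminf_of_le (by isBoundedDefault) ?_)
    filter_upwards [ev1, ev2] with m h1 h2
    apply ENNReal.ofReal_le_ofReal
    rw [le_div_iff₀ hl, add_mul, div_mul_cancel₀ _ hl.ne']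
    linarith
  refine (MeasureTheory.setLIntegral_mono' measurableSet_Ioc hpt).trans ?_
  refine (MeasureTheory.lintegral_liminf_le fun m => ?_).trans ?_
  · exact (((hFmono m).measurable.sub_const _).div measurable_id).ennreal_ofReal
  · refine Filter.liminf_le_of_le (by isBoundedDefault) fun c hc => ?_
    obtain ⟨m, hm⟩ := hc.exists
    refine hm.trans ?_
    have := dc_int _ K _ hCb (hN m) (hμ0 m) (hμK m) (hlog m)
    rw [hcardN] at this
    simp_rw [hF]
    exact this
end

section
/- Let A be an n×n Hermitian positive semidefinite complex matrix, let a > 0 be smaller than every nonzero eigenvalue of A, and let b be a real number with b ≥ ‖A‖ and b ≥ a. Then Σ_{μ} log μ = log(b)·(n − E_A(0)) − ∫_{(a, b]} (E_A(λ) − E_A(0))/λ dλ, where the sum on the left runs over all nonzero eigenvalues μ of A counted with multiplicity (so the left-hand side is the logarithm of the modified determinant det′(A), the product of the nonzero eigenvalues of A). -/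
open scoped ComplexOrder

/-- Let `A` be an `n × n` Hermitian positive semidefinite matrix, let `a > 0` be smaller
than every nonzero eigenvalue of `A`, and let `b ≥ ‖A‖` with `b ≥ a`.  Then the logarithm
of the modified determinant (the product of the nonzero eigenvalues, i.e. the sum of their
logarithms) equals `log b · (n − E_A(0)) − ∫_{(a,b]} (E_A(λ) − E_A(0))/λ dλ`. -/
theorem log_modified_determinant_eq
    {n : ℕ} {A : Matrix (Fin n) (Fin n) ℂ}
    (hA : A.PosSemidef)
    (a : ℝ) (ha : 0 < a)
    (haev : ∀ i : Fin n, hA.1.eigenvalues i ≠ 0 → a < hA.1.eigenvalues i)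
    (b : ℝ) (hb : ‖Matrix.toEuclideanCLM (𝕜 := ℂ) A‖ ≤ b) (hab : a ≤ b)
    (E : ℝ → ℕ)
    (hE : ∀ t : ℝ, E t = (Finset.univ.filter fun i : Fin n =>
      hA.1.eigenvalues i ≤ t).card) :
    ∑ i ∈ Finset.univ.filter (fun i : Fin n => hA.1.eigenvalues i ≠ 0),
        Real.log (hA.1.eigenvalues i) =
      Real.log b * ((n : ℝ) - E 0) -
        ∫ lam in Set.Ioc a b, ((E lam : ℝ) - E 0) / lam := by
  have hnn : ∀ i, 0 ≤ hA.1.eigenvalues i := fun i => hA.eigenvalues_nonneg i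
  have hle : ∀ i, hA.1.eigenvalues i ≤ b := by
    intro i
    refine le_trans ?_ hb
    have h1 := (Matrix.toEuclideanCLM (𝕜 := ℂ) A).le_opNorm (hA.1.eigenvectorBasis i)
    have h2 : Matrix.toEuclideanCLM (𝕜 := ℂ) A (hA.1.eigenvectorBasis i)
        = (hA.1.eigenvalues i : ℂ) • hA.1.eigenvectorBasis i := by
      have h3 := hA.1.mulVec_eigenvectorBasis i
      ext j
      have h4 := congrFun h3 j
      rw [Matrix.ofLp_toEuclideanCLM]
      simpa using h4
    rw [h2, norm_smul, hA.1.eigenvectorBasis.orthonormal.1 i] at h1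
    simpa [abs_of_nonneg (hnn i)] using h1
  generalize hA.1.eigenvalues = μ at *
  have hb0 : 0 < b := lt_of_lt_of_le ha hab
  set S := Finset.univ.filter (fun i : Fin n => μ i ≠ 0) with hS
  have hE0 : (E 0 : ℝ) = ∑ i : Fin n, if μ i ≠ 0 then 0 else 1 := by
    rw [hE, Finset.card_filter]
    push_cast
    refine Finset.sum_congr rfl fun i _ => ?_
    have := hnn i
    by_cases h : μ i = 0
    · simp [h]
    · have : ¬ μ i ≤ 0 := fun h' => h (le_antisymm h' this)
      simp [h, this]
  have hcard : (n : ℝ) - E 0 = ∑ i ∈ S, (1 : ℝ) := by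
    have hn : (n : ℝ) = ∑ i : Fin n, (1 : ℝ) := by simp
    rw [hE0, hn, hS, Finset.sum_filter, ← Finset.sum_sub_distrib]
    refine Finset.sum_congr rfl fun i _ => ?_
    split_ifs <;> simp
  have hint : ∀ x ∈ Set.Ioc a b, ((E x : ℝ) - E 0) / x
      = ∑ i ∈ S, (Set.Ici (μ i)).indicator (fun y : ℝ => y⁻¹) x := by
    intro x hx
    have hx0 : 0 < x := ha.trans hx.1
    rw [hE0, hE, Finset.card_filter, hS, Finset.sum_filter]
    push_cast
    rw [← Finset.sum_sub_distrib, Finset.sum_div]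
    refine Finset.sum_congr rfl fun i _ => ?_
    by_cases h : μ i = 0
    · simp [h, hx0.le]
    · by_cases h' : μ i ≤ x <;> simp [h, h', Set.indicator]
  have hI : MeasureTheory.IntegrableOn (fun y : ℝ => y⁻¹) (Set.Ioc a b) := by
    have : IntervalIntegrable (fun y : ℝ => y⁻¹) MeasureTheory.volume a b := by
      apply intervalIntegrable_inv_iff.2
      right
      rw [Set.uIcc_of_le hab]
      exact fun h => absurd h.1 (not_le.2 ha)
    exact (intervalIntegrable_iff_integrableOn_Ioc_of_le hab).1 this
  rw [MeasureTheory.setIntegral_congr_fun measurableSet_Ioc hint,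
    MeasureTheory.integral_finsetSum _ (fun i _ => hI.indicator measurableSet_Ici),
    hcard, Finset.mul_sum, ← Finset.sum_sub_distrib]
  refine Finset.sum_congr rfl fun i hi => ?_
  have hi0 : μ i ≠ 0 := by simpa [hS] using hi
  have hai := haev i hi0
  have hpos : 0 < μ i := ha.trans hai
  rw [MeasureTheory.setIntegral_indicator measurableSet_Ici]
  have hset : Set.Ioc a b ∩ Set.Ici (μ i) = Set.Icc (μ i) b := by
    ext x
    simp only [Set.mem_inter_iff, Set.mem_Ioc, Set.mem_Ici, Set.mem_Icc]
    constructor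
    · rintro ⟨⟨_, h⟩, h'⟩
      exact ⟨h', h⟩
    · rintro ⟨h, h'⟩
      exact ⟨⟨hai.trans_le h, h'⟩, h⟩
  rw [hset, MeasureTheory.integral_Icc_eq_integral_Ioc,
    ← intervalIntegral.integral_of_le (hle i), integral_inv_of_pos hpos hb0,
    Real.log_div hb0.ne' hpos.ne']
  ring
end

section
/- In the Setting, the following are equivalent: (i) there exists ε > 0 such that the spectrum of Δ contains no point of the interval (0, ε]; (ii) there exists λ > 0 such that lim_{m→∞} (E_m(λ) − E_m(0))/N_m = 0. (This is the combinatorial form of the gap criterion: the Laplacian has a spectral gap at zero if and only if the normalized count of small nonzero eigenvalues of the finite approximations tends to zero.) -/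
open scoped ComplexOrder

open Filter

theorem aux_trace_pow {n : Type*} [Fintype n] [DecidableEq n] {A : Matrix n n ℂ}
    (hA : A.IsHermitian) (k : ℕ) :
    ((A ^ k).trace).re = ∑ i, hA.eigenvalues i ^ k := by
  conv_lhs => rw [hA.spectral_theorem, ← map_pow, Unitary.conjStarAlgAut_apply,
    Matrix.trace_mul_cycle, Matrix.diagonal_pow]
  simp [Matrix.trace_diagonal, ← Complex.ofReal_pow]

theorem aux_row_norm {n : Type*} [Fintype n] [DecidableEq n] (A : Matrix n n ℂ) (R : ℝ)
    (hR : 1 ≤ R) (h : ∀ i, ∑ j, ‖A i j‖ ≤ R) (k : ℕ) (i : n) :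
    ∑ j, ‖(A ^ k) i j‖ ≤ R ^ k := by
  induction k generalizing i with
  | zero => simp [Matrix.one_apply, apply_ite norm]
  | succ k ih =>
    calc ∑ j, ‖(A ^ (k+1)) i j‖ ≤ ∑ j, ∑ l, ‖A i l‖ * ‖(A ^ k) l j‖ := by
          refine Finset.sum_le_sum fun j _ => ?_
          rw [pow_succ', Matrix.mul_apply]
          exact (norm_sum_le _ _).trans (by simp)
      _ = ∑ l, ‖A i l‖ * ∑ j, ‖(A ^ k) l j‖ := by
          rw [Finset.sum_comm]; simp [Finset.mul_sum]
      _ ≤ ∑ l, ‖A i l‖ * R ^ k := by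
          refine Finset.sum_le_sum fun l _ => mul_le_mul_of_nonneg_left (ih l) (norm_nonneg _)
      _ ≤ R ^ (k+1) := by
          rw [← Finset.sum_mul, pow_succ']
          exact mul_le_mul_of_nonneg_right (h i) (by positivity)

theorem aux_eig_le {n : Type*} [Fintype n] [DecidableEq n] {A : Matrix n n ℂ}
    (hA : A.IsHermitian) (R : ℝ) (h : ∀ i, ∑ j, ‖A i j‖ ≤ R) (i : n) :
    |hA.eigenvalues i| ≤ R := by
  have h1 : Module.End.HasEigenvalue (Matrix.toLin' A) (hA.eigenvalues i : ℂ) := by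
    rw [Module.End.hasEigenvalue_iff_mem_spectrum, Matrix.spectrum_toLin']
    exact spectrum.algebraMap_mem ℂ (hA.eigenvalues_mem_spectrum_real i)
  obtain ⟨k, hk⟩ := eigenvalue_mem_ball h1
  rw [mem_closedBall_iff_norm] at hk
  have h2 : ‖(hA.eigenvalues i : ℂ)‖ ≤ ‖A k k‖ + ∑ j ∈ Finset.univ.erase k, ‖A k j‖ := by
    have := norm_le_norm_add_norm_sub' (hA.eigenvalues i : ℂ) (A k k)
    linarith
  have h3 := Finset.add_sum_erase Finset.univ (fun j => ‖A k j‖) (Finset.mem_univ k)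
  have h4 := h k
  have h5 : ‖(hA.eigenvalues i : ℂ)‖ ≤ R := by
    refine h2.trans (le_trans (le_of_eq h3) h4)
  simpa using h5

theorem aux_det_bound {n : Type*} [Fintype n] [DecidableEq n] {A : Matrix n n ℂ}
    (hA : A.IsHermitian) (hentry : ∀ i j, ∃ z : ℤ, A i j = (z : ℂ)) :
    1 ≤ |∏ i ∈ Finset.univ.filter (fun i => hA.eigenvalues i ≠ 0), hA.eigenvalues i| := by
  classical
  choose B hB using hentry
  have hAB : A = (Matrix.of B).map (Int.castRingHom ℂ) := by
    ext i j; simp [hB]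
  set s := Finset.univ.filter (fun i => hA.eigenvalues i ≠ 0)
  have h1 : A.charpoly = Polynomial.X ^ (Finset.univ \ s).card *
      ∏ i ∈ s, (Polynomial.X - Polynomial.C (hA.eigenvalues i : ℂ)) := by
    rw [hA.charpoly_eq, ← Finset.prod_sdiff (Finset.subset_univ s)]
    congr 1
    rw [← Finset.prod_const]
    refine Finset.prod_congr rfl fun i hi => ?_
    have : hA.eigenvalues i = 0 := by simpa [s] using hi
    simp [this]
  have h2 : A.charpoly.coeff (Finset.univ \ s).card =
      ((Matrix.of B).charpoly.coeff (Finset.univ \ s).card : ℂ) := by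
    conv_lhs => rw [hAB, Matrix.charpoly_map, Polynomial.coeff_map]
    simp
  rw [h1, Polynomial.coeff_X_pow_mul', if_pos le_rfl, Nat.sub_self, Polynomial.coeff_zero_eq_eval_zero,
    Polynomial.eval_prod] at h2
  have h3 := congrArg norm h2
  simp only [Polynomial.eval_sub, Polynomial.eval_X, Polynomial.eval_C, zero_sub, norm_prod, norm_neg,
    Complex.norm_real, Complex.norm_intCast] at h3
  rw [← norm_prod, Real.norm_eq_abs] at h3
  rw [h3]
  have h4 : |∏ i ∈ s, hA.eigenvalues i| ≠ 0 := by
    rw [abs_ne_zero, Finset.prod_ne_zero_iff]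
    intro i hi; simpa [s] using hi
  rw [h3] at h4
  have h5 := Int.one_le_abs (z := (Matrix.of B).charpoly.coeff (Finset.univ \ s).card)
    (by intro h; simp [h] at h4)
  exact_mod_cast h5

theorem aux_luck {n : Type*} [Fintype n] [DecidableEq n] {A : Matrix n n ℂ}
    (hA : A.PosSemidef) (hentry : ∀ i j, ∃ z : ℤ, A i j = (z : ℂ)) (R : ℝ) (hR1 : 1 ≤ R)
    (h : ∀ i, ∑ j, ‖A i j‖ ≤ R) (δ : ℝ) (hδ : 0 < δ) :
    ((Finset.univ.filter (fun i => 0 < hA.1.eigenvalues i ∧ hA.1.eigenvalues i ≤ δ)).card : ℝ)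
      * Real.log (1 / δ) ≤ (Fintype.card n : ℝ) * Real.log R := by
  classical
  set s := Finset.univ.filter (fun i => hA.1.eigenvalues i ≠ 0)
  set t := Finset.univ.filter (fun i => 0 < hA.1.eigenvalues i ∧ hA.1.eigenvalues i ≤ δ)
  have hts : t ⊆ s := by
    intro i hi
    simp only [t, s, Finset.mem_filter, Finset.mem_univ, true_and] at hi ⊢
    exact hi.1.ne'
  have h1 := aux_det_bound hA.1 hentry
  rw [abs_of_nonneg (Finset.prod_nonneg fun i _ => hA.eigenvalues_nonneg i)] at h1
  change 1 ≤ ∏ i ∈ s, hA.1.eigenvalues i at h1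
  rw [← Finset.prod_sdiff hts] at h1
  have h2 : ∏ i ∈ s \ t, hA.1.eigenvalues i ≤ R ^ (Fintype.card n) := by
    calc _ ≤ ∏ i ∈ s \ t, R := Finset.prod_le_prod (fun i _ => hA.eigenvalues_nonneg i)
            (fun i _ => (le_abs_self _).trans (aux_eig_le hA.1 R h i))
      _ = R ^ (s \ t).card := by simp
      _ ≤ _ := pow_le_pow_right₀ hR1 (Finset.card_le_univ _)
  have h3 : ∏ i ∈ t, hA.1.eigenvalues i ≤ δ ^ t.card := by
    calc _ ≤ ∏ i ∈ t, δ := Finset.prod_le_prod (fun i _ => hA.eigenvalues_nonneg i)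
            (fun i hi => by simpa using (Finset.mem_filter.1 hi).2.2)
      _ = _ := by simp
  have h4 : 1 ≤ R ^ (Fintype.card n) * δ ^ t.card :=
    h1.trans (mul_le_mul h2 h3 (Finset.prod_nonneg fun i _ => hA.eigenvalues_nonneg i) (by positivity))
  have h5 := Real.log_nonneg h4
  rw [Real.log_mul (by positivity) (by positivity), Real.log_pow, Real.log_pow] at h5
  rw [one_div, Real.log_inv]
  linarith

theorem aux_delta_apply {I : Type*} [DecidableEq I] (σ τ : I) :
    (delta σ : ∀ _ : I, ℂ) τ = if τ = σ then 1 else 0 := by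
  by_cases h : τ = σ
  · subst h; simp [delta]
  · simp [delta, h]

theorem aux_norm_delta {I : Type*} [DecidableEq I] (σ : I) : ‖delta σ‖ = 1 := by
  simp [delta, lp.norm_single]

theorem aux_sum_apply {I : Type*} {ι : Type*} (s : Finset ι)
    (c : ι → ℂ) (v : ι → lp (fun _ : I => ℂ) 2) (τ : I) :
    ((∑ i ∈ s, c i • v i : lp (fun _ : I => ℂ) 2) : ∀ _ : I, ℂ) τ = ∑ i ∈ s, c i * v i τ := by
  rw [lp.coeFn_sum, Finset.sum_apply]
  simp

theorem aux_expand {I : Type*} [DecidableEq I] (s : Finset I) (v : lp (fun _ : I => ℂ) 2)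
    (hv : ∀ τ, τ ∉ s → (v : ∀ _ : I, ℂ) τ = 0) :
    v = ∑ τ ∈ s, (v : ∀ _ : I, ℂ) τ • delta τ := by
  ext ρ
  rw [aux_sum_apply]
  simp only [aux_delta_apply]
  by_cases h : ρ ∈ s
  · simp [h]
  · simp [h, hv ρ h]

theorem aux_pow_equiv {I : Type*} [MetricSpace I] [DecidableEq I]
    {G : Type*} [Group G] [MulAction G I]
    (hiso : ∀ (g : G) (σ τ : I), dist (g • σ) (g • τ) = dist σ τ)
    (hballfin : ∀ σ : I, {τ : I | dist σ τ ≤ 1}.Finite)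
    (Δ : lp (fun _ : I => ℂ) 2 →L[ℂ] lp (fun _ : I => ℂ) 2)
    (hΔequiv : ∀ (g : G) (σ τ : I),
      (Δ (delta (g • σ)) : ∀ _ : I, ℂ) (g • τ) = (Δ (delta σ) : ∀ _ : I, ℂ) τ)
    (hΔloc : ∀ σ τ : I, 1 < dist σ τ → (Δ (delta σ) : ∀ _ : I, ℂ) τ = 0)
    (n : ℕ) (g : G) (σ τ : I) :
    ((Δ ^ n) (delta (g • σ)) : ∀ _ : I, ℂ) (g • τ) = ((Δ ^ n) (delta σ) : ∀ _ : I, ℂ) τ := by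
  induction n generalizing σ τ with
  | zero => simp [aux_delta_apply]
  | succ n ih =>
    have h1 : Δ (delta σ) = ∑ ρ ∈ (hballfin σ).toFinset, (Δ (delta σ) : ∀ _ : I, ℂ) ρ • delta ρ := by
      apply aux_expand
      intro ρ hρ
      apply hΔloc
      simpa using hρ
    have h2 : Δ (delta (g • σ)) =
        ∑ ρ ∈ (hballfin σ).toFinset, (Δ (delta σ) : ∀ _ : I, ℂ) ρ • delta (g • ρ) := by
      have := aux_expand ((hballfin σ).toFinset.image (fun ρ => g • ρ)) (Δ (delta (g • σ))) (by
        intro ρ hρ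
        apply hΔloc
        by_contra hcon
        apply hρ
        rw [Finset.mem_image]
        refine ⟨g⁻¹ • ρ, ?_, by simp⟩
        simp only [Set.Finite.mem_toFinset, Set.mem_ofPred_eq]
        rw [← hiso g]
        simpa using hcon)
      rw [Finset.sum_image (fun a _ b _ hab => MulAction.injective g hab)] at this
      simpa only [hΔequiv] using this
    rw [pow_succ]
    change ((Δ ^ n) (Δ (delta (g • σ))) : ∀ _ : I, ℂ) (g • τ) = ((Δ ^ n) (Δ (delta σ)) : ∀ _ : I, ℂ) τ
    rw [h2, h1, map_sum, map_sum]
    simp only [map_smul]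
    rw [aux_sum_apply, aux_sum_apply]
    refine Finset.sum_congr rfl fun ρ _ => ?_
    rw [ih, ← h1]

theorem aux_deep {I : Type*} [MetricSpace I] [DecidableEq I]
    (Δ : lp (fun _ : I => ℂ) 2 →L[ℂ] lp (fun _ : I => ℂ) 2)
    (hΔloc : ∀ σ τ : I, 1 < dist σ τ → (Δ (delta σ) : ∀ _ : I, ℂ) τ = 0)
    (Y : Finset I) (D : Matrix Y Y ℂ)
    (hloc : ∀ σ τ : Y, 1 < dist (σ : I) (τ : I) → D σ τ = 0)
    (hagree : ∀ σ τ : Y,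
      ((∀ ρ : I, ρ ∉ Y → 1 < dist (σ : I) ρ) ∨ (∀ ρ : I, ρ ∉ Y → 1 < dist (τ : I) ρ)) →
      D σ τ = (Δ (delta (σ : I)) : ∀ _ : I, ℂ) (τ : I))
    (n : ℕ) (σ : Y) (hσ : ∀ ρ : I, ρ ∉ Y → (n : ℝ) < dist (σ : I) ρ) :
    (Δ ^ n) (delta (σ : I)) = ∑ τ : Y, (D ^ n) σ τ • delta (τ : I) := by
  induction n generalizing σ with
  | zero =>
    simp [Matrix.one_apply]
  | succ n ih =>
    have hσ1 : ∀ ρ : I, ρ ∉ Y → 1 < dist (σ : I) ρ := by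
      intro ρ hρ
      have := hσ ρ hρ
      push_cast at this
      have h0 : (0 : ℝ) ≤ n := by positivity
      linarith
    have h1 : Δ (delta (σ : I)) = ∑ τ : Y, D σ τ • delta (τ : I) := by
      conv_lhs => rw [aux_expand Y (Δ (delta (σ : I))) (fun τ hτ => hΔloc _ _ (hσ1 τ hτ))]
      rw [← Finset.sum_coe_sort]
      refine Finset.sum_congr rfl fun τ _ => ?_
      rw [hagree σ τ (Or.inl hσ1)]
    rw [pow_succ]
    change (Δ ^ n) (Δ (delta (σ : I))) = _
    rw [h1, map_sum]
    have h2 : ∀ τ : Y, (Δ ^ n) (D σ τ • delta (τ : I)) =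
        ∑ ρ : Y, (D σ τ * (D ^ n) τ ρ) • delta (ρ : I) := by
      intro τ
      by_cases hd : 1 < dist (σ : I) τ
      · simp [hloc σ τ hd]
      · rw [map_smul, ih τ, Finset.smul_sum]
        · simp [smul_smul]
        · intro ρ hρ
          have := hσ ρ hρ
          push_cast at this
          have h3 := dist_triangle (σ : I) τ ρ
          linarith
    simp only [h2]
    rw [Finset.sum_comm]
    refine Finset.sum_congr rfl fun ρ _ => ?_
    rw [← Finset.sum_smul, pow_succ', Matrix.mul_apply]

theorem aux_sumY {I : Type*} [DecidableEq I] {G : Type*} [Group G] [MulAction G I]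
    (hfree : ∀ (g : G) (σ : I), g • σ = σ → g = 1) (𝓕 : Finset I)
    (hfund : ∀ σ : I, ∃! τ : I, τ ∈ 𝓕 ∧ ∃ g : G, g • σ = τ)
    (Λ : Finset G) (φ : I → ℝ) (hφ : ∀ (g : G) σ, φ (g • σ) = φ σ) :
    ∑ σ ∈ Λ.biUnion (fun g => 𝓕.image fun σ => g • σ), φ σ = Λ.card * ∑ σ ∈ 𝓕, φ σ := by
  rw [Finset.sum_biUnion]
  · rw [Finset.sum_congr rfl (g := fun _ => ∑ σ ∈ 𝓕, φ σ)]
    · simp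
    · intro g _
      rw [Finset.sum_image (fun a _ b _ hab => MulAction.injective g hab)]
      simp [hφ]
  · intro g _ h _ hgh
    rw [Function.onFun, Finset.disjoint_left]
    intro x hx hx2
    simp only [Finset.mem_image] at hx hx2
    obtain ⟨σ, hσ, rfl⟩ := hx
    obtain ⟨τ, hτ, e⟩ := hx2
    have e2 : (h⁻¹ * g) • σ = τ := by rw [mul_smul, ← e]; simp
    have e3 : τ = σ := (hfund σ).unique ⟨hτ, _, e2⟩ ⟨hσ, 1, by simp⟩
    have := hfree _ _ (e2.trans e3)
    apply hgh
    rw [inv_mul_eq_one] at this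
    exact this.symm

theorem aux_coord_norm {I : Type*} [DecidableEq I]
    (S : lp (fun _ : I => ℂ) 2 →L[ℂ] lp (fun _ : I => ℂ) 2) (σ : I) :
    |((S (delta σ) : ∀ _ : I, ℂ) σ).re| ≤ ‖S‖ := by
  calc _ ≤ ‖(S (delta σ) : ∀ _ : I, ℂ) σ‖ := Complex.abs_re_le_norm _
    _ ≤ ‖S (delta σ)‖ := lp.norm_apply_le_norm (by simp) _ _
    _ ≤ ‖S‖ * ‖delta σ‖ := S.le_opNorm _
    _ = ‖S‖ := by rw [aux_norm_delta, mul_one]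

/-- finite-stage comparison of the traces of powers -/
theorem aux_trace_compare {I : Type*} [MetricSpace I] [DecidableEq I]
    (Δ : lp (fun _ : I => ℂ) 2 →L[ℂ] lp (fun _ : I => ℂ) 2)
    (hΔloc : ∀ σ τ : I, 1 < dist σ τ → (Δ (delta σ) : ∀ _ : I, ℂ) τ = 0)
    (Y : Finset I) (D : Matrix Y Y ℂ) (hD : D.IsHermitian)
    (hloc : ∀ σ τ : Y, 1 < dist (σ : I) (τ : I) → D σ τ = 0)
    (hagree : ∀ σ τ : Y,
      ((∀ ρ : I, ρ ∉ Y → 1 < dist (σ : I) ρ) ∨ (∀ ρ : I, ρ ∉ Y → 1 < dist (τ : I) ρ)) →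
      D σ τ = (Δ (delta (σ : I)) : ∀ _ : I, ℂ) (τ : I))
    (R : ℝ) (hR : 1 ≤ R) (h : ∀ i, ∑ j, ‖D i j‖ ≤ R) (hΔR : ‖Δ‖ ≤ R) (n : ℕ) :
    |∑ i, hD.eigenvalues i ^ n - ∑ σ ∈ Y, (((Δ ^ n) (delta σ) : ∀ _ : I, ℂ) σ).re| ≤
      ({σ : I | σ ∈ Y ∧ ∃ τ : I, τ ∉ Y ∧ dist σ τ ≤ (n : ℝ)}.ncard : ℝ) * (2 * R ^ n) := by
  classical
  rw [← aux_trace_pow, Matrix.trace, Complex.re_sum, ← Finset.sum_coe_sort Y, ← Finset.sum_sub_distrib]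
  have hset : {σ : I | σ ∈ Y ∧ ∃ τ : I, τ ∉ Y ∧ dist σ τ ≤ (n : ℝ)} =
      ↑(Y.filter (fun σ => ∃ τ : I, τ ∉ Y ∧ dist σ τ ≤ (n : ℝ))) := by
    ext; simp
  rw [hset, Set.ncard_coe_finset]
  have hb : ∀ σ : Y, |((D ^ n).diag σ).re - (((Δ ^ n) (delta (σ : I)) : ∀ _ : I, ℂ) σ).re| ≤
      if (∃ τ : I, τ ∉ Y ∧ dist (σ : I) τ ≤ (n : ℝ)) then 2 * R ^ n else 0 := by
    intro σ
    split_ifs with hc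
    · have h1 : |((D ^ n).diag σ).re| ≤ R ^ n := by
        refine (Complex.abs_re_le_norm _).trans (le_trans ?_ (aux_row_norm D R hR h n σ))
        exact Finset.single_le_sum (f := fun j => ‖(D ^ n) σ j‖) (fun _ _ => norm_nonneg _)
          (Finset.mem_univ σ)
      have h2 := (aux_coord_norm (Δ ^ n) (σ : I))
      have h3 : ‖Δ ^ n‖ ≤ R ^ n := by
        rcases Nat.eq_zero_or_pos n with rfl | hn
        · simp only [pow_zero]
          exact ContinuousLinearMap.norm_id_le
        · exact (norm_pow_le' _ hn).trans (pow_le_pow_left₀ (norm_nonneg _) hΔR n)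
      exact (abs_sub _ _).trans (by linarith)
    · push Not at hc
      rw [aux_deep Δ hΔloc Y D hloc hagree n σ hc, aux_sum_apply]
      simp [aux_delta_apply]
  refine (Finset.abs_sum_le_sum_abs _ _).trans ((Finset.sum_le_sum fun σ _ => hb σ).trans ?_)
  rw [Finset.sum_coe_sort Y (fun σ => if (∃ τ : I, τ ∉ Y ∧ dist (σ : I) τ ≤ (n : ℝ)) then 2 * R ^ n else 0),
    ← Finset.sum_filter]
  simp

/-- Continuous functional calculus for a self-adjoint operator on a Hilbert space. -/
noncomputable def hcfc {H : Type*} [NormedAddCommGroup H] [InnerProductSpace ℂ H] [CompleteSpace H]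
    (f : ℝ → ℝ) (T : H →L[ℂ] H) : H →L[ℂ] H := cfc f T

/-- Polynomial in an operator. -/
noncomputable def hpoly {H : Type*} [NormedAddCommGroup H] [InnerProductSpace ℂ H]
    (p : Polynomial ℝ) (T : H →L[ℂ] H) : H →L[ℂ] H :=
  ∑ i ∈ Finset.range (p.natDegree + 1), (p.coeff i : ℂ) • T ^ i

theorem hcfc_near {H : Type*} [NormedAddCommGroup H] [InnerProductSpace ℂ H] [CompleteSpace H]
    (T : H →L[ℂ] H) (hT : IsSelfAdjoint T)
    (R : ℝ) (hTR : ‖T‖ ≤ R) (f : ℝ → ℝ) (hf : Continuous f) (η : ℝ) (hη : 0 < η)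
    (p : Polynomial ℝ) (hp : ∀ x ∈ Set.Icc (-R) R, |p.eval x - f x| < η) :
    ‖hcfc f T - hpoly p T‖ ≤ η := by
  have e : hpoly p T = Polynomial.aeval T p := by
    rw [Polynomial.aeval_eq_sum_range, hpoly]
    rfl
  rw [e, hcfc, ← cfc_polynomial p T hT, ← cfc_sub f p.eval T hf.continuousOn p.continuous.continuousOn]
  refine norm_cfc_le hη.le fun x hx => ?_
  have hx2 : |x| ≤ R := by
    have h1 := spectrum.norm_le_norm_mul_of_mem hx
    have h2 : ‖(1 : H →L[ℂ] H)‖ ≤ 1 := ContinuousLinearMap.norm_id_le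
    have h3 := mul_le_mul_of_nonneg_left h2 (norm_nonneg T)
    rw [Real.norm_eq_abs] at h1
    linarith
  have := hp x (abs_le.1 hx2)
  rw [Real.norm_eq_abs, abs_sub_comm]
  exact this.le

theorem hcfc_sq {H : Type*} [NormedAddCommGroup H] [InnerProductSpace ℂ H] [CompleteSpace H]
    (T : H →L[ℂ] H) (f : ℝ → ℝ) (hf : Continuous f) (v : H) :
    (inner ℂ v (hcfc (fun x => f x * f x) T v)).re = ‖hcfc f T v‖ ^ 2 := by
  have hs : IsSelfAdjoint (hcfc f T) := cfc_predicate f T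
  have e : hcfc (fun x => f x * f x) T = hcfc f T * hcfc f T :=
    cfc_mul f f T hf.continuousOn hf.continuousOn
  have h2 : inner ℂ v ((hcfc f T * hcfc f T) v) = inner ℂ (hcfc f T v) (hcfc f T v) :=
    (hs.isSymmetric v (hcfc f T v)).symm
  rw [e, h2, ← inner_self_eq_norm_sq (𝕜 := ℂ)]
  rfl

theorem hcfc_eq_zero {H : Type*} [NormedAddCommGroup H] [InnerProductSpace ℂ H] [CompleteSpace H]
    (T : H →L[ℂ] H) (f : ℝ → ℝ) (h : ∀ x : ℝ, (x : ℂ) ∈ spectrum ℂ T → f x = 0) :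
    hcfc f T = 0 := by
  rw [hcfc, ← cfc_const_zero ℝ T]
  refine cfc_congr fun x hx => h x ?_
  exact spectrum.algebraMap_mem ℂ hx

theorem hcfc_zero_spec {H : Type*} [NormedAddCommGroup H] [InnerProductSpace ℂ H] [CompleteSpace H]
    (T : H →L[ℂ] H) (hT : IsSelfAdjoint T) (f : ℝ → ℝ) (hf : Continuous f) (h : hcfc f T = 0)
    (x : ℝ) (hx : (x : ℂ) ∈ spectrum ℂ T) : f x = 0 := by
  have hx2 : x ∈ spectrum ℝ T := spectrum.of_algebraMap_mem ℂ hx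
  have h1 := norm_apply_le_norm_cfc f T hx2 hf.continuousOn hT
  have h2 : cfc f T = 0 := h
  rw [h2, norm_zero] at h1
  simpa using h1

theorem aux_poly_diag {I : Type*} [DecidableEq I]
    (Δ : lp (fun _ : I => ℂ) 2 →L[ℂ] lp (fun _ : I => ℂ) 2) (p : Polynomial ℝ) (σ : I) :
    ((hpoly p Δ (delta σ) : lp (fun _ : I => ℂ) 2) σ).re =
      ∑ i ∈ Finset.range (p.natDegree + 1),
        p.coeff i * (((Δ ^ i) (delta σ) : ∀ _ : I, ℂ) σ).re := by
  rw [hpoly, sum_apply, lp.coeFn_sum, Finset.sum_apply,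
    Complex.re_sum]
  refine Finset.sum_congr rfl fun i _ => ?_
  change ((p.coeff i : ℂ) * ((Δ ^ i) (delta σ) : ∀ _ : I, ℂ) σ).re = _
  rw [Complex.re_ofReal_mul]

theorem aux_limit {I : Type*} [DecidableEq I] (𝓕 : Finset I)
    (Δ : lp (fun _ : I => ℂ) 2 →L[ℂ] lp (fun _ : I => ℂ) 2) (hΔ : IsSelfAdjoint Δ)
    (R : ℝ) (hΔR : ‖Δ‖ ≤ R) (ι : ℕ → Type*) [∀ m, Fintype (ι m)] (e : ∀ m, ι m → ℝ)
    (he : ∀ m i, |e m i| ≤ R) (N : ℕ → ℝ) (hN : ∀ m, 0 < N m)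
    (hcard : ∀ m, (Fintype.card (ι m) : ℝ) = N m * 𝓕.card)
    (hmon : ∀ n : ℕ, Tendsto (fun m => (∑ i, e m i ^ n) / N m) atTop
      (nhds (∑ σ ∈ 𝓕, (((Δ ^ n) (delta σ) : ∀ _ : I, ℂ) σ).re)))
    (f : ℝ → ℝ) (hf : Continuous f) :
    Tendsto (fun m => (∑ i, f (e m i)) / N m) atTop
      (nhds (∑ σ ∈ 𝓕, ((hcfc f Δ (delta σ) : lp (fun _ : I => ℂ) 2) σ).re)) := by
  have hpl : ∀ p : Polynomial ℝ, Tendsto (fun m => (∑ i, p.eval (e m i)) / N m) atTop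
      (nhds (∑ σ ∈ 𝓕, ((hpoly p Δ (delta σ) : lp (fun _ : I => ℂ) 2) σ).re)) := by
    intro p
    simp only [aux_poly_diag]
    rw [Finset.sum_comm]
    simp only [← Finset.mul_sum]
    have := tendsto_finsetSum (Finset.range (p.natDegree + 1))
      (fun n _ => (hmon n).const_mul (p.coeff n))
    refine this.congr fun m => ?_
    simp only [Polynomial.eval_eq_sum_range]
    rw [Finset.sum_comm, Finset.sum_div]
    simp only [← Finset.mul_sum, mul_div_assoc]
  rw [Metric.tendsto_atTop]
  intro η hη
  set c : ℝ := (𝓕.card : ℝ) with hc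
  have hc0 : 0 ≤ c := by positivity
  set θ := η / (3 * (c + 1)) with hθ
  have hθ0 : 0 < θ := by positivity
  have hcη : c * θ ≤ η / 3 := by
    rw [hθ]
    have : η / (3 * (c + 1)) * (c + 1) = η / 3 := by field_simp
    have h2 : 0 < η / (3 * (c + 1)) := by positivity
    nlinarith
  obtain ⟨p, hp⟩ := exists_polynomial_near_of_continuousOn (-R) R f hf.continuousOn θ hθ0
  obtain ⟨M, hM⟩ := (Metric.tendsto_atTop.1 (hpl p)) (η / 3) (by positivity)
  refine ⟨M, fun m hm => ?_⟩
  have h1 := hM m hm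
  rw [Real.dist_eq] at h1 ⊢
  have h2 : |(∑ i, f (e m i)) / N m - (∑ i, p.eval (e m i)) / N m| ≤ c * θ := by
    rw [← sub_div, ← Finset.sum_sub_distrib, abs_div, abs_of_pos (hN m), div_le_iff₀ (hN m)]
    calc _ ≤ ∑ i, |f (e m i) - p.eval (e m i)| := Finset.abs_sum_le_sum_abs _ _
      _ ≤ ∑ i : ι m, θ := Finset.sum_le_sum fun i _ => by
          rw [abs_sub_comm]; exact (hp _ (abs_le.1 (he m i))).le
      _ = c * θ * N m := by
          rw [Finset.sum_const, Finset.card_univ, nsmul_eq_mul, hcard m]; ring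
  have h3 : |∑ σ ∈ 𝓕, ((hpoly p Δ (delta σ) : lp (fun _ : I => ℂ) 2) σ).re -
      ∑ σ ∈ 𝓕, ((hcfc f Δ (delta σ) : lp (fun _ : I => ℂ) 2) σ).re| ≤ c * θ := by
    rw [← Finset.sum_sub_distrib]
    calc _ ≤ ∑ σ ∈ 𝓕, |((hpoly p Δ (delta σ) : lp (fun _ : I => ℂ) 2) σ).re -
              ((hcfc f Δ (delta σ) : lp (fun _ : I => ℂ) 2) σ).re| := Finset.abs_sum_le_sum_abs _ _
      _ ≤ ∑ σ ∈ 𝓕, θ := Finset.sum_le_sum fun σ _ => by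
          have := (aux_coord_norm (hcfc f Δ - hpoly p Δ) σ).trans
            (hcfc_near Δ hΔ R hΔR f hf θ hθ0 p hp)
          rw [abs_sub_comm]
          simpa using this
      _ = c * θ := by rw [Finset.sum_const, nsmul_eq_mul]
  rw [abs_lt] at h1 ⊢
  rw [abs_le] at h2 h3
  constructor <;> linarith [h1.1, h1.2, h2.1, h2.2, h3.1, h3.2]

theorem aux_cfc_equiv {I : Type*} [MetricSpace I] [DecidableEq I]
    {G : Type*} [Group G] [MulAction G I]
    (hiso : ∀ (g : G) (σ τ : I), dist (g • σ) (g • τ) = dist σ τ)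
    (hballfin : ∀ σ : I, {τ : I | dist σ τ ≤ 1}.Finite)
    (Δ : lp (fun _ : I => ℂ) 2 →L[ℂ] lp (fun _ : I => ℂ) 2) (hΔ : IsSelfAdjoint Δ)
    (hΔequiv : ∀ (g : G) (σ τ : I),
      (Δ (delta (g • σ)) : ∀ _ : I, ℂ) (g • τ) = (Δ (delta σ) : ∀ _ : I, ℂ) τ)
    (hΔloc : ∀ σ τ : I, 1 < dist σ τ → (Δ (delta σ) : ∀ _ : I, ℂ) τ = 0)
    (f : ℝ → ℝ) (hf : Continuous f) (g : G) (σ : I) :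
    ((hcfc f Δ (delta (g • σ)) : lp (fun _ : I => ℂ) 2) (g • σ)).re =
      ((hcfc f Δ (delta σ) : lp (fun _ : I => ℂ) 2) σ).re := by
  refine eq_of_forall_dist_le fun η hη => ?_
  obtain ⟨p, hp⟩ := exists_polynomial_near_of_continuousOn (-‖Δ‖) ‖Δ‖ f hf.continuousOn (η / 2)
    (by positivity)
  have h := hcfc_near Δ hΔ _ le_rfl f hf (η / 2) (by positivity) p hp
  have h1 := (aux_coord_norm (hcfc f Δ - hpoly p Δ) σ).trans h
  have h2 := (aux_coord_norm (hcfc f Δ - hpoly p Δ) (g • σ)).trans h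
  have h3 : ((hpoly p Δ (delta (g • σ)) : lp (fun _ : I => ℂ) 2) (g • σ)).re =
      ((hpoly p Δ (delta σ) : lp (fun _ : I => ℂ) 2) σ).re := by
    simp only [aux_poly_diag, aux_pow_equiv hiso hballfin Δ hΔequiv hΔloc]
  simp only [sub_apply, lp.coeFn_sub, Pi.sub_apply, Complex.sub_re] at h1 h2
  rw [abs_le] at h1 h2
  rw [Real.dist_eq, abs_le]
  constructor <;> linarith [h1.1, h1.2, h2.1, h2.2]

theorem aux_cfc_sq {I : Type*} [DecidableEq I]
    (Δ : lp (fun _ : I => ℂ) 2 →L[ℂ] lp (fun _ : I => ℂ) 2)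
    (f : ℝ → ℝ) (hf : Continuous f) (σ : I) :
    ((hcfc (fun x => f x * f x) Δ (delta σ) : lp (fun _ : I => ℂ) 2) σ).re =
      ‖hcfc f Δ (delta σ)‖ ^ 2 := by
  rw [← hcfc_sq Δ f hf]
  conv_rhs => rw [delta, lp.inner_single_left]
  simp [delta]

theorem aux_op_zero {I : Type*} [DecidableEq I]
    (S : lp (fun _ : I => ℂ) 2 →L[ℂ] lp (fun _ : I => ℂ) 2) (h : ∀ σ, S (delta σ) = 0) : S = 0 := by
  ext1 v
  have h1 := (lp.hasSum_single (by simp) v).mapL S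
  have h2 : ∀ σ, S (lp.single 2 σ ((v : ∀ _ : I, ℂ) σ)) = 0 := by
    intro σ
    have : lp.single (E := fun _ : I => ℂ) 2 σ ((v : ∀ _ : I, ℂ) σ) = (v : ∀ _ : I, ℂ) σ • delta σ := by
      rw [delta, ← lp.single_smul]; simp
    rw [this, map_smul, h, smul_zero]
  simp only [h2] at h1
  simpa using h1.unique hasSum_zero

theorem aux_row_sum {I : Type*} [MetricSpace I] (C : ℝ) (b : ℕ) (hC : 0 < C)
    (hballfin : ∀ σ : I, {τ : I | dist σ τ ≤ 1}.Finite)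
    (hballcard : ∀ σ : I, {τ : I | dist σ τ ≤ 1}.ncard ≤ b)
    (Y : Finset I) (D : Matrix Y Y ℂ)
    (hentry : ∀ σ τ : Y, ∃ z : ℤ, D σ τ = (z : ℂ) ∧ |(z : ℝ)| ≤ C)
    (hloc : ∀ σ τ : Y, 1 < dist (σ : I) (τ : I) → D σ τ = 0) (σ : Y) :
    ∑ τ, ‖D σ τ‖ ≤ C * b := by
  classical
  have h1 : ∀ τ : Y, ‖D σ τ‖ ≤ if dist (σ : I) (τ : I) ≤ 1 then C else 0 := by
    intro τ
    split_ifs with h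
    · obtain ⟨z, hz, hz2⟩ := hentry σ τ
      rw [hz]; simpa using hz2
    · rw [hloc σ τ (not_le.1 h)]; simp
  refine (Finset.sum_le_sum fun τ _ => h1 τ).trans ?_
  rw [Finset.sum_coe_sort Y (fun τ => if dist (σ : I) τ ≤ 1 then C else 0), ← Finset.sum_filter,
    Finset.sum_const, nsmul_eq_mul, mul_comm]
  refine mul_le_mul_of_nonneg_left ?_ hC.le
  have h2 : (Y.filter (fun τ => dist (σ : I) τ ≤ 1)).card ≤ b := by
    rw [← Set.ncard_coe_finset]
    refine (Set.ncard_le_ncard ?_ (hballfin σ)).trans (hballcard σ)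
    intro τ hτ
    simpa using (Finset.mem_filter.1 (Finset.mem_coe.1 hτ)).2
  exact_mod_cast h2

/-- **Gap criterion (combinatorial form).** In the amenable Setting, the spectrum of `Δ` has
a gap at zero (i.e. misses some interval `(0, ε]`) if and only if there is `λ > 0` with
`lim_m (E_m(λ) − E_m(0))/N_m = 0`. -/
theorem gap_criterion
    {I : Type*} [MetricSpace I] [Countable I] [DecidableEq I]
    {G : Type*} [Group G] [Countable G] [MulAction G I]
    (hfree : ∀ (g : G) (σ : I), g • σ = σ → g = 1)
    (hiso : ∀ (g : G) (σ τ : I), dist (g • σ) (g • τ) = dist σ τ)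
    (𝓕 : Finset I)
    (hfund : ∀ σ : I, ∃! τ : I, τ ∈ 𝓕 ∧ ∃ g : G, g • σ = τ)
    (C : ℝ) (b : ℕ) (hC : 0 < C) (hCb : 1 ≤ C * b)
    (hballfin : ∀ σ : I, {τ : I | dist σ τ ≤ 1}.Finite)
    (hballcard : ∀ σ : I, {τ : I | dist σ τ ≤ 1}.ncard ≤ b)
    (Δ : lp (fun _ : I => ℂ) 2 →L[ℂ] lp (fun _ : I => ℂ) 2)
    (hΔpos : Δ.IsPositive)
    (hΔequiv : ∀ (g : G) (σ τ : I),
      (Δ (delta (g • σ)) : ∀ _ : I, ℂ) (g • τ) = (Δ (delta σ) : ∀ _ : I, ℂ) τ)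
    (hΔint : ∀ σ τ : I, ∃ z : ℤ, (Δ (delta σ) : ∀ _ : I, ℂ) τ = (z : ℂ) ∧ |(z : ℝ)| ≤ C)
    (hΔloc : ∀ σ τ : I, 1 < dist σ τ → (Δ (delta σ) : ∀ _ : I, ℂ) τ = 0)
    (Λ : ℕ → Finset G) (hΛ : ∀ m, (Λ m).Nonempty)
    (Y : ℕ → Finset I)
    (hY : ∀ m, Y m = (Λ m).biUnion fun g => 𝓕.image fun σ => g • σ)
    (hreg : ∀ k : ℕ, Filter.Tendsto
      (fun m => (({σ : I | σ ∈ Y m ∧ ∃ τ : I, τ ∉ Y m ∧ dist σ τ ≤ (k : ℝ)}.ncard : ℝ)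
        / (Λ m).card)) Filter.atTop (nhds 0))
    (Δm : (m : ℕ) → Matrix (Y m) (Y m) ℂ)
    (hΔm : ∀ m, (Δm m).PosSemidef)
    (hΔmint : ∀ m, ∀ σ τ : Y m, ∃ z : ℤ, Δm m σ τ = (z : ℂ) ∧ |(z : ℝ)| ≤ C)
    (hΔmloc : ∀ m, ∀ σ τ : Y m, 1 < dist (σ : I) (τ : I) → Δm m σ τ = 0)
    (hΔmagree : ∀ m, ∀ σ τ : Y m,
      ((∀ ρ : I, ρ ∉ Y m → 1 < dist (σ : I) ρ) ∨ (∀ ρ : I, ρ ∉ Y m → 1 < dist (τ : I) ρ)) →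
      Δm m σ τ = (Δ (delta (σ : I)) : ∀ _ : I, ℂ) (τ : I))
    (F : ℕ → ℝ → ℝ)
    (hF : ∀ (m : ℕ) (lam : ℝ), F m lam =
      ((Finset.univ.filter fun i : Y m => (hΔm m).1.eigenvalues i ≤ lam).card : ℝ)
        / (Λ m).card)
    :
    (∃ ε : ℝ, 0 < ε ∧ ∀ μ : ℝ, μ ∈ Set.Ioc 0 ε → (μ : ℂ) ∉ spectrum ℂ Δ) ↔
    (∃ lam : ℝ, 0 < lam ∧
      Filter.Tendsto (fun m => F m lam - F m 0) Filter.atTop (nhds 0)) := by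
  classical
  set R : ℝ := max (C * b) ‖Δ‖ with hRdef
  have hR1 : 1 ≤ R := hCb.trans (le_max_left _ _)
  have hΔR : ‖Δ‖ ≤ R := le_max_right _ _
  have hsa : IsSelfAdjoint Δ := hΔpos.isSelfAdjoint
  have hN : ∀ m, 0 < ((Λ m).card : ℝ) := fun m => by
    exact_mod_cast Finset.card_pos.2 (hΛ m)
  have hrow : ∀ m (σ : Y m), ∑ τ, ‖Δm m σ τ‖ ≤ R := fun m σ =>
    (aux_row_sum C b hC hballfin hballcard (Y m) (Δm m) (hΔmint m) (hΔmloc m) σ).trans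
      (le_max_left _ _)
  set e : ∀ m, Y m → ℝ := fun m => (hΔm m).1.eigenvalues with he
  have heR : ∀ m i, |e m i| ≤ R := fun m i => aux_eig_le (hΔm m).1 R (hrow m) i
  have he0 : ∀ m i, 0 ≤ e m i := fun m i => (hΔm m).eigenvalues_nonneg i
  have hsumY : ∀ m (φ : I → ℝ), (∀ (g : G) σ, φ (g • σ) = φ σ) →
      ∑ σ ∈ Y m, φ σ = (Λ m).card * ∑ σ ∈ 𝓕, φ σ := by
    intro m φ hφ
    rw [hY m]
    exact aux_sumY hfree 𝓕 hfund (Λ m) φ hφ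
  have hcard : ∀ m, (Fintype.card (Y m) : ℝ) = (Λ m).card * 𝓕.card := by
    intro m
    have := hsumY m (fun _ => 1) (fun _ _ => rfl)
    simpa using this
  have hmon : ∀ n : ℕ, Tendsto (fun m => (∑ i, e m i ^ n) / ((Λ m).card : ℝ)) atTop
      (nhds (∑ σ ∈ 𝓕, (((Δ ^ n) (delta σ) : ∀ _ : I, ℂ) σ).re)) := by
    intro n
    rw [tendsto_iff_dist_tendsto_zero]
    have hlim := (hreg n).mul_const (2 * R ^ n)
    rw [zero_mul] at hlim
    refine squeeze_zero (fun _ => dist_nonneg) (fun m => ?_) hlim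
    have h1 := aux_trace_compare Δ hΔloc (Y m) (Δm m) (hΔm m).1 (hΔmloc m) (hΔmagree m) R hR1
      (hrow m) hΔR n
    rw [hsumY m _ (fun g σ => by
      rw [aux_pow_equiv hiso hballfin Δ hΔequiv hΔloc n g σ σ])] at h1
    rw [Real.dist_eq]
    have h2 : (∑ i, e m i ^ n) / ((Λ m).card : ℝ) -
        ∑ σ ∈ 𝓕, (((Δ ^ n) (delta σ) : ∀ _ : I, ℂ) σ).re =
        (∑ i, e m i ^ n - (Λ m).card * ∑ σ ∈ 𝓕, (((Δ ^ n) (delta σ) : ∀ _ : I, ℂ) σ).re) /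
          ((Λ m).card : ℝ) := by
      have := (hN m).ne'
      field_simp
    rw [h2, abs_div, abs_of_pos (hN m), div_mul_eq_mul_div]
    exact div_le_div_of_nonneg_right h1 (hN m).le
  have hlim := fun f hf => aux_limit 𝓕 Δ hsa R hΔR (fun m => Y m) e heR
    (fun m => ((Λ m).card : ℝ)) hN hcard hmon f hf
  have hFdiff : ∀ m lam, 0 ≤ lam → F m lam - F m 0 =
      ((Finset.univ.filter fun i : Y m => 0 < e m i ∧ e m i ≤ lam).card : ℝ) / (Λ m).card := by
    intro m lam hlam
    rw [hF, hF, ← sub_div]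
    congr 1
    rw [sub_eq_iff_eq_add, ← Nat.cast_add, ← Finset.card_union_of_disjoint]
    · congr 2
      ext i
      simp only [Finset.mem_filter, Finset.mem_univ, true_and, Finset.mem_union]
      constructor
      · intro h
        rcases le_or_gt (e m i) 0 with h0 | h0
        · exact Or.inr h0
        · exact Or.inl ⟨h0, h⟩
      · rintro (h | h)
        · exact h.2
        · exact le_trans h hlam
    · rw [Finset.disjoint_left]
      intro i hi hi2
      simp only [Finset.mem_filter, Finset.mem_univ, true_and] at hi hi2
      exact absurd hi2 (not_le.2 hi.1)
  have hFnn : ∀ m lam, 0 ≤ lam → 0 ≤ F m lam - F m 0 := by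
    intro m lam hlam
    rw [hFdiff m lam hlam]
    positivity
  constructor
  · rintro ⟨ε, hε, hgap⟩
    refine ⟨ε / 2, by positivity, ?_⟩
    -- the bump function
    set f : ℝ → ℝ := fun t => max 0 (t * (ε - t)) with hf
    have hfc : Continuous f := by fun_prop
    have hf0 : hcfc f Δ = 0 := by
      apply hcfc_eq_zero
      intro x hx
      have hx2 : x ∉ Set.Ioc 0 ε := fun h => hgap x h hx
      simp only [hf, max_eq_left_iff]
      rw [Set.mem_Ioc, not_and_or, not_lt, not_le] at hx2
      rcases hx2 with h | h
      · exact mul_nonpos_of_nonpos_of_nonneg h (by linarith)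
      · exact mul_nonpos_of_nonneg_of_nonpos (by linarith) (by linarith)
    have hl := hlim f hfc
    rw [hf0] at hl
    have hl0 : Tendsto (fun m => (∑ i, f (e m i)) / ((Λ m).card : ℝ)) atTop (nhds 0) := by
      simpa using hl
    have hkey : ∀ δ : ℝ, 0 < δ → δ < 1 → ∀ m, F m (ε / 2) - F m 0 ≤
        (𝓕.card * Real.log R) / Real.log (1 / δ) +
          (2 / (δ * ε)) * ((∑ i, f (e m i)) / ((Λ m).card : ℝ)) := by
      intro δ hδ hδ1 m
      have hlog : 0 < Real.log (1 / δ) := Real.log_pos (by rw [lt_div_iff₀ hδ]; linarith)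
      have h1 := aux_luck (hΔm m) (fun i j => (hΔmint m i j).imp fun z hz => hz.1) R hR1 (hrow m) δ hδ
      rw [hcard m] at h1
      have h2 : ((Finset.univ.filter fun i : Y m => δ < e m i ∧ e m i ≤ ε / 2).card : ℝ) *
          (δ * ε / 2) ≤ ∑ i, f (e m i) := by
        rw [← nsmul_eq_mul, ← Finset.sum_const]
        refine (Finset.sum_le_sum (g := fun i => f (e m i)) fun i hi => ?_).trans
          (Finset.sum_le_sum_of_subset_of_nonneg (Finset.filter_subset _ _)
            fun i _ _ => le_max_left _ _)
        simp only [Finset.mem_filter, Finset.mem_univ, true_and] at hi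
        refine le_trans ?_ (le_max_right _ _)
        nlinarith [hi.1, hi.2]
      have h3 : ((Finset.univ.filter fun i : Y m => 0 < e m i ∧ e m i ≤ ε / 2).card : ℝ) ≤
          ((Finset.univ.filter fun i : Y m => 0 < e m i ∧ e m i ≤ δ).card : ℝ) +
          ((Finset.univ.filter fun i : Y m => δ < e m i ∧ e m i ≤ ε / 2).card : ℝ) := by
        rw [← Nat.cast_add, Nat.cast_le]
        refine le_trans (Finset.card_le_card ?_) (Finset.card_union_le _ _)
        intro i hi
        simp only [Finset.mem_filter, Finset.mem_univ, true_and, Finset.mem_union] at hi ⊢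
        rcases le_or_gt (e m i) δ with h | h
        · exact Or.inl ⟨hi.1, h⟩
        · exact Or.inr ⟨h, hi.2⟩
      rw [hFdiff m _ (by positivity), div_le_iff₀ (hN m)]
      refine h3.trans ?_
      have h4 : ((Finset.univ.filter fun i : Y m => 0 < e m i ∧ e m i ≤ δ).card : ℝ) ≤
          (𝓕.card * Real.log R) / Real.log (1 / δ) * (Λ m).card := by
        rw [div_mul_eq_mul_div, le_div_iff₀ hlog]
        refine h1.trans (le_of_eq (by ring))
      have h5 : ((Finset.univ.filter fun i : Y m => δ < e m i ∧ e m i ≤ ε / 2).card : ℝ) ≤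
          (2 / (δ * ε)) * ∑ i, f (e m i) := by
        rw [div_mul_eq_mul_div, le_div_iff₀ (by positivity)]
        linarith
      have h6 : (2 / (δ * ε)) * ((∑ i, f (e m i)) / ((Λ m).card : ℝ)) * (Λ m).card =
          (2 / (δ * ε)) * ∑ i, f (e m i) := by
        have := (hN m).ne'
        field_simp
      rw [add_mul, h6]
      exact add_le_add h4 h5
    rw [Metric.tendsto_atTop]
    intro η hη
    -- choose δ
    set c : ℝ := 𝓕.card * Real.log R with hc
    have hc0 : 0 ≤ c := mul_nonneg (by positivity) (Real.log_nonneg hR1)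
    set T : ℝ := 2 * c / η + 1 with hT
    have hT0 : 0 < T := by positivity
    have hδ1 : Real.exp (-T) < 1 := by rw [Real.exp_lt_one_iff]; linarith
    have hlogδ : Real.log (1 / Real.exp (-T)) = T := by
      rw [one_div, Real.log_inv, Real.log_exp, neg_neg]
    have hcT : c / T < η / 2 := by
      rw [div_lt_iff₀ hT0, hT]
      have : η / 2 * (2 * c / η + 1) = c + η / 2 := by field_simp
      linarith
    have hl1 := hl0.const_mul (2 / (Real.exp (-T) * ε))
    rw [mul_zero, Metric.tendsto_atTop] at hl1
    obtain ⟨M, hM⟩ := hl1 (η / 2) (by positivity)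
    refine ⟨M, fun m hm => ?_⟩
    have h1 := hkey (Real.exp (-T)) (Real.exp_pos _) hδ1 m
    rw [hlogδ] at h1
    have h2 := hM m hm
    rw [Real.dist_eq, sub_zero, abs_lt] at h2
    rw [Real.dist_eq, sub_zero, abs_of_nonneg (hFnn m _ (by positivity))]
    linarith [h2.2]
  · rintro ⟨lam, hlam, hlim0⟩
    refine ⟨lam / 2, by positivity, ?_⟩
    set h : ℝ → ℝ := fun t => Real.sqrt (max 0 (t * (lam - t))) with hh
    have hhc : Continuous h := by fun_prop
    have hsq : ∀ t, h t * h t = max 0 (t * (lam - t)) := fun t =>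
      Real.mul_self_sqrt (le_max_left _ _)
    have hl := hlim (fun t => h t * h t) (hhc.mul hhc)
    have hl0 : Tendsto (fun m => (∑ i, h (e m i) * h (e m i)) / ((Λ m).card : ℝ)) atTop (nhds 0) := by
      have hb := hlim0.mul_const (lam ^ 2)
      rw [zero_mul] at hb
      refine squeeze_zero (fun m => ?_) (fun m => ?_) hb
      · exact div_nonneg (Finset.sum_nonneg fun i _ => mul_self_nonneg _) (hN m).le
      · rw [hFdiff m _ hlam.le, div_mul_eq_mul_div]
        refine div_le_div_of_nonneg_right ?_ (hN m).le
        rw [← nsmul_eq_mul, ← Finset.sum_const, Finset.sum_filter]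
        refine Finset.sum_le_sum fun i _ => ?_
        rw [hsq]
        have := he0 m i
        split_ifs with hi
        · refine max_le (by positivity) ?_
          nlinarith [hi.1, hi.2]
        · refine max_le le_rfl ?_
          rw [not_and_or, not_lt, not_le] at hi
          rcases hi with hi | hi
          · have : e m i = 0 := le_antisymm hi this
            simp [this]
          · exact mul_nonpos_of_nonneg_of_nonpos this (by linarith)
    have hz := tendsto_nhds_unique hl hl0
    simp only [aux_cfc_sq Δ h hhc] at hz
    rw [Finset.sum_eq_zero_iff_of_nonneg (fun _ _ => by positivity)] at hz
    have hop : hcfc h Δ = 0 := by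
      apply aux_op_zero
      intro σ
      obtain ⟨τ, ⟨hτ, g, hg⟩, -⟩ := hfund σ
      have h1 := aux_cfc_equiv hiso hballfin Δ hsa hΔequiv hΔloc (fun t => h t * h t)
        (hhc.mul hhc) g σ
      rw [aux_cfc_sq Δ h hhc, aux_cfc_sq Δ h hhc, hg, hz τ hτ] at h1
      have h2 := pow_eq_zero_iff (two_ne_zero) |>.1 h1.symm
      exact norm_eq_zero.1 h2
    intro μ hμ hspec
    have h1 := hcfc_zero_spec Δ hsa h hhc hop μ hspec
    have h2 := hsq μ
    rw [h1, zero_mul] at h2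
    have h3 : 0 < μ * (lam - μ) := mul_pos hμ.1 (by linarith [hμ.2])
    have h4 := le_max_right 0 (μ * (lam - μ))
    linarith
end
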